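/- arXiv:0907.4534 — 9 statements merged into one kernel-verified Lean document; each statement's English description precedes it below -/
import Mathlib

section
/- For every real α > 1 there exists a positive constant R(α), depending only on α, with the following property: for every completely multiplicative function f : ℕ → ℂ with |f(m)| ≤ 1 for all m, and every integer n ≥ 2, |(1/n) Σ_{m=1}^n f(m) − Π_{p≤n} (1 − 1/p)/(1 − f(p)/p)| ≤ R(α) · μ_n(α), where μ_n(α) = ((1/log n) Σ_{p≤n} |f(p) − 1|^α (log p)/p)^{1/α}, the sum and product being over primes p ≤ n. -/
open Filter Finset

open ArithmeticFunction in
theorem sum_Ioc_mul_weight_eq_sum_sum {R : Type*} [CommSemiring R] (f g : ArithmeticFunction R)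
    (w : ℕ → R) (N : ℕ) :
    ∑ n ∈ Ioc 0 N, (f * g) n * w n =
      ∑ d ∈ Ioc 0 N, f d * ∑ k ∈ Ioc 0 (N / d), g k * w (d * k) := by
  have h1 : ∀ n ∈ Ioc 0 N, (f * g) n * w n =
      ∑ x ∈ Ioc 0 N ×ˢ Ioc 0 N with x.1 * x.2 = n, f x.1 * g x.2 * w (x.1 * x.2) := by
    intro n hn
    simp only [mem_Ioc] at hn
    rw [mul_apply, Nat.divisorsAntidiagonal_eq_prod_filter_of_le hn.1.ne' hn.2, sum_mul]
    exact sum_congr rfl fun x hx ↦ by rw [(mem_filter.mp hx).2]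
  rw [sum_congr rfl h1]
  simp_rw [sum_filter]
  rw [sum_comm, sum_product]
  refine sum_congr rfl fun d hd ↦ ?_
  simp only [mem_Ioc] at hd
  have h2 : Ioc 0 (N / d) = (Ioc 0 N).filter (fun k ↦ d * k ≤ N) := by
    ext k
    simp only [mem_filter, mem_Ioc]
    rw [Nat.le_div_iff_mul_le hd.1, mul_comm k d]
    refine ⟨fun h ↦ ⟨⟨h.1, (Nat.le_mul_of_pos_left k hd.1).trans h.2⟩, h.2⟩, fun h ↦ ⟨h.1.1, h.2⟩⟩
  rw [h2, mul_sum, sum_filter]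
  refine sum_congr rfl fun k hk ↦ ?_
  simp only [mem_Ioc] at hk
  have : 0 < d * k := Nat.mul_pos hd.1 hk.1
  simp [this, mul_assoc]

theorem log_add_one_le_harmonic_real (n : ℕ) : Real.log (n + 1) ≤ (harmonic n : ℝ) := by
  exact_mod_cast log_add_one_le_harmonic n

theorem one_le_harmonic_real {n : ℕ} (hn : 1 ≤ n) : (1 : ℝ) ≤ (harmonic n : ℝ) := by
  rw [harmonic_eq_sum_Icc]
  push_cast
  calc (1 : ℝ) = ∑ i ∈ Icc 1 1, ((i : ℕ) : ℝ)⁻¹ := by simp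
    _ ≤ _ := sum_le_sum_of_subset_of_nonneg (Icc_subset_Icc_right hn) (fun _ _ _ ↦ by positivity)

theorem harmonic_sub_log_antitone {k N : ℕ} (hk : 1 ≤ k) (hkN : k ≤ N) :
    (harmonic N : ℝ) - Real.log N ≤ harmonic k - Real.log k := by
  have := Real.strictAnti_eulerMascheroniSeq'.antitone hkN
  simpa [Real.eulerMascheroniSeq', show N ≠ 0 by lia, show k ≠ 0 by lia] using this

theorem harmonic_sub_log_le {k N : ℕ} (hk : 1 ≤ k) (hkN : k ≤ N) :
    (k : ℝ) * ((harmonic k - Real.log k) - (harmonic N - Real.log N)) ≤ 1 := by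
  have h1 := Real.strictMono_eulerMascheroniSeq.monotone hkN
  simp only [Real.eulerMascheroniSeq] at h1
  have hk0 : (0 : ℝ) < k := by exact_mod_cast hk
  have hN0 : (0 : ℝ) < N := by exact_mod_cast hk.trans hkN
  have h2 : Real.log N ≤ Real.log (N + 1) := Real.log_le_log hN0 (by linarith)
  have h3 : Real.log (k + 1) - Real.log k ≤ 1 / k := by
    rw [← Real.log_div (by positivity) hk0.ne']
    refine (Real.log_le_sub_one_of_pos (by positivity)).trans (le_of_eq ?_)
    field_simp
    ring
  calc (k : ℝ) * ((harmonic k - Real.log k) - (harmonic N - Real.log N)) ≤ k * (1 / k) := by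
        gcongr; linarith
    _ = 1 := by field_simp

theorem abs_harmonic_defect_le {d N : ℕ} (hd : 1 ≤ d) (hdN : d ≤ N) :
    |((N / d : ℕ) : ℝ) * (harmonic N - Real.log d) - N / d * harmonic (N / d)| ≤
      4 * harmonic (N / d) := by
  set k := N / d with hk
  have hk1 : 1 ≤ k := (Nat.one_le_div_iff hd).mpr hdN
  have hkN : k ≤ N := Nat.div_le_self N d
  have hk0 : (0 : ℝ) < k := by exact_mod_cast hk1
  have hd0 : (0 : ℝ) < d := by exact_mod_cast hd
  have hN0 : (0 : ℝ) < N := by exact_mod_cast hk1.trans hkN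
  set y : ℝ := (N : ℝ) / d with hy
  have hky : (k : ℝ) ≤ y := Nat.cast_div_le
  have hyk : y ≤ k + 1 := by
    rw [hy, div_le_iff₀ hd0]
    have : N < (N / d + 1) * d := by rw [mul_comm]; exact Nat.lt_mul_div_succ N hd
    exact_mod_cast this.le
  have hy0 : 0 < y := hk0.trans_le hky
  have hlogy : Real.log y = Real.log N - Real.log d := Real.log_div hN0.ne' hd0.ne'
  have e1 := harmonic_sub_log_antitone hk1 hkN
  have e2 := harmonic_sub_log_le hk1 hkN
  have e3 : Real.log y - Real.log k ≤ (y - k) / k := by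
    rw [← Real.log_div hy0.ne' hk0.ne']
    refine (Real.log_le_sub_one_of_pos (by positivity)).trans (le_of_eq ?_)
    field_simp
  have e3' : (k : ℝ) * (Real.log y - Real.log k) ≤ y - k := by
    calc (k : ℝ) * (Real.log y - Real.log k) ≤ k * ((y - k) / k) := by gcongr
      _ = y - k := by field_simp
  have e4 : 0 ≤ (k : ℝ) * (Real.log y - Real.log k) :=
    mul_nonneg hk0.le (sub_nonneg.mpr (Real.log_le_log hk0 hky))
  have e5 : 0 ≤ (k : ℝ) * ((harmonic k - Real.log k) - (harmonic N - Real.log N)) :=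
    mul_nonneg hk0.le (by linarith)
  have e6 : (1 : ℝ) ≤ harmonic k := one_le_harmonic_real hk1
  have e7 : 0 ≤ (y - k) * (harmonic k : ℝ) := mul_nonneg (by linarith) (by linarith)
  have e8 : (y - k) * (harmonic k : ℝ) ≤ 1 * harmonic k := by gcongr; linarith
  have key : (k : ℝ) * (harmonic N - Real.log d) - y * harmonic k =
      k * (Real.log y - Real.log k)
        - k * ((harmonic k - Real.log k) - (harmonic N - Real.log N))
        - (y - k) * harmonic k := by
    rw [hlogy]; ring
  rw [key, abs_le]
  constructor <;> linarith

open ArithmeticFunction ArithmeticFunction.zeta ArithmeticFunction.Moebius in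
theorem mean_defect_identity (F : ArithmeticFunction ℂ) (hmul : ∀ m n, F (m * n) = F m * F n)
    (N : ℕ) :
    (∑ m ∈ Ioc 0 N, F m) * (harmonic N : ℝ) - N * ∑ m ∈ Ioc 0 N, F m / m =
      ∑ q ∈ Ioc 0 N, (Λ q : ℂ) * (F q - 1) * ∑ m ∈ Ioc 0 (N / q), F m +
      ∑ d ∈ Ioc 0 N, (F * (μ : ArithmeticFunction ℂ)) d *
        ((((N / d : ℕ) : ℝ) * (harmonic N - Real.log d) - N / d * harmonic (N / d) : ℝ) : ℂ) := by
  set g : ArithmeticFunction ℂ := F * (μ : ArithmeticFunction ℂ) with hg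
  have hF : F = g * (ζ : ArithmeticFunction ℂ) := by
    rw [hg, mul_assoc, coe_moebius_mul_coe_zeta, mul_one]
  let L : ArithmeticFunction ℂ := ⟨fun n ↦ (Λ n : ℂ), by simp⟩
  let lg : ArithmeticFunction ℂ := ⟨fun n ↦ (Real.log n : ℂ), by simp⟩
  have hL : L * (ζ : ArithmeticFunction ℂ) = lg := by
    ext n
    rw [coe_mul_zeta_apply]
    change ∑ i ∈ n.divisors, ((Λ i : ℝ) : ℂ) = (Real.log n : ℂ)
    rw [← vonMangoldt_sum]; push_cast; rfl
  have ha : ∑ m ∈ Ioc 0 N, F m = ∑ d ∈ Ioc 0 N, g d * ((N / d : ℕ) : ℂ) := by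
    conv_lhs => rw [hF]
    exact sum_Ioc_mul_zeta_eq_sum g N
  have hw : ∀ w : ℕ → ℂ, ∑ m ∈ Ioc 0 N, F m * w m =
      ∑ d ∈ Ioc 0 N, g d * ∑ k ∈ Ioc 0 (N / d), w (d * k) := by
    intro w
    conv_lhs => rw [hF]
    rw [sum_Ioc_mul_weight_eq_sum_sum]
    refine sum_congr rfl fun d _ ↦ ?_
    congr 1
    refine sum_congr rfl fun k hk ↦ ?_
    simp [natCoe_apply, zeta_apply, (mem_Ioc.mp hk).1.ne']
  have hb : ∑ m ∈ Ioc 0 N, F m / m = ∑ d ∈ Ioc 0 N, g d * ((harmonic (N / d) : ℝ) / d : ℂ) := by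
    simp_rw [div_eq_mul_inv]
    rw [hw]
    refine sum_congr rfl fun d _ ↦ ?_
    congr 1
    rw [harmonic_eq_sum_Icc]
    push_cast
    rw [sum_mul]
    exact sum_congr rfl fun k _ ↦ by rw [mul_inv]; ring
  have hc : ∑ q ∈ Ioc 0 N, (Λ q : ℂ) * F q * ∑ m ∈ Ioc 0 (N / q), F m =
      ∑ m ∈ Ioc 0 N, F m * (Real.log m : ℂ) := by
    have h := sum_Ioc_mul_weight_eq_sum_sum L (ζ : ArithmeticFunction ℂ) F N
    rw [hL] at h
    calc _ = _ := ?_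
      _ = _ := h.symm
      _ = _ := sum_congr rfl fun m _ ↦ mul_comm _ _
    refine sum_congr rfl fun q _ ↦ ?_
    rw [mul_assoc, mul_sum]
    congr 1
    refine sum_congr rfl fun k hk ↦ ?_
    simp [natCoe_apply, zeta_apply, (mem_Ioc.mp hk).1.ne', hmul]
  have hd : ∑ q ∈ Ioc 0 N, (Λ q : ℂ) * ∑ m ∈ Ioc 0 (N / q), F m =
      ∑ d ∈ Ioc 0 N, g d * ∑ k ∈ Ioc 0 (N / d), (Real.log k : ℂ) := by
    rw [show (∑ q ∈ Ioc 0 N, (Λ q : ℂ) * ∑ m ∈ Ioc 0 (N / q), F m) = _ from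
      (sum_Ioc_mul_eq_sum_sum L F N).symm, show (∑ d ∈ Ioc 0 N, g d *
      ∑ k ∈ Ioc 0 (N / d), (Real.log k : ℂ)) = _ from
      (sum_Ioc_mul_eq_sum_sum g lg N).symm]
    have h : L * F = g * lg := by
      rw [← hL]
      conv_lhs => rw [hF]
      rw [mul_left_comm]
    rw [h]
  have hE : ∑ q ∈ Ioc 0 N, (Λ q : ℂ) * (F q - 1) * ∑ m ∈ Ioc 0 (N / q), F m =
      ∑ d ∈ Ioc 0 N, g d * (((N / d : ℕ) : ℂ) * Real.log d) := by
    have : ∑ q ∈ Ioc 0 N, (Λ q : ℂ) * (F q - 1) * ∑ m ∈ Ioc 0 (N / q), F m =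
        ∑ q ∈ Ioc 0 N, (Λ q : ℂ) * F q * ∑ m ∈ Ioc 0 (N / q), F m -
        ∑ q ∈ Ioc 0 N, (Λ q : ℂ) * ∑ m ∈ Ioc 0 (N / q), F m := by
      rw [← sum_sub_distrib]
      exact sum_congr rfl fun q _ ↦ by ring
    rw [this, hc, hd, hw, ← sum_sub_distrib]
    refine sum_congr rfl fun d hd ↦ ?_
    rw [← mul_sub, ← sum_sub_distrib]
    congr 1
    rw [sum_congr rfl (g := fun _ ↦ (Real.log d : ℂ))]
    · simp
    · intro k hk
      have hk0 : (k : ℝ) ≠ 0 := by exact_mod_cast (mem_Ioc.mp hk).1.ne'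
      have hd0 : (d : ℝ) ≠ 0 := by exact_mod_cast (mem_Ioc.mp hd).1.ne'
      rw [Nat.cast_mul, Real.log_mul hd0 hk0]
      push_cast; ring
  rw [hE, ha, hb, sum_mul, mul_sum, ← sum_sub_distrib, ← sum_add_distrib]
  refine sum_congr rfl fun d _ ↦ ?_
  push_cast
  ring

theorem norm_pow_sub_one_le {z : ℂ} (hz : ‖z‖ ≤ 1) (k : ℕ) : ‖z ^ k - 1‖ ≤ k * ‖z - 1‖ := by
  rw [← mul_geom_sum, norm_mul, mul_comm]
  gcongr
  refine (norm_sum_le _ _).trans ?_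
  calc ∑ i ∈ range k, ‖z ^ i‖ ≤ ∑ i ∈ range k, 1 :=
        sum_le_sum fun i _ ↦ by rw [norm_pow]; exact pow_le_one₀ (norm_nonneg _) hz
    _ = k := by simp

theorem sum_Icc_mul_half_pow_le (M : ℕ) :
    ∑ k ∈ Icc 1 M, (k : ℝ) * (1 / 2) ^ (k - 1) ≤ 4 := by
  have : ∑ k ∈ Icc 1 M, (k : ℝ) * (1 / 2) ^ (k - 1) = 4 - (2 * M + 4) * (1 / 2) ^ M := by
    induction M with
    | zero => norm_num
    | succ M ih =>
      rw [sum_Icc_succ_top (by lia), ih, Nat.add_sub_cancel, pow_succ]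
      push_cast; ring
  rw [this]
  have : 0 ≤ (2 * M + 4 : ℝ) * (1 / 2) ^ M := by positivity
  linarith

theorem sum_Icc_div_prime_pow_le {p : ℕ} (hp : p.Prime) (M : ℕ) :
    ∑ k ∈ Icc 1 M, (k : ℝ) / (p : ℝ) ^ k ≤ 4 / p := by
  have hp2 : (2 : ℝ) ≤ p := by exact_mod_cast hp.two_le
  calc ∑ k ∈ Icc 1 M, (k : ℝ) / (p : ℝ) ^ k
      ≤ ∑ k ∈ Icc 1 M, (1 / p : ℝ) * ((k : ℝ) * (1 / 2) ^ (k - 1)) := by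
        refine sum_le_sum fun k hk ↦ ?_
        obtain ⟨j, rfl⟩ : ∃ j, k = j + 1 := ⟨k - 1, by grind⟩
        have : (1 / p : ℝ) ^ j ≤ (1 / 2) ^ j := by gcongr
        rw [Nat.add_sub_cancel]
        calc ((j + 1 : ℕ) : ℝ) / (p : ℝ) ^ (j + 1)
            = 1 / p * (((j + 1 : ℕ) : ℝ) * (1 / p) ^ j) := by
              rw [one_div_pow, pow_succ]; field_simp
          _ ≤ _ := by gcongr
    _ = 1 / p * ∑ k ∈ Icc 1 M, ((k : ℝ) * (1 / 2) ^ (k - 1)) := by rw [mul_sum]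
    _ ≤ 1 / p * 4 := by gcongr; exact sum_Icc_mul_half_pow_le M
    _ = 4 / p := by ring

/-- The weighted `ℓ¹` distance `∑_{p ≤ n} |F p - 1| log p / p` of `F` from `1` on the primes
up to `n`. -/
noncomputable def primeDistance (F : ℕ → ℂ) (n : ℕ) : ℝ :=
  ∑ p ∈ (range (n + 1)).filter Nat.Prime, ‖F p - 1‖ * Real.log p / p

theorem primeDistance_nonneg (F : ℕ → ℂ) (n : ℕ) : 0 ≤ primeDistance F n :=
  sum_nonneg fun _ _ ↦ by positivity

theorem sum_primes_norm_sub_one_mul_le {F : ℕ → ℂ} {n : ℕ} (hF : ∀ p, p.Prime → n < p → F p = 1)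
    (w : ℕ → ℝ) (hw : ∀ p, 0 ≤ w p) (N : ℕ) :
    ∑ p ∈ (Ioc 0 N).filter Nat.Prime, ‖F p - 1‖ * w p ≤
      ∑ p ∈ (range (n + 1)).filter Nat.Prime, ‖F p - 1‖ * w p := by
  rw [← sum_filter_add_sum_filter_not _ (fun p ↦ p ≤ n)]
  have : ∑ p ∈ ((Ioc 0 N).filter Nat.Prime).filter (fun p ↦ ¬ p ≤ n), ‖F p - 1‖ * w p = 0 := by
    refine sum_eq_zero fun p hp ↦ ?_
    simp only [mem_filter, not_le] at hp
    simp [hF p hp.1.2 hp.2]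
  rw [this, add_zero]
  refine sum_le_sum_of_subset_of_nonneg (fun p hp ↦ ?_)
    (fun p _ _ ↦ mul_nonneg (norm_nonneg _) (hw p))
  simp only [mem_filter, mem_range] at hp ⊢
  exact ⟨by lia, hp.1.2⟩

open ArithmeticFunction in
theorem sum_vonMangoldt_mul_norm_le {F : ℕ → ℂ} (h1 : F 1 = 1)
    (hmul : ∀ m n, F (m * n) = F m * F n)
    (hb : ∀ m, ‖F m‖ ≤ 1) {n : ℕ} (hF : ∀ p, p.Prime → n < p → F p = 1) (N : ℕ) :
    ∑ q ∈ Ioc 0 N, Λ q * ‖F q - 1‖ / q ≤ 4 * primeDistance F n := by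
  have hpow : ∀ p k, F (p ^ k) = F p ^ k := by
    intro p k
    induction k with
    | zero => simp [h1]
    | succ k ih => rw [pow_succ, hmul, ih, pow_succ]
  set f : ℕ → ℝ := fun q ↦ Λ q * ‖F q - 1‖ / q with hf
  have hf0 : ∀ q, 0 ≤ f q := fun q ↦
    div_nonneg (mul_nonneg vonMangoldt_nonneg (norm_nonneg _)) (Nat.cast_nonneg _)
  have e1 : ∑ q ∈ Ioc 0 N, f q = ∑ q ∈ Ioc 0 N with IsPrimePow q, f q := by
    rw [sum_filter]
    refine sum_congr rfl fun q _ ↦ ?_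
    split_ifs with h
    · rfl
    · simp [hf, vonMangoldt_eq_zero_iff.mpr h]
  have e2 := Chebyshev.sum_PrimePow_eq_sum_sum f (x := N) (Nat.cast_nonneg N)
  rw [Nat.floor_natCast] at e2
  rw [e1, e2]
  set M := ⌊Real.log N / Real.log 2⌋₊
  calc ∑ k ∈ Icc 1 M, ∑ p ∈ Ioc 0 ⌊(N : ℝ) ^ ((1 : ℝ) / k)⌋₊ with p.Prime, f (p ^ k)
      ≤ ∑ k ∈ Icc 1 M, ∑ p ∈ (Ioc 0 N).filter Nat.Prime,
          (‖F p - 1‖ * Real.log p) * (k / (p : ℝ) ^ k) := by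
        refine sum_le_sum fun k hk ↦ ?_
        have hk1 : 1 ≤ k := (mem_Icc.mp hk).1
        have hsub : (Ioc 0 ⌊(N : ℝ) ^ ((1 : ℝ) / k)⌋₊).filter Nat.Prime ⊆
            (Ioc 0 N).filter Nat.Prime := by
          refine filter_subset_filter _ (Ioc_subset_Ioc_right ?_)
          rcases Nat.eq_zero_or_pos N with rfl | hN
          · rw [Nat.cast_zero, Real.zero_rpow (by positivity)]; simp
          · refine Nat.floor_le_of_le ?_
            calc (N : ℝ) ^ ((1 : ℝ) / k) ≤ (N : ℝ) ^ (1 : ℝ) := by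
                  apply Real.rpow_le_rpow_of_exponent_le
                  · exact_mod_cast hN
                  · rw [div_le_one (by positivity)]; exact_mod_cast hk1
              _ = N := Real.rpow_one _
        refine (sum_le_sum_of_subset_of_nonneg hsub fun _ _ _ ↦ hf0 _).trans ?_
        refine sum_le_sum fun p hp ↦ ?_
        have hpp := (mem_filter.mp hp).2
        simp only [hf]
        rw [vonMangoldt_apply_pow (by lia), vonMangoldt_apply_prime hpp, hpow]
        have hlog : 0 ≤ Real.log p := Real.log_natCast_nonneg p
        calc Real.log p * ‖F p ^ k - 1‖ / ((p ^ k : ℕ) : ℝ)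
            ≤ Real.log p * (k * ‖F p - 1‖) / ((p ^ k : ℕ) : ℝ) := by
              gcongr; exact norm_pow_sub_one_le (hb p) k
          _ = _ := by push_cast; ring
    _ = ∑ p ∈ (Ioc 0 N).filter Nat.Prime, ‖F p - 1‖ *
          (Real.log p * ∑ k ∈ Icc 1 M, (k / (p : ℝ) ^ k)) := by
        rw [sum_comm]
        exact sum_congr rfl fun p _ ↦ by rw [← mul_sum]; ring
    _ ≤ ∑ p ∈ (Ioc 0 N).filter Nat.Prime, ‖F p - 1‖ * (4 * (Real.log p / p)) := by
        refine sum_le_sum fun p hp ↦ ?_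
        have hpp := (mem_filter.mp hp).2
        have hlog : 0 ≤ Real.log p := Real.log_natCast_nonneg p
        have := sum_Icc_div_prime_pow_le hpp M
        calc ‖F p - 1‖ * (Real.log p * ∑ k ∈ Icc 1 M, (k / (p : ℝ) ^ k))
            ≤ ‖F p - 1‖ * (Real.log p * (4 / p)) := by gcongr
          _ = _ := by ring
    _ ≤ ∑ p ∈ (range (n + 1)).filter Nat.Prime, ‖F p - 1‖ * (4 * (Real.log p / p)) :=
        sum_primes_norm_sub_one_mul_le hF _ (fun p ↦ by positivity) N
    _ = 4 * primeDistance F n := by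
        rw [primeDistance, mul_sum]
        exact sum_congr rfl fun p _ ↦ by ring

/-- The multiplicative majorant `d ↦ ∏_{p ∣ d} |F p - 1|` of the Dirichlet quotient of `F`
by `1`. -/
noncomputable def defectMajorant (F : ℕ → ℂ) (d : ℕ) : ℝ := ∏ p ∈ d.primeFactors, ‖F p - 1‖

theorem defectMajorant_nonneg (F : ℕ → ℂ) (d : ℕ) : 0 ≤ defectMajorant F d :=
  prod_nonneg fun _ _ ↦ norm_nonneg _

theorem defectMajorant_one (F : ℕ → ℂ) : defectMajorant F 1 = 1 := by
  simp [defectMajorant]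

theorem defectMajorant_mul_of_coprime (F : ℕ → ℂ) {m n : ℕ} (h : m.Coprime n) :
    defectMajorant F (m * n) = defectMajorant F m * defectMajorant F n := by
  rw [defectMajorant, h.primeFactors_mul, prod_union h.disjoint_primeFactors]; rfl

theorem defectMajorant_prime_pow (F : ℕ → ℂ) {p : ℕ} (hp : p.Prime) {k : ℕ} (hk : k ≠ 0) :
    defectMajorant F (p ^ k) = ‖F p - 1‖ := by
  simp [defectMajorant, Nat.primeFactors_prime_pow hk hp]

theorem defectMajorant_primePow_mul_le {F : ℕ → ℂ} (hb : ∀ m, ‖F m‖ ≤ 1) {q m : ℕ}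
    (hq : IsPrimePow q) (hm : m ≠ 0) :
    defectMajorant F (q * m) ≤ 2 * defectMajorant F m := by
  obtain ⟨p, k, hp, hk, rfl⟩ := hq
  have hp' := hp.nat_prime
  have h0 := defectMajorant_nonneg F m
  have : (p ^ k * m).primeFactors = insert p m.primeFactors := by
    rw [Nat.primeFactors_mul (pow_ne_zero _ hp'.ne_zero) hm,
      Nat.primeFactors_prime_pow hk.ne' hp']
    rfl
  rw [defectMajorant, this]
  by_cases hpm : p ∈ m.primeFactors
  · rw [insert_eq_self.mpr hpm]
    change defectMajorant F m ≤ _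
    linarith
  · rw [prod_insert hpm]
    change _ * defectMajorant F m ≤ _
    gcongr
    calc ‖F p - 1‖ ≤ ‖F p‖ + ‖(1 : ℂ)‖ := norm_sub_le _ _
      _ ≤ 2 := by rw [norm_one]; linarith [hb p]

open ArithmeticFunction ArithmeticFunction.zeta ArithmeticFunction.Moebius in
theorem mul_moebius_prime_pow (F : ArithmeticFunction ℂ) (hmul : ∀ m n, F (m * n) = F m * F n)
    {p : ℕ} (hp : p.Prime) (k : ℕ) :
    (F * (μ : ArithmeticFunction ℂ)) (p ^ (k + 1)) = F (p ^ k) * (F p - 1) := by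
  set g : ArithmeticFunction ℂ := F * (μ : ArithmeticFunction ℂ) with hg
  have hF : F = g * (ζ : ArithmeticFunction ℂ) := by
    rw [hg, mul_assoc, coe_moebius_mul_coe_zeta, mul_one]
  have h : ∀ j, F (p ^ j) = ∑ i ∈ range (j + 1), g (p ^ i) := by
    intro j
    conv_lhs => rw [hF]
    rw [coe_mul_zeta_apply, Nat.sum_divisors_prime_pow hp]
  have h2 := h (k + 1)
  rw [sum_range_succ, ← h k, pow_succ, hmul] at h2
  rw [pow_succ, mul_sub, h2]
  ring

open ArithmeticFunction ArithmeticFunction.Moebius in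
theorem isMultiplicative_mul_moebius (F : ArithmeticFunction ℂ) (h1 : F 1 = 1)
    (hmul : ∀ m n, F (m * n) = F m * F n) :
    (F * (μ : ArithmeticFunction ℂ)).IsMultiplicative :=
  IsMultiplicative.mul ⟨h1, fun _ ↦ hmul _ _⟩ isMultiplicative_moebius.intCast

open ArithmeticFunction ArithmeticFunction.Moebius in
theorem norm_mul_moebius_le (F : ArithmeticFunction ℂ) (h1 : F 1 = 1)
    (hmul : ∀ m n, F (m * n) = F m * F n) (hb : ∀ m, ‖F m‖ ≤ 1) {d : ℕ} (hd : d ≠ 0) :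
    ‖(F * (μ : ArithmeticFunction ℂ)) d‖ ≤ defectMajorant F d := by
  rw [(isMultiplicative_mul_moebius F h1 hmul).multiplicative_factorization _ hd, Finsupp.prod,
    norm_prod, Nat.support_factorization, defectMajorant]
  refine prod_le_prod (fun _ _ ↦ norm_nonneg _) fun p hp ↦ ?_
  have hpp := Nat.prime_of_mem_primeFactors hp
  have hv : d.factorization p ≠ 0 := by
    rwa [← Nat.support_factorization, Finsupp.mem_support_iff] at hp
  obtain ⟨k, hk⟩ := Nat.exists_eq_succ_of_ne_zero hv
  rw [hk, Nat.succ_eq_add_one, mul_moebius_prime_pow F hmul hpp, norm_mul]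
  exact mul_le_of_le_one_left (norm_nonneg _) (hb _)

/-- The Euler product `∏_{p ≤ n} (1 + |F p - 1| / (p - 1))`. -/
noncomputable def defectEulerProduct (F : ℕ → ℂ) (n : ℕ) : ℝ :=
  ∏ p ∈ (range (n + 1)).filter Nat.Prime, (1 + ‖F p - 1‖ / ((p : ℝ) - 1))

theorem hasSum_defectMajorant_prime_pow (F : ℕ → ℂ) {p : ℕ} (hp : p.Prime) :
    HasSum (fun k : ℕ ↦ defectMajorant F (p ^ k) / ((p ^ k : ℕ) : ℝ))
      (1 + ‖F p - 1‖ / ((p : ℝ) - 1)) := by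
  have hp1 : (1 : ℝ) < p := by exact_mod_cast hp.one_lt
  have h := (hasSum_geometric_of_lt_one (r := 1 / (p : ℝ)) (by positivity)
    (by rw [div_lt_one (by positivity)]; exact hp1)).mul_left (‖F p - 1‖ / p)
  rw [← hasSum_nat_add_iff' 1]
  have hp1' : (p : ℝ) - 1 ≠ 0 := by linarith
  convert! h using 1
  · funext k
    rw [defectMajorant_prime_pow F hp (by lia), one_div_pow]
    push_cast
    rw [pow_succ]
    field_simp
  · simp only [range_one, sum_singleton, pow_zero, defectMajorant_one]
    rw [show 1 - 1 / (p : ℝ) = (p - 1) / p by field_simp]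
    push_cast
    field_simp
    ring

theorem defectMajorant_eq_zero_of_not_smooth {F : ℕ → ℂ} {n : ℕ}
    (hF : ∀ p, p.Prime → n < p → F p = 1) {d : ℕ} (hd : d ≠ 0)
    (h : d ∉ Nat.smoothNumbers (n + 1)) : defectMajorant F d = 0 := by
  rw [Nat.mem_smoothNumbers'] at h
  push Not at h
  obtain ⟨p, hp, hpd, hnp⟩ := h
  exact prod_eq_zero (Nat.mem_primeFactors.mpr ⟨hp, hpd, hd⟩) (by simp [hF p hp hnp])

theorem hasSum_defectMajorant_div {F : ℕ → ℂ} {n : ℕ}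
    (hF : ∀ p, p.Prime → n < p → F p = 1) :
    HasSum (fun d : ℕ ↦ defectMajorant F d / d) (defectEulerProduct F n) := by
  have h := (EulerProduct.summable_and_hasSum_smoothNumbers_prod_primesBelow_tsum
    (f := fun d : ℕ ↦ defectMajorant F d / d) (by simp [defectMajorant_one])
    (fun {m k} hmk ↦ by rw [defectMajorant_mul_of_coprime F hmk]; push_cast; ring)
    (fun {p} hp ↦ (hasSum_defectMajorant_prime_pow F hp).summable.norm) (n + 1)).2
  rw [Nat.primesBelow, prod_congr rfl (fun p hp ↦
    (hasSum_defectMajorant_prime_pow F (mem_filter.mp hp).2).tsum_eq)] at h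
  rw [← hasSum_subtype_iff_of_support_subset (s := Nat.smoothNumbers (n + 1))]
  · exact h
  · intro d hd
    by_contra hns
    refine hd ?_
    rcases eq_or_ne d 0 with rfl | hd0
    · simp
    · simp [defectMajorant_eq_zero_of_not_smooth hF hd0 hns]

theorem sum_Ioc_defectMajorant_div_le {F : ℕ → ℂ} {n : ℕ}
    (hF : ∀ p, p.Prime → n < p → F p = 1) (N : ℕ) :
    ∑ d ∈ Ioc 0 N, defectMajorant F d / d ≤ defectEulerProduct F n :=
  sum_le_hasSum _ (fun d _ ↦ div_nonneg (defectMajorant_nonneg F d) (Nat.cast_nonneg d))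
    (hasSum_defectMajorant_div hF)

open ArithmeticFunction ArithmeticFunction.zeta in
theorem sum_Ioc_defectMajorant_mul_log_le {F : ℕ → ℂ} {n : ℕ} (hb : ∀ m, ‖F m‖ ≤ 1)
    (hF : ∀ p, p.Prime → n < p → F p = 1) (M : ℕ) :
    ∑ d ∈ Ioc 0 M, defectMajorant F d * Real.log d ≤ 12 * M * defectEulerProduct F n := by
  let G : ArithmeticFunction ℝ := ⟨fun d ↦ if d = 0 then 0 else defectMajorant F d, by simp⟩
  have hG : ∀ d ∈ Ioc 0 M, G d = defectMajorant F d := fun d hd ↦ by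
    simp [G, (mem_Ioc.mp hd).1.ne']
  have hG' : ∀ d, d ≠ 0 → G d = defectMajorant F d := fun d hd ↦ by simp [G, hd]
  have hlog4 : Real.log 4 ≤ 2 := by
    have := Real.log_two_lt_d9
    rw [show (4 : ℝ) = 2 ^ 2 by norm_num, Real.log_pow]
    push_cast
    linarith
  calc ∑ d ∈ Ioc 0 M, defectMajorant F d * Real.log d
      = ∑ d ∈ Ioc 0 M, (Λ * (ζ : ArithmeticFunction ℝ)) d * defectMajorant F d := by
        rw [vonMangoldt_mul_zeta]
        exact sum_congr rfl fun d _ ↦ by rw [log_apply, mul_comm]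
    _ = ∑ q ∈ Ioc 0 M, Λ q * ∑ k ∈ Ioc 0 (M / q), defectMajorant F (q * k) := by
        rw [sum_Ioc_mul_weight_eq_sum_sum]
        refine sum_congr rfl fun q _ ↦ ?_
        congr 1
        refine sum_congr rfl fun k hk ↦ ?_
        simp [natCoe_apply, zeta_apply, (mem_Ioc.mp hk).1.ne']
    _ ≤ ∑ q ∈ Ioc 0 M, Λ q * ∑ k ∈ Ioc 0 (M / q), 2 * G k := by
        refine sum_le_sum fun q _ ↦ ?_
        by_cases hq : IsPrimePow q
        · refine mul_le_mul_of_nonneg_left (sum_le_sum fun k hk ↦ ?_) vonMangoldt_nonneg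
          have hk0 := (mem_Ioc.mp hk).1.ne'
          rw [hG' k hk0]
          exact defectMajorant_primePow_mul_le hb hq hk0
        · simp [vonMangoldt_eq_zero_iff.mpr hq]
    _ = 2 * ∑ q ∈ Ioc 0 M, (G * Λ) q := by
        rw [mul_comm G, sum_Ioc_mul_eq_sum_sum, mul_sum]
        exact sum_congr rfl fun q _ ↦ by rw [← mul_sum]; ring
    _ = 2 * ∑ k ∈ Ioc 0 M, G k * Chebyshev.psi (M / k : ℕ) := by
        rw [sum_Ioc_mul_eq_sum_sum]
        simp only [Chebyshev.psi, Nat.floor_natCast]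
    _ ≤ 2 * ∑ k ∈ Ioc 0 M, 6 * M * (defectMajorant F k / k) := by
        refine mul_le_mul_of_nonneg_left (sum_le_sum fun k hk ↦ ?_) (by norm_num)
        rw [hG k hk]
        have h0 := defectMajorant_nonneg F k
        calc defectMajorant F k * Chebyshev.psi (M / k : ℕ)
            ≤ defectMajorant F k * (6 * (M / k)) := by
              gcongr
              refine (Chebyshev.psi_le_const_mul_self (Nat.cast_nonneg _)).trans ?_
              have : ((M / k : ℕ) : ℝ) ≤ (M : ℝ) / k := Nat.cast_div_le
              gcongr
              linarith
          _ = _ := by ring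
    _ = 12 * M * ∑ k ∈ Ioc 0 M, defectMajorant F k / k := by rw [← mul_sum]; ring
    _ ≤ _ := by gcongr; exact sum_Ioc_defectMajorant_div_le hF M

theorem one_le_defectEulerProduct (F : ℕ → ℂ) (n : ℕ) : 1 ≤ defectEulerProduct F n := by
  refine one_le_prod fun p hp ↦ ?_
  have hp1 : (1 : ℝ) < p := by exact_mod_cast (mem_filter.mp hp).2.one_lt
  have : 0 ≤ ‖F p - 1‖ / ((p : ℝ) - 1) := div_nonneg (norm_nonneg _) (by linarith)
  linarith

theorem defectEulerProduct_sub_one_le {F : ℕ → ℂ} {n : ℕ} (h : primeDistance F n ≤ 1) :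
    defectEulerProduct F n - 1 ≤ 60 * primeDistance F n := by
  set η := primeDistance F n with hη
  have hη0 : 0 ≤ η := primeDistance_nonneg F n
  have h1 : defectEulerProduct F n ≤ Real.exp (4 * η) := by
    rw [hη, primeDistance, mul_sum, Real.exp_sum]
    refine prod_le_prod (fun p hp ↦ ?_) fun p hp ↦ ?_
    · have hp1 : (1 : ℝ) < p := by exact_mod_cast (mem_filter.mp hp).2.one_lt
      have : 0 ≤ ‖F p - 1‖ / ((p : ℝ) - 1) := div_nonneg (norm_nonneg _) (by linarith)
      linarith
    · have hp2 : (2 : ℝ) ≤ p := by exact_mod_cast (mem_filter.mp hp).2.two_le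
      rw [add_comm]
      refine le_trans ?_ (Real.add_one_le_exp _)
      gcongr
      have hlog : 1 / 2 ≤ Real.log p := by
        have := Real.log_two_gt_d9
        have := Real.log_le_log (by norm_num) hp2
        linarith
      rw [show 4 * (‖F p - 1‖ * Real.log p / p) = ‖F p - 1‖ * (4 * Real.log p / p) by ring,
        div_eq_mul_one_div]
      refine mul_le_mul_of_nonneg_left ?_ (norm_nonneg _)
      rw [div_le_div_iff₀ (by linarith) (by linarith)]
      nlinarith
  have h2 : Real.exp (4 * η) ≤ 1 + 60 * η := by
    have hc := convexOn_exp.2 (Set.mem_univ (0 : ℝ)) (Set.mem_univ (4 : ℝ))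
      (sub_nonneg.mpr h) hη0 (by ring)
    simp only [smul_eq_mul, mul_zero, zero_add, Real.exp_zero] at hc
    have he : Real.exp 4 ≤ 61 := by
      have := Real.exp_one_lt_d9
      rw [show (4 : ℝ) = ((4 : ℕ) : ℝ) * 1 by norm_num, Real.exp_nat_mul]
      calc Real.exp 1 ^ 4 ≤ 2.7182818286 ^ 4 := by gcongr
        _ ≤ 61 := by norm_num
    calc Real.exp (4 * η) = Real.exp (η * 4) := by rw [mul_comm]
      _ ≤ (1 - η) * 1 + η * Real.exp 4 := hc
      _ ≤ (1 - η) * 1 + η * 61 := by gcongr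
      _ = 1 + 60 * η := by ring
  linarith

theorem tsum_rpow_neg_le {δ : ℝ} (hδ : 0 < δ) :
    Summable (fun m : ℕ ↦ (m : ℝ) ^ (-(1 + δ))) ∧
      ∑' m : ℕ, (m : ℝ) ^ (-(1 + δ)) ≤ 1 + 1 / δ := by
  have hs : Summable (fun m : ℕ ↦ (m : ℝ) ^ (-(1 + δ))) :=
    Real.summable_nat_rpow.mpr (by linarith)
  refine ⟨hs, hs.tsum_le_of_sum_range_le fun n ↦ ?_⟩
  have step : ∀ m : ℕ, ((m + 2 : ℕ) : ℝ) ^ (-(1 + δ)) ≤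
      1 / δ * (((m + 1 : ℕ) : ℝ) ^ (-δ) - ((m + 2 : ℕ) : ℝ) ^ (-δ)) := by
    intro m
    have ha : (0 : ℝ) < ((m + 2 : ℕ) : ℝ) := by positivity
    have hb : (0 : ℝ) < ((m + 1 : ℕ) : ℝ) := by positivity
    have h1 : (1 : ℝ) + δ * (1 / ((m + 2 : ℕ) : ℝ)) ≤
        (((m + 1 : ℕ) : ℝ) / ((m + 2 : ℕ) : ℝ)) ^ (-δ) := by
      rw [Real.rpow_def_of_pos (by positivity)]
      refine le_trans ?_ (Real.add_one_le_exp _)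
      have h2 := Real.log_le_sub_one_of_pos (div_pos hb ha)
      have h3 : ((m + 1 : ℕ) : ℝ) / ((m + 2 : ℕ) : ℝ) - 1 = - (1 / ((m + 2 : ℕ) : ℝ)) := by
        field_simp; push_cast; ring
      rw [h3] at h2
      nlinarith
    rw [Real.div_rpow hb.le ha.le, le_div_iff₀ (by positivity)] at h1
    rw [show -(1 + δ) = -δ - 1 by ring, Real.rpow_sub_one ha.ne', one_div, inv_mul_eq_div,
      le_div_iff₀ hδ]
    have : (1 + δ * (1 / ((m + 2 : ℕ) : ℝ))) * ((m + 2 : ℕ) : ℝ) ^ (-δ) =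
      ((m + 2 : ℕ) : ℝ) ^ (-δ) + ((m + 2 : ℕ) : ℝ) ^ (-δ) / ((m + 2 : ℕ) : ℝ) * δ := by ring
    linarith
  have bound : ∀ n : ℕ, ∑ m ∈ range (n + 2), (m : ℝ) ^ (-(1 + δ)) ≤
      1 + 1 / δ * (1 - ((n + 1 : ℕ) : ℝ) ^ (-δ)) := by
    intro n
    induction n with
    | zero =>
      simp [sum_range_succ, Real.zero_rpow (show -δ + -1 ≠ 0 by linarith)]
    | succ n ih =>
      rw [sum_range_succ]
      have := step n
      have e : n + 1 + 1 = n + 2 := rfl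
      rw [e]
      linarith
  have hpos : 0 ≤ 1 / δ * ((n + 1 : ℕ) : ℝ) ^ (-δ) := by positivity
  calc ∑ m ∈ range n, (m : ℝ) ^ (-(1 + δ)) ≤ ∑ m ∈ range (n + 2), (m : ℝ) ^ (-(1 + δ)) :=
        sum_le_sum_of_subset_of_nonneg (range_subset_range.mpr (by lia))
          fun _ _ _ ↦ by positivity
    _ ≤ _ := bound n
    _ ≤ _ := by linarith

theorem prod_primes_inv_one_sub_rpow_le {δ : ℝ} (hδ : 0 < δ) (n : ℕ) :
    ∏ p ∈ (range (n + 1)).filter Nat.Prime, (1 - (p : ℝ) ^ (-(1 + δ)))⁻¹ ≤ 1 + 1 / δ := by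
  obtain ⟨hs, hle⟩ := tsum_rpow_neg_le hδ
  let f : ℕ →* ℝ :=
    { toFun := fun m ↦ (m : ℝ) ^ (-(1 + δ))
      map_one' := by simp
      map_mul' := fun a b ↦ by
        push_cast
        exact Real.mul_rpow (Nat.cast_nonneg a) (Nat.cast_nonneg b) }
  have h := EulerProduct.prod_primesBelow_geometric_eq_tsum_smoothNumbers (f := f) hs (n + 1)
  calc _ = ∑' m : Nat.smoothNumbers (n + 1), f m := h
    _ ≤ ∑' m : ℕ, f m := hs.tsum_subtype_le _ _ fun m ↦ Real.rpow_nonneg (Nat.cast_nonneg m) _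
    _ ≤ _ := hle

theorem defectEulerProduct_le {F : ℕ → ℂ} (hb : ∀ m, ‖F m‖ ≤ 1) {n : ℕ}
    (h : 1 ≤ primeDistance F n) :
    defectEulerProduct F n ≤ 600 * primeDistance F n ^ 2 := by
  set η := primeDistance F n with hη
  have hη0 : 0 < η := by linarith
  have hsq : ∑ p ∈ (range (n + 1)).filter Nat.Prime, 4 * ((p : ℝ) ^ 2)⁻¹ ≤ 4 := by
    rw [← mul_sum]
    have : ∑ p ∈ (range (n + 1)).filter Nat.Prime, ((p : ℝ) ^ 2)⁻¹ ≤
        ∑ p ∈ Ioo 1 (n + 1), ((p : ℝ) ^ 2)⁻¹ := by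
      refine sum_le_sum_of_subset_of_nonneg (fun p hp ↦ ?_) fun _ _ _ ↦ by positivity
      simp only [mem_filter, mem_range] at hp
      exact mem_Ioo.mpr ⟨hp.2.one_lt, hp.1⟩
    have := sum_Ioo_inv_sq_le (α := ℝ) 1 (n + 1)
    norm_num at this
    linarith
  have factor : ∀ p ∈ (range (n + 1)).filter Nat.Prime, 1 + ‖F p - 1‖ / ((p : ℝ) - 1) ≤
      Real.exp (4 * ((p : ℝ) ^ 2)⁻¹) * Real.exp (1 / η * (‖F p - 1‖ * Real.log p / p)) *
        ((1 - (p : ℝ) ^ (-(1 + 1 / η)))⁻¹) ^ 2 := by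
    intro p hp
    have hp2 : (2 : ℝ) ≤ p := by exact_mod_cast (mem_filter.mp hp).2.two_le
    have hp0 : (0 : ℝ) < p := by linarith
    set b := ‖F p - 1‖ with hbdef
    have hb0 : 0 ≤ b := norm_nonneg _
    have hb2 : b ≤ 2 := by
      refine (norm_sub_le _ _).trans ?_
      rw [norm_one]; linarith [hb p]
    set x := (p : ℝ) ^ (-(1 + 1 / η)) with hx
    have hx0 : 0 ≤ x := Real.rpow_nonneg hp0.le _
    have hx1 : x < 1 := Real.rpow_lt_one_of_one_lt_of_neg (by linarith)
      (by have : 0 < 1 / η := by positivity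
          linarith)
    have e1 : Real.exp (2 * x) ≤ ((1 - x)⁻¹) ^ 2 := by
      rw [show 2 * x = ((2 : ℕ) : ℝ) * x by norm_num, Real.exp_nat_mul]
      gcongr
      rw [le_inv_comm₀ (Real.exp_pos _) (by linarith), ← Real.exp_neg]
      linarith [Real.add_one_le_exp (-x)]
    have e2 : 1 / (p : ℝ) ≤ x + 1 / η * Real.log p / p := by
      have hxe : x = 1 / p * Real.exp (-(1 / η * Real.log p)) := by
        rw [hx, show -(1 + 1 / η) = -(1 / η) - 1 by ring, Real.rpow_sub_one hp0.ne',
          Real.rpow_def_of_pos hp0]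
        rw [div_eq_mul_one_div, mul_comm]
        congr 2
        ring
      have := Real.add_one_le_exp (-(1 / η * Real.log p))
      have : 1 / (p : ℝ) * (-(1 / η * Real.log p) + 1) ≤ x := by rw [hxe]; gcongr
      calc 1 / (p : ℝ) = 1 / (p : ℝ) * (-(1 / η * Real.log p) + 1) + 1 / η * Real.log p / p := by
            ring
        _ ≤ _ := by linarith
    have e3 : b / ((p : ℝ) - 1) ≤ b / p + 4 * ((p : ℝ) ^ 2)⁻¹ := by
      rw [← div_eq_mul_inv, div_add_div _ _ hp0.ne' (by positivity),
        div_le_div_iff₀ (by linarith) (by positivity)]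
      have : b * (p : ℝ) * p ≤ 2 * p * p := by gcongr
      nlinarith [mul_nonneg hp0.le (sub_nonneg.mpr hp2)]
    have e4 : b / p ≤ 2 * x + 1 / η * (b * Real.log p / p) := by
      calc b / p = b * (1 / p) := by ring
        _ ≤ b * (x + 1 / η * Real.log p / p) := by gcongr
        _ = b * x + 1 / η * (b * Real.log p / p) := by ring
        _ ≤ _ := by gcongr
    calc 1 + b / ((p : ℝ) - 1)
        ≤ 1 + (4 * ((p : ℝ) ^ 2)⁻¹ + 1 / η * (b * Real.log p / p) + 2 * x) := by linarith
      _ ≤ Real.exp (4 * ((p : ℝ) ^ 2)⁻¹ + 1 / η * (b * Real.log p / p) + 2 * x) := by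
        rw [add_comm]; exact Real.add_one_le_exp _
      _ = Real.exp (4 * ((p : ℝ) ^ 2)⁻¹) * Real.exp (1 / η * (b * Real.log p / p)) *
          Real.exp (2 * x) := by rw [Real.exp_add, Real.exp_add]
      _ ≤ _ := by gcongr
  have hprod : 0 ≤ ∏ p ∈ (range (n + 1)).filter Nat.Prime,
      (1 - (p : ℝ) ^ (-(1 + 1 / η)))⁻¹ := by
    refine prod_nonneg fun p hp ↦ inv_nonneg.mpr (sub_nonneg.mpr ?_)
    refine Real.rpow_le_one_of_one_le_of_nonpos ?_ ?_
    · exact_mod_cast (mem_filter.mp hp).2.one_lt.le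
    · have : 0 < 1 / η := by positivity
      linarith
  have hP := prod_primes_inv_one_sub_rpow_le (show 0 < 1 / η by positivity) n
  rw [one_div_one_div] at hP
  calc defectEulerProduct F n ≤ _ := prod_le_prod (fun p hp ↦ by
        have hp1 : (1 : ℝ) < p := by exact_mod_cast (mem_filter.mp hp).2.one_lt
        have : 0 ≤ ‖F p - 1‖ / ((p : ℝ) - 1) := div_nonneg (norm_nonneg _) (by linarith)
        linarith) factor
    _ = Real.exp (∑ p ∈ (range (n + 1)).filter Nat.Prime, 4 * ((p : ℝ) ^ 2)⁻¹) *
        Real.exp (1 / η * η) * (∏ p ∈ (range (n + 1)).filter Nat.Prime,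
          (1 - (p : ℝ) ^ (-(1 + 1 / η)))⁻¹) ^ 2 := by
      rw [prod_mul_distrib, prod_mul_distrib, prod_pow, ← Real.exp_sum, ← Real.exp_sum,
        hη, primeDistance, mul_sum _ _ (1 / ∑ p ∈ (range (n + 1)).filter Nat.Prime, _)]
    _ ≤ Real.exp 4 * Real.exp 1 * (1 + η) ^ 2 := by
      rw [one_div_mul_cancel hη0.ne']
      gcongr
    _ ≤ 150 * (2 * η) ^ 2 := by
      have he : Real.exp 4 * Real.exp 1 ≤ 150 := by
        have := Real.exp_one_lt_d9
        rw [← Real.exp_add, show (4 : ℝ) + 1 = ((5 : ℕ) : ℝ) * 1 by norm_num, Real.exp_nat_mul]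
        calc Real.exp 1 ^ 5 ≤ 2.7182818286 ^ 5 := by gcongr
          _ ≤ 150 := by norm_num
      gcongr
      linarith
    _ = _ := by ring

theorem harmonic_div_mul_log_le {d N : ℕ} (hd : 1 ≤ d) (hdN : d ≤ N) :
    (harmonic (N / d) : ℝ) * (Real.log N - Real.log d) ≤ 4 * (N / d) := by
  have hd0 : (0 : ℝ) < d := by exact_mod_cast hd
  have hN0 : (0 : ℝ) < N := by exact_mod_cast hd.trans hdN
  rw [← Real.log_div hN0.ne' hd0.ne']
  set y : ℝ := (N : ℝ) / d with hy
  have hy1 : 1 ≤ y := by rw [hy, one_le_div hd0]; exact_mod_cast hdN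
  have hk : (1 : ℝ) ≤ ((N / d : ℕ) : ℝ) := by exact_mod_cast (Nat.one_le_div_iff hd).mpr hdN
  have hH : (harmonic (N / d) : ℝ) ≤ 1 + Real.log y := by
    refine (harmonic_le_one_add_log _).trans ?_
    gcongr
    exact Nat.cast_div_le
  have hlog0 : 0 ≤ Real.log y := Real.log_nonneg hy1
  set r := Real.sqrt y with hr
  have hr1 : 1 ≤ r := Real.one_le_sqrt.mpr hy1
  have hr2 : r ^ 2 = y := Real.sq_sqrt (by linarith)
  have hlog : Real.log y ≤ 2 * (r - 1) := by
    rw [← hr2, Real.log_pow]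
    push_cast
    have := Real.log_le_sub_one_of_pos (show 0 < r by linarith)
    linarith
  calc _ ≤ (1 + Real.log y) * Real.log y := by gcongr
    _ ≤ (1 + 2 * (r - 1)) * (2 * (r - 1)) := by gcongr
    _ ≤ 4 * y := by rw [← hr2]; nlinarith

open ArithmeticFunction in
theorem sum_Ioc_defectMajorant_mul_log_mul_harmonic_le {F : ℕ → ℂ} {n : ℕ} (hb : ∀ m, ‖F m‖ ≤ 1)
    (hF : ∀ p, p.Prime → n < p → F p = 1) (N : ℕ) :
    ∑ d ∈ Ioc 0 N, defectMajorant F d * Real.log d * harmonic (N / d) ≤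
      24 * N * defectEulerProduct F n := by
  let a : ArithmeticFunction ℝ := ⟨fun d ↦ defectMajorant F d * Real.log d, by simp⟩
  let c : ArithmeticFunction ℝ := ⟨fun j ↦ (j : ℝ)⁻¹, by simp⟩
  have hZ : 0 ≤ defectEulerProduct F n := zero_le_one.trans (one_le_defectEulerProduct F n)
  have hsq : ∑ j ∈ Ioc 0 N, ((j : ℝ) ^ 2)⁻¹ ≤ 2 := by
    have h := sum_Ioo_inv_sq_le (α := ℝ) 0 (N + 1)
    rw [show Ioo 0 (N + 1) = Ioc 0 N by ext; simp] at h
    simpa using h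
  calc ∑ d ∈ Ioc 0 N, defectMajorant F d * Real.log d * harmonic (N / d)
      = ∑ m ∈ Ioc 0 N, (a * c) m := by
        rw [sum_Ioc_mul_eq_sum_sum]
        refine sum_congr rfl fun d _ ↦ ?_
        rw [harmonic_eq_sum_Icc]
        push_cast
        rfl
    _ = ∑ j ∈ Ioc 0 N, (j : ℝ)⁻¹ * ∑ d ∈ Ioc 0 (N / j), defectMajorant F d * Real.log d := by
        rw [mul_comm, sum_Ioc_mul_eq_sum_sum]
        rfl
    _ ≤ ∑ j ∈ Ioc 0 N, (12 * N * defectEulerProduct F n) * ((j : ℝ) ^ 2)⁻¹ := by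
        refine sum_le_sum fun j _ ↦ ?_
        have h1 := sum_Ioc_defectMajorant_mul_log_le hb hF (N / j)
        have h2 : ((N / j : ℕ) : ℝ) ≤ (N : ℝ) / j := Nat.cast_div_le
        calc _ ≤ (j : ℝ)⁻¹ * (12 * ((N : ℝ) / j) * defectEulerProduct F n) := by
              gcongr
              exact h1.trans (by gcongr)
          _ = _ := by rw [pow_two, mul_inv]; ring
    _ ≤ (12 * N * defectEulerProduct F n) * 2 := by rw [← mul_sum]; gcongr
    _ = _ := by ring

theorem sum_Ioc_defectMajorant_mul_harmonic_mul_log_le {F : ℕ → ℂ} {n : ℕ}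
    (hb : ∀ m, ‖F m‖ ≤ 1) (hF : ∀ p, p.Prime → n < p → F p = 1) (N : ℕ) :
    (∑ d ∈ Ioc 0 N, defectMajorant F d * harmonic (N / d)) * Real.log N ≤
      28 * N * defectEulerProduct F n := by
  have h1 := sum_Ioc_defectMajorant_mul_log_mul_harmonic_le hb hF N
  have h2 : ∑ d ∈ Ioc 0 N, defectMajorant F d *
      ((harmonic (N / d) : ℝ) * (Real.log N - Real.log d)) ≤ 4 * N * defectEulerProduct F n := by
    calc _ ≤ ∑ d ∈ Ioc 0 N, 4 * N * (defectMajorant F d / d) := by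
          refine sum_le_sum fun d hd ↦ ?_
          rw [mem_Ioc] at hd
          calc _ ≤ defectMajorant F d * (4 * (N / d)) :=
                mul_le_mul_of_nonneg_left (harmonic_div_mul_log_le hd.1 hd.2)
                  (defectMajorant_nonneg F d)
            _ = _ := by ring
      _ ≤ _ := by
          rw [← mul_sum]
          gcongr
          exact sum_Ioc_defectMajorant_div_le hF N
  calc _ = ∑ d ∈ Ioc 0 N, defectMajorant F d * Real.log d * harmonic (N / d) +
        ∑ d ∈ Ioc 0 N, defectMajorant F d *
          ((harmonic (N / d) : ℝ) * (Real.log N - Real.log d)) := by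
        rw [sum_mul, ← sum_add_distrib]
        exact sum_congr rfl fun d _ ↦ by ring
    _ ≤ _ := by linarith

theorem sum_Ioc_one_defectMajorant_mul_harmonic_le {F : ℕ → ℂ} {n : ℕ}
    (hb : ∀ m, ‖F m‖ ≤ 1) (hF : ∀ p, p.Prime → n < p → F p = 1) {N : ℕ} (hN : 2 ≤ N)
    (hη : primeDistance F n ≤ Real.log N) :
    ∑ d ∈ Ioc 1 N, defectMajorant F d * harmonic (N / d) ≤ 16800 * N * primeDistance F n := by
  set η := primeDistance F n with hηdef
  have hη0 : 0 ≤ η := primeDistance_nonneg F n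
  have hsplit : Ioc 0 N = insert 1 (Ioc 1 N) := by ext; simp; lia
  rcases le_total η 1 with hle | hge
  · have hZ := sum_Ioc_defectMajorant_div_le hF N
    rw [hsplit, sum_insert (by simp), defectMajorant_one] at hZ
    have hZ' := defectEulerProduct_sub_one_le hle
    rw [← hηdef] at hZ'
    norm_num at hZ
    calc _ ≤ ∑ d ∈ Ioc 1 N, N * (defectMajorant F d / d) := by
          refine sum_le_sum fun d hd ↦ ?_
          have hH : (harmonic (N / d) : ℝ) ≤ N / d := by
            refine le_trans ?_ (Nat.cast_div_le (α := ℝ))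
            rw [harmonic_eq_sum_Icc]
            push_cast
            calc ∑ i ∈ Icc 1 (N / d), ((i : ℕ) : ℝ)⁻¹ ≤ ∑ i ∈ Icc 1 (N / d), (1 : ℝ) :=
                  sum_le_sum fun i hi ↦ inv_le_one_of_one_le₀ (by
                    exact_mod_cast (mem_Icc.mp hi).1)
              _ = ((N / d : ℕ) : ℝ) := by simp
          calc _ ≤ defectMajorant F d * (N / d) :=
                mul_le_mul_of_nonneg_left hH (defectMajorant_nonneg F d)
            _ = _ := by ring
      _ ≤ N * (60 * η) := by rw [← mul_sum]; gcongr; linarith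
      _ ≤ _ := by nlinarith [mul_nonneg (Nat.cast_nonneg N : (0 : ℝ) ≤ N) hη0]
  · have hlog : 0 < Real.log N := by linarith
    have h := sum_Ioc_defectMajorant_mul_harmonic_mul_log_le hb hF N
    have hsub : ∑ d ∈ Ioc 1 N, defectMajorant F d * (harmonic (N / d) : ℝ) ≤
        ∑ d ∈ Ioc 0 N, defectMajorant F d * (harmonic (N / d) : ℝ) := by
      refine sum_le_sum_of_subset_of_nonneg (by rw [hsplit]; exact subset_insert _ _)
        fun d hd _ ↦ mul_nonneg (defectMajorant_nonneg F d) ?_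
      rw [mem_Ioc] at hd
      exact zero_le_one.trans (one_le_harmonic_real ((Nat.one_le_div_iff hd.1).mpr hd.2))
    refine hsub.trans (le_of_mul_le_mul_right (h.trans ?_) hlog)
    calc _ ≤ 28 * N * (600 * η ^ 2) := by gcongr; exact defectEulerProduct_le hb hge
      _ = 16800 * N * η * η := by ring
      _ ≤ _ := by gcongr

open ArithmeticFunction ArithmeticFunction.Moebius in
theorem norm_sum_mul_harmonic_sub_le (F : ArithmeticFunction ℂ) (h1 : F 1 = 1)
    (hmul : ∀ m n, F (m * n) = F m * F n) (hb : ∀ m, ‖F m‖ ≤ 1) {n : ℕ}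
    (hF : ∀ p, p.Prime → n < p → F p = 1) {N : ℕ} (hN : 2 ≤ N)
    (hη : primeDistance F n ≤ Real.log N) :
    ‖(∑ m ∈ Ioc 0 N, F m) * (harmonic N : ℝ) - N * ∑ m ∈ Ioc 0 N, F m / m‖ ≤
      70000 * primeDistance F n * N := by
  have hη0 : 0 ≤ primeDistance F n := primeDistance_nonneg F n
  have hS : ∀ M : ℕ, ‖∑ m ∈ Ioc 0 M, F m‖ ≤ M := fun M ↦ by
    refine (norm_sum_le _ _).trans ?_
    calc _ ≤ ∑ m ∈ Ioc 0 M, (1 : ℝ) := sum_le_sum fun m _ ↦ hb m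
      _ = M := by simp
  rw [mean_defect_identity F hmul]
  have e1 : ‖∑ q ∈ Ioc 0 N, (Λ q : ℂ) * (F q - 1) * ∑ m ∈ Ioc 0 (N / q), F m‖ ≤
      N * (4 * primeDistance F n) := by
    refine (norm_sum_le _ _).trans ?_
    calc _ ≤ ∑ q ∈ Ioc 0 N, N * (Λ q * ‖F q - 1‖ / q) := by
          refine sum_le_sum fun q _ ↦ ?_
          rw [norm_mul, norm_mul, Complex.norm_real, Real.norm_of_nonneg vonMangoldt_nonneg]
          calc _ ≤ Λ q * ‖F q - 1‖ * ((N : ℝ) / q) := by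
                have := vonMangoldt_nonneg (n := q)
                gcongr
                exact (hS _).trans Nat.cast_div_le
            _ = _ := by ring
      _ ≤ _ := by
          rw [← mul_sum]
          gcongr
          exact sum_vonMangoldt_mul_norm_le h1 hmul hb hF N
  have e2 : ‖∑ d ∈ Ioc 0 N, (F * (μ : ArithmeticFunction ℂ)) d *
      ((((N / d : ℕ) : ℝ) * (harmonic N - Real.log d) - N / d * harmonic (N / d) : ℝ) : ℂ)‖ ≤
      4 * (16800 * N * primeDistance F n) := by
    rw [show Ioc 0 N = insert 1 (Ioc 1 N) by ext; simp; lia, sum_insert (by simp)]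
    have h0 : (((N / 1 : ℕ) : ℝ) * (harmonic N - Real.log (1 : ℕ)) -
        N / (1 : ℕ) * harmonic (N / 1) : ℝ) = 0 := by simp
    rw [h0, Complex.ofReal_zero, mul_zero, zero_add]
    refine (norm_sum_le _ _).trans ?_
    calc _ ≤ ∑ d ∈ Ioc 1 N, 4 * (defectMajorant F d * harmonic (N / d)) := by
          refine sum_le_sum fun d hd ↦ ?_
          rw [mem_Ioc] at hd
          rw [norm_mul, Complex.norm_real, Real.norm_eq_abs]
          calc _ ≤ defectMajorant F d * (4 * harmonic (N / d)) :=
                mul_le_mul (norm_mul_moebius_le F h1 hmul hb (by lia))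
                  (abs_harmonic_defect_le hd.1.le hd.2) (abs_nonneg _) (defectMajorant_nonneg F d)
            _ = _ := by ring
      _ ≤ _ := by
          rw [← mul_sum]
          gcongr
          exact sum_Ioc_one_defectMajorant_mul_harmonic_le hb hF hN hη
  refine (norm_add_le _ _).trans ((add_le_add e1 e2).trans ?_)
  nlinarith [mul_nonneg hη0 (Nat.cast_nonneg N : (0 : ℝ) ≤ N)]

theorem norm_mean_sub_limit_le (a : ℕ → ℂ) {P : ℂ} {C : ℝ} {n : ℕ} (hn : 1 ≤ n)
    (h : ∀ N ≥ n, ‖(∑ m ∈ Ioc 0 N, a m) * (harmonic N : ℝ) - N * ∑ m ∈ Ioc 0 N, a m / m‖ ≤ C * N)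
    (hP : Tendsto (fun N : ℕ ↦ (∑ m ∈ Ioc 0 N, a m) / N) atTop (nhds P)) :
    ‖(∑ m ∈ Ioc 0 n, a m) / n - P‖ ≤ 2 * C / (harmonic (n + 1) - 1) := by
  set S : ℕ → ℂ := fun N ↦ ∑ m ∈ Ioc 0 N, a m with hS
  let ell : ℕ → ℝ := fun N ↦ harmonic (N + 1) - 1
  let Q : ℕ → ℂ := fun N ↦ ∑ m ∈ Ioc 0 N, a m / m - S N / (N + 1)
  have ell_succ : ∀ N, ell (N + 1) = ell N + 1 / (N + 2) := fun N ↦ by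
    simp only [ell, harmonic_succ (N + 1)]
    push_cast
    ring
  have ell_pos : ∀ N, 1 ≤ N → 0 < ell N := fun N hN ↦ by
    simp only [ell, harmonic_succ N]
    have := one_le_harmonic_real hN
    push_cast
    have : (0 : ℝ) < ((N : ℝ) + 1)⁻¹ := by positivity
    linarith
  have Q_succ : ∀ N, Q (N + 1) = Q N + S (N + 1) / (N + 1 : ℕ) / (N + 2) := fun N ↦ by
    have h1 : ((N : ℂ) + 1) ≠ 0 := by exact_mod_cast N.succ_ne_zero
    have h2 : ((N : ℂ) + 2) ≠ 0 := by exact_mod_cast (N + 1).succ_ne_zero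
    have hS' : S (N + 1) = S N + a (N + 1) := sum_Ioc_succ_top (Nat.zero_le N) a
    simp only [Q]
    rw [sum_Ioc_succ_top (Nat.zero_le N), hS']
    push_cast
    rw [show (N : ℂ) + 1 + 1 = N + 2 by ring]
    field_simp
    ring
  have defect : ∀ N ≥ n, ‖S N / N * ell N - Q N‖ ≤ C := fun N hN ↦ by
    have hN0 : (0 : ℝ) < N := by exact_mod_cast hn.trans hN
    have hN0' : (N : ℂ) ≠ 0 := by exact_mod_cast hN0.ne'
    have h1 : ((N : ℂ) + 1) ≠ 0 := by exact_mod_cast N.succ_ne_zero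
    have e : S N / N * ell N - Q N =
        (S N * (harmonic N : ℝ) - N * ∑ m ∈ Ioc 0 N, a m / m) / N := by
      simp only [ell, Q, harmonic_succ N]
      push_cast
      field_simp
      ring
    rw [e, norm_div, Complex.norm_natCast, div_le_iff₀ hN0]
    exact h N hN
  have hC : 0 ≤ C := (norm_nonneg _).trans (defect n le_rfl)
  have telescope : ∀ N ≥ n, ‖Q N / ell N - Q n / ell n‖ ≤ C * (1 / ell n - 1 / ell N) := by
    intro N hN
    induction N, hN using Nat.le_induction with
    | base => simp
    | succ N hN ih =>
      have l0 := ell_pos N (hn.trans hN)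
      have l1 := ell_pos (N + 1) (by lia)
      have h2 : (0 : ℝ) < (N : ℝ) + 2 := by positivity
      have step : Q (N + 1) / ell (N + 1) - Q N / ell N =
          (S (N + 1) / (N + 1 : ℕ) * ell (N + 1) - Q (N + 1)) *
            ((1 / ell N - 1 / ell (N + 1) : ℝ) : ℂ) := by
        have hQ : Q N = Q (N + 1) - S (N + 1) / (N + 1 : ℕ) / (N + 2) := by rw [Q_succ N]; ring
        have l0' : (ell N : ℂ) ≠ 0 := by exact_mod_cast l0.ne'
        have l1' : (ell (N + 1) : ℂ) ≠ 0 := by exact_mod_cast l1.ne'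
        have h2' : (N : ℂ) + 2 ≠ 0 := by exact_mod_cast (N + 1).succ_ne_zero
        have hl : (1 / ((N : ℂ) + 2)) = ell (N + 1) - ell N := by
          rw [ell_succ N]; push_cast; ring
        rw [hQ, div_eq_mul_one_div _ ((N : ℂ) + 2), hl]
        push_cast
        field_simp
        ring
      have hmono : 0 ≤ 1 / ell N - 1 / ell (N + 1) := by
        rw [sub_nonneg]
        refine one_div_le_one_div_of_le l0 ?_
        rw [ell_succ]
        have : 0 < 1 / ((N : ℝ) + 2) := by positivity
        linarith
      have bound : ‖Q (N + 1) / ell (N + 1) - Q N / ell N‖ ≤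
          C * (1 / ell N - 1 / ell (N + 1)) := by
        rw [step, norm_mul, Complex.norm_real, Real.norm_of_nonneg hmono]
        gcongr
        exact defect (N + 1) (by lia)
      calc _ ≤ _ := norm_sub_le_norm_sub_add_norm_sub _ (Q N / ell N) _
        _ ≤ C * (1 / ell N - 1 / ell (N + 1)) + C * (1 / ell n - 1 / ell N) := by gcongr
        _ = _ := by ring
  have close : ∀ N ≥ n, ‖S N / N - Q n / ell n‖ ≤ C / ell n := fun N hN ↦ by
    have l0 := ell_pos N (hn.trans hN)
    have l0' : (ell N : ℂ) ≠ 0 := by exact_mod_cast l0.ne'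
    have e : S N / N - Q N / ell N = (S N / N * ell N - Q N) / ell N := by field_simp
    have b : ‖S N / N - Q N / ell N‖ ≤ C / ell N := by
      rw [e, norm_div, Complex.norm_real, Real.norm_of_nonneg l0.le]
      gcongr
      exact defect N hN
    calc _ ≤ _ := norm_sub_le_norm_sub_add_norm_sub _ (Q N / ell N) _
      _ ≤ C / ell N + C * (1 / ell n - 1 / ell N) := by gcongr; exact telescope N hN
      _ = _ := by ring
  have lim : ‖P - Q n / ell n‖ ≤ C / ell n :=
    le_of_tendsto (hP.sub_const _).norm (eventually_atTop.mpr ⟨n, close⟩)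
  calc _ ≤ _ := norm_sub_le_norm_sub_add_norm_sub _ (Q n / ell n) _
    _ ≤ C / ell n + C / ell n := by
      gcongr
      · exact close n le_rfl
      · rw [norm_sub_rev]; exact lim
    _ = _ := by ring

open ArithmeticFunction ArithmeticFunction.Moebius in
theorem hasSum_mul_moebius_div (F : ArithmeticFunction ℂ) (h1 : F 1 = 1)
    (hmul : ∀ m n, F (m * n) = F m * F n) (hb : ∀ m, ‖F m‖ ≤ 1) {n : ℕ}
    (hF : ∀ p, p.Prime → n < p → F p = 1) :
    HasSum (fun d : ℕ ↦ (F * (μ : ArithmeticFunction ℂ)) d / d)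
      (∏ p ∈ (range (n + 1)).filter Nat.Prime, (1 - 1 / (p : ℂ)) / (1 - F p / (p : ℂ))) := by
  set g := F * (μ : ArithmeticFunction ℂ) with hg
  have hgmul : g.IsMultiplicative := isMultiplicative_mul_moebius F h1 hmul
  have hbound : ∀ d : ℕ, ‖g d / d‖ ≤ defectMajorant F d / d := fun d ↦ by
    rw [norm_div, Complex.norm_natCast]
    rcases eq_or_ne d 0 with rfl | hd
    · simp
    · gcongr
      exact norm_mul_moebius_le F h1 hmul hb hd
  have hpow : ∀ p k, F (p ^ k) = F p ^ k := by
    intro p k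
    induction k with
    | zero => simp [h1]
    | succ k ih => rw [pow_succ, hmul, ih, pow_succ]
  have hprime : ∀ p : ℕ, p.Prime → HasSum (fun k : ℕ ↦ g (p ^ k) / ((p ^ k : ℕ) : ℂ))
      ((1 - 1 / (p : ℂ)) / (1 - F p / (p : ℂ))) := by
    intro p hp
    have hp1 : (1 : ℝ) < p := by exact_mod_cast hp.one_lt
    have hp0 : (p : ℂ) ≠ 0 := by exact_mod_cast hp.ne_zero
    have hlt : ‖F p / p‖ < 1 := by
      rw [norm_div, Complex.norm_natCast, div_lt_one (by linarith)]
      exact (hb p).trans_lt hp1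
    have hne : 1 - F p / (p : ℂ) ≠ 0 := fun h0 ↦ by
      rw [← sub_eq_zero.mp h0] at hlt
      simp at hlt
    have h := (hasSum_geometric_of_norm_lt_one hlt).mul_left ((F p - 1) / p)
    rw [← hasSum_nat_add_iff' 1]
    convert! h using 1
    · funext k
      rw [mul_moebius_prime_pow F hmul hp, hpow, div_pow]
      push_cast
      rw [pow_succ]
      field_simp
    · simp only [range_one, sum_singleton, pow_zero, hgmul.map_one]
      rw [← div_eq_mul_inv, eq_div_iff hne, sub_mul, div_mul_cancel₀ _ hne]
      push_cast
      ring
  have h := (EulerProduct.summable_and_hasSum_smoothNumbers_prod_primesBelow_tsum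
    (f := fun d : ℕ ↦ g d / d) (by simp [hgmul.map_one])
    (fun {m k} hmk ↦ by
      rw [hgmul.map_mul_of_coprime hmk]; push_cast; rw [mul_div_mul_comm])
    (fun {p} hp ↦ (hasSum_defectMajorant_prime_pow F hp).summable.of_nonneg_of_le
      (fun _ ↦ norm_nonneg _) fun k ↦ hbound (p ^ k)) (n + 1)).2
  rw [Nat.primesBelow, prod_congr rfl (fun p hp ↦ (hprime p (mem_filter.mp hp).2).tsum_eq)] at h
  rw [← hasSum_subtype_iff_of_support_subset (s := Nat.smoothNumbers (n + 1))]
  · exact h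
  · intro d hd
    by_contra hns
    refine hd ?_
    rcases eq_or_ne d 0 with rfl | hd0
    · simp
    · have := hbound d
      rwa [defectMajorant_eq_zero_of_not_smooth hF hd0 hns, zero_div, norm_le_zero_iff] at this

theorem tendsto_natCast_div_div (d : ℕ) :
    Tendsto (fun N : ℕ ↦ ((N / d : ℕ) : ℝ) / N) atTop (nhds (1 / d)) := by
  have h := (tendsto_nat_floor_mul_div_atTop (R := ℝ) (a := 1 / d) (by positivity)).comp
    tendsto_natCast_atTop_atTop
  refine h.congr fun N ↦ ?_
  simp only [Function.comp]
  rw [one_div_mul_eq_div, Nat.floor_div_natCast, Nat.floor_natCast]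

open ArithmeticFunction ArithmeticFunction.zeta ArithmeticFunction.Moebius in
theorem tendsto_mean_of_eventually_one (F : ArithmeticFunction ℂ) (h1 : F 1 = 1)
    (hmul : ∀ m n, F (m * n) = F m * F n) (hb : ∀ m, ‖F m‖ ≤ 1) {n : ℕ}
    (hF : ∀ p, p.Prime → n < p → F p = 1) :
    Tendsto (fun N : ℕ ↦ (∑ m ∈ Ioc 0 N, F m) / N) atTop
      (nhds (∏ p ∈ (range (n + 1)).filter Nat.Prime,
        (1 - 1 / (p : ℂ)) / (1 - F p / (p : ℂ)))) := by
  rw [← (hasSum_mul_moebius_div F h1 hmul hb hF).tsum_eq]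
  set g := F * (μ : ArithmeticFunction ℂ) with hg
  have hFg : F = g * (ζ : ArithmeticFunction ℂ) := by
    rw [hg, mul_assoc, coe_moebius_mul_coe_zeta, mul_one]
  have h := tendsto_tsum_of_dominated_convergence (𝓕 := atTop)
    (f := fun N d : ℕ ↦ g d * (((((N / d : ℕ) : ℝ) / N : ℝ)) : ℂ))
    (g := fun d : ℕ ↦ g d / d) (hasSum_defectMajorant_div hF).summable
    (fun d ↦ by
      have := ((Complex.continuous_ofReal.tendsto _).comp (tendsto_natCast_div_div d)).const_mul
        (g d)
      simpa [div_eq_mul_inv, Function.comp_def] using this)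
    (Eventually.of_forall fun N d ↦ by
      rcases eq_or_ne d 0 with rfl | hd
      · simp
      · rw [norm_mul, Complex.norm_real, Real.norm_of_nonneg (by positivity),
          div_eq_mul_one_div (defectMajorant F d)]
        have : ((N / d : ℕ) : ℝ) / N ≤ 1 / d := by
          rcases eq_or_ne N 0 with rfl | hN
          · simp
          · have hN0 : (0 : ℝ) < N := by exact_mod_cast hN.bot_lt
            rw [div_le_iff₀ hN0, one_div_mul_eq_div]
            exact Nat.cast_div_le
        exact mul_le_mul (norm_mul_moebius_le F h1 hmul hb hd) this (by positivity)
          (defectMajorant_nonneg F d))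
  refine h.congr fun N ↦ ?_
  rw [tsum_eq_sum (s := Ioc 0 N)]
  · conv_rhs => rw [hFg, sum_Ioc_mul_zeta_eq_sum, sum_div]
    refine sum_congr rfl fun d _ ↦ ?_
    push_cast
    rw [mul_div_assoc]
  · intro d hd
    rcases eq_or_ne d 0 with rfl | hd0
    · simp
    · have : N < d := by simp at hd; lia
      simp [Nat.div_eq_of_lt this]

theorem norm_prod_euler_le_one {F : ℕ → ℂ} (hb : ∀ m, ‖F m‖ ≤ 1) (n : ℕ) :
    ‖∏ p ∈ (range (n + 1)).filter Nat.Prime, (1 - 1 / (p : ℂ)) / (1 - F p / (p : ℂ))‖ ≤ 1 := by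
  rw [norm_prod]
  refine prod_le_one (fun _ _ ↦ norm_nonneg _) fun p hp ↦ ?_
  have hp1 : (1 : ℝ) < p := by exact_mod_cast (mem_filter.mp hp).2.one_lt
  have hlt : 1 / (p : ℝ) < 1 := by rw [div_lt_one (by linarith)]; exact hp1
  have h1 : ‖1 - 1 / (p : ℂ)‖ = 1 - 1 / p := by
    rw [show 1 - 1 / (p : ℂ) = ((1 - 1 / p : ℝ) : ℂ) by push_cast; rfl, Complex.norm_real,
      Real.norm_of_nonneg (by linarith)]
  have h2 : 1 - 1 / (p : ℝ) ≤ ‖1 - F p / (p : ℂ)‖ := by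
    have := norm_sub_norm_le 1 (F p / (p : ℂ))
    rw [norm_one, norm_div, Complex.norm_natCast] at this
    have : ‖F p‖ / p ≤ 1 / (p : ℝ) := by gcongr; exact hb p
    linarith
  rw [norm_div, h1, div_le_one (by linarith)]
  exact h2

theorem half_log_le_harmonic_succ_sub_one {n : ℕ} (hn : 2 ≤ n) :
    Real.log n / 2 ≤ harmonic (n + 1) - 1 := by
  have hn2 : (2 : ℝ) ≤ n := by exact_mod_cast hn
  have h := log_add_one_le_harmonic_real (n + 1)
  push_cast at h
  rw [show (n : ℝ) + 1 + 1 = n + 2 by ring] at h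
  have h8 : Real.log ((2 : ℝ) ^ 3 * n) ≤ Real.log (((n : ℝ) + 2) ^ 2) :=
    Real.log_le_log (by positivity) (by nlinarith [sq_nonneg ((n : ℝ) - 2)])
  rw [Real.log_mul (by norm_num) (by positivity), Real.log_pow, Real.log_pow] at h8
  push_cast at h8
  have := Real.log_two_gt_d9
  linarith

theorem norm_mean_sub_prod_le (F : ArithmeticFunction ℂ) (h1 : F 1 = 1)
    (hmul : ∀ m n, F (m * n) = F m * F n) (hb : ∀ m, ‖F m‖ ≤ 1) {n : ℕ} (hn : 2 ≤ n)
    (hF : ∀ p, p.Prime → n < p → F p = 1) :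
    ‖(∑ m ∈ Ioc 0 n, F m) / n -
      ∏ p ∈ (range (n + 1)).filter Nat.Prime, (1 - 1 / (p : ℂ)) / (1 - F p / (p : ℂ))‖ ≤
      280000 * (primeDistance F n / Real.log n) := by
  have hn2 : (2 : ℝ) ≤ n := by exact_mod_cast hn
  have hlog : 0 < Real.log n := Real.log_pos (by linarith)
  have hη0 : 0 ≤ primeDistance F n := primeDistance_nonneg F n
  rcases le_total (primeDistance F n) (Real.log n) with hle | hge
  · refine (norm_mean_sub_limit_le (C := 70000 * primeDistance F n) F (by lia) (fun N hN ↦ ?_)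
      (tendsto_mean_of_eventually_one F h1 hmul hb hF)).trans ?_
    · refine norm_sum_mul_harmonic_sub_le F h1 hmul hb hF (hn.trans hN) (hle.trans ?_)
      exact Real.log_le_log (by linarith) (by exact_mod_cast hN)
    · calc _ ≤ 2 * (70000 * primeDistance F n) / (Real.log n / 2) := by
            gcongr
            exact half_log_le_harmonic_succ_sub_one hn
        _ = _ := by ring
  · have hq : 1 ≤ primeDistance F n / Real.log n := (one_le_div hlog).mpr hge
    have hS : ‖(∑ m ∈ Ioc 0 n, F m) / n‖ ≤ 1 := by
      rw [norm_div, Complex.norm_natCast, div_le_one (by linarith)]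
      refine (norm_sum_le _ _).trans ?_
      calc _ ≤ ∑ m ∈ Ioc 0 n, (1 : ℝ) := sum_le_sum fun m _ ↦ hb m
        _ = n := by simp
    have := norm_sub_le ((∑ m ∈ Ioc 0 n, F m) / n) (∏ p ∈ (range (n + 1)).filter Nat.Prime,
      (1 - 1 / (p : ℂ)) / (1 - F p / (p : ℂ)))
    have := norm_prod_euler_le_one hb n
    linarith

open ArithmeticFunction ArithmeticFunction.zeta in
theorem sum_primes_log_div_le {n : ℕ} (hn : 1 ≤ n) :
    ∑ p ∈ (range (n + 1)).filter Nat.Prime, Real.log p / p ≤ 2 * Real.log n := by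
  have hn0 : (0 : ℝ) < n := by exact_mod_cast hn
  have h : ∑ q ∈ Ioc 0 n, Λ q * ((n / q : ℕ) : ℝ) ≤ n * Real.log n := by
    rw [← sum_Ioc_mul_zeta_eq_sum, vonMangoldt_mul_zeta]
    calc ∑ m ∈ Ioc 0 n, log m ≤ ∑ m ∈ Ioc 0 n, Real.log n := by
          refine sum_le_sum fun m hm ↦ ?_
          rw [mem_Ioc] at hm
          exact Real.log_le_log (by exact_mod_cast hm.1) (by exact_mod_cast hm.2)
      _ = _ := by simp
  have hp : n / 2 * ∑ p ∈ (range (n + 1)).filter Nat.Prime, Real.log p / p ≤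
      ∑ q ∈ Ioc 0 n, Λ q * ((n / q : ℕ) : ℝ) := by
    rw [mul_sum]
    calc _ ≤ ∑ p ∈ (range (n + 1)).filter Nat.Prime, Λ p * ((n / p : ℕ) : ℝ) := by
          refine sum_le_sum fun p hp ↦ ?_
          simp only [mem_filter, mem_range] at hp
          rw [vonMangoldt_apply_prime hp.2]
          have hp0 : (0 : ℝ) < p := by exact_mod_cast hp.2.pos
          have hfloor : (n : ℝ) / p ≤ 2 * ((n / p : ℕ) : ℝ) := by
            have h1 : 1 ≤ n / p := (Nat.one_le_div_iff hp.2.pos).mpr (by lia)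
            have h2 : n ≤ 2 * (n / p) * p := by
              have := Nat.lt_div_mul_add (a := n) hp.2.pos
              nlinarith
            rw [div_le_iff₀ hp0]
            exact_mod_cast h2
          calc (n : ℝ) / 2 * (Real.log p / p) = Real.log p * (n / p / 2) := by ring
            _ ≤ _ := by gcongr; linarith
      _ ≤ _ := sum_le_sum_of_subset_of_nonneg (fun p hp ↦ by
            simp only [mem_filter, mem_range] at hp
            exact mem_Ioc.mpr ⟨hp.2.pos, by lia⟩)
          fun _ _ _ ↦ mul_nonneg vonMangoldt_nonneg (Nat.cast_nonneg _)
  refine le_of_mul_le_mul_left ((hp.trans h).trans ?_) (show (0 : ℝ) < n / 2 by positivity)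
  linarith

theorem primeDistance_div_log_le {α : ℝ} (hα : 1 < α) (F : ℕ → ℂ) {n : ℕ} (hn : 2 ≤ n) :
    primeDistance F n / Real.log n ≤
      2 * ((1 / Real.log n) * ∑ p ∈ (range (n + 1)).filter Nat.Prime,
        ‖F p - 1‖ ^ α * Real.log p / p) ^ (1 / α) := by
  have hlog : 0 < Real.log n := Real.log_pos (by exact_mod_cast hn)
  have hw : ∑ p ∈ (range (n + 1)).filter Nat.Prime, Real.log p / p / Real.log n ≤ 2 := by
    rw [← sum_div, div_le_iff₀ hlog]
    exact sum_primes_log_div_le (by lia)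
  have hw0 : 0 ≤ ∑ p ∈ (range (n + 1)).filter Nat.Prime, Real.log p / p / Real.log n :=
    sum_nonneg fun _ _ ↦ by positivity
  have hα' : α⁻¹ ≤ 1 := inv_le_one_of_one_le₀ hα.le
  have hα0 : 0 ≤ α⁻¹ := by positivity
  have h := Real.inner_le_weight_mul_Lp_of_nonneg ((range (n + 1)).filter Nat.Prime) hα.le
    (fun p ↦ Real.log p / p / Real.log n) (fun p ↦ ‖F p - 1‖)
    (fun _ ↦ by positivity) (fun _ ↦ norm_nonneg _)
  calc primeDistance F n / Real.log n
      = ∑ p ∈ (range (n + 1)).filter Nat.Prime, Real.log p / p / Real.log n * ‖F p - 1‖ := by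
        rw [primeDistance, sum_div]
        exact sum_congr rfl fun _ _ ↦ by ring
    _ ≤ _ := h
    _ ≤ 2 * (∑ p ∈ (range (n + 1)).filter Nat.Prime,
          Real.log p / p / Real.log n * ‖F p - 1‖ ^ α) ^ α⁻¹ := by
        refine mul_le_mul_of_nonneg_right ?_
          (Real.rpow_nonneg (sum_nonneg fun _ _ ↦ by positivity) _)
        calc _ ≤ (2 : ℝ) ^ (1 - α⁻¹) := Real.rpow_le_rpow hw0 hw (by linarith)
          _ ≤ (2 : ℝ) ^ (1 : ℝ) := Real.rpow_le_rpow_of_exponent_le (by norm_num) (by linarith)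
          _ = 2 := Real.rpow_one 2
    _ = _ := by
        rw [mul_sum, one_div α]
        congr 2
        exact sum_congr rfl fun _ _ ↦ by ring

/-- The completely multiplicative function agreeing with `f` at the primes `p ≤ n` and taking
the value `1` at all other primes. -/
noncomputable def smoothPart (f : ℕ → ℂ) (n : ℕ) : ArithmeticFunction ℂ where
  toFun m := if m = 0 then 0 else (m.primeFactorsList.map fun p ↦ if p ≤ n then f p else 1).prod
  map_zero' := by simp

theorem smoothPart_apply {f : ℕ → ℂ} {n m : ℕ} (hm : m ≠ 0) :
    smoothPart f n m = (m.primeFactorsList.map fun p ↦ if p ≤ n then f p else 1).prod :=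
  if_neg hm

theorem smoothPart_mul (f : ℕ → ℂ) (n a b : ℕ) :
    smoothPart f n (a * b) = smoothPart f n a * smoothPart f n b := by
  rcases eq_or_ne a 0 with rfl | ha
  · simp
  rcases eq_or_ne b 0 with rfl | hb
  · simp
  rw [smoothPart_apply ha, smoothPart_apply hb, smoothPart_apply (mul_ne_zero ha hb),
    ← List.prod_append, ← List.map_append]
  exact ((Nat.perm_primeFactorsList_mul ha hb).map _).prod_eq

theorem smoothPart_prime {f : ℕ → ℂ} {n p : ℕ} (hp : p.Prime) :
    smoothPart f n p = if p ≤ n then f p else 1 := by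
  rw [smoothPart_apply hp.ne_zero, Nat.primeFactorsList_prime hp]
  simp

theorem smoothPart_eq_of_le {f : ℕ → ℂ} (h1 : f 1 = 1) (hmul : ∀ m n, f (m * n) = f m * f n)
    {n m : ℕ} (hm : m ≠ 0) (hmn : m ≤ n) : smoothPart f n m = f m := by
  let φ : ℕ →* ℂ := ⟨⟨f, h1⟩, hmul⟩
  rw [smoothPart_apply hm]
  calc _ = (m.primeFactorsList.map φ).prod := by
        congr 1
        refine List.map_congr_left fun p hp ↦ ?_
        exact if_pos ((Nat.le_of_mem_primeFactorsList hp).trans hmn)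
    _ = φ m.primeFactorsList.prod := (map_list_prod φ _).symm
    _ = f m := by rw [Nat.prod_primeFactorsList hm]; rfl

theorem norm_smoothPart_le {f : ℕ → ℂ} (hb : ∀ m, ‖f m‖ ≤ 1) (n m : ℕ) :
    ‖smoothPart f n m‖ ≤ 1 := by
  rcases eq_or_ne m 0 with rfl | hm
  · simp
  rw [smoothPart_apply hm]
  induction m.primeFactorsList with
  | nil => simp
  | cons p l ih =>
    rw [List.map_cons, List.prod_cons, norm_mul]
    refine mul_le_one₀ ?_ (norm_nonneg _) ih
    split_ifs
    · exact hb p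
    · simp

/-- For every `α > 1` there is `R(α) > 0` such that for every completely
multiplicative `f : ℕ → ℂ` with `|f(m)| ≤ 1` and every `n ≥ 2`,
`|(1/n) Σ_{m=1}^n f(m) − Π_{p≤n} (1 − 1/p)/(1 − f(p)/p)| ≤ R(α) μ_n(α)`, where
`μ_n(α) = ((1/log n) Σ_{p≤n} |f(p) − 1|^α (log p)/p)^{1/α}`. -/
theorem stmt_2 (α : ℝ) (hα : 1 < α) :
    ∃ R : ℝ, 0 < R ∧ ∀ f : ℕ → ℂ, f 1 = 1 → (∀ m n : ℕ, f (m * n) = f m * f n) →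
      (∀ m : ℕ, ‖f m‖ ≤ 1) → ∀ n : ℕ, 2 ≤ n →
      ‖(1 / (n : ℂ)) * ∑ m ∈ Finset.Icc 1 n, f m
          - ∏ p ∈ (Finset.range (n + 1)).filter Nat.Prime,
              (1 - 1 / (p : ℂ)) / (1 - f p / (p : ℂ))‖ ≤
        R * ((1 / Real.log n) *
          ∑ p ∈ (Finset.range (n + 1)).filter Nat.Prime,
            ‖f p - 1‖ ^ α * Real.log p / p) ^ (1 / α) := by
  refine ⟨560000, by norm_num, fun f h1 hmul hb n hn ↦ ?_⟩
  have hp : ∀ p ∈ (range (n + 1)).filter Nat.Prime, smoothPart f n p = f p := fun p hp ↦ by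
    simp only [mem_filter, mem_range] at hp
    rw [smoothPart_prime hp.2, if_pos (by lia)]
  have key := norm_mean_sub_prod_le (smoothPart f n)
    ((smoothPart_eq_of_le h1 hmul one_ne_zero (by lia)).trans h1) (smoothPart_mul f n)
    (norm_smoothPart_le hb n) hn
    (fun p hp hnp ↦ by rw [smoothPart_prime hp, if_neg (by lia)])
  have holder := primeDistance_div_log_le hα (smoothPart f n) hn
  rw [sum_congr rfl fun p hpm ↦ by rw [hp p hpm]] at holder
  rw [prod_congr rfl fun p hpm ↦ by rw [hp p hpm], sum_congr (g := f) rfl fun m hm ↦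
    smoothPart_eq_of_le h1 hmul (mem_Ioc.mp hm).1.ne' (mem_Ioc.mp hm).2] at key
  rw [one_div_mul_eq_div, show Icc 1 n = Ioc 0 n from rfl]
  linarith
end

section
/- There is an absolute constant C > 0 such that for all real x > 1 and all t > 0, Σ_{m≤x} f_t(m)/m ≤ C (1 + t log x). -/
open Filter Finset

/-- `f_t(m) = Σ_{d∣m} μ(d)/d^t`. -/
noncomputable def ft (t : ℝ) (m : ℕ) : ℝ :=
  ∑ d ∈ m.divisors, (ArithmeticFunction.moebius d : ℝ) / (d : ℝ) ^ t

lemma sum_divisors_rpow_mul_ft (t : ℝ) {n : ℕ} (hn : 0 < n) :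
    ∑ i ∈ n.divisors, (i : ℝ) ^ t * ft t i = (n : ℝ) ^ t := by
  refine ArithmeticFunction.sum_eq_iff_sum_mul_moebius_eq (R := ℝ)
    (f := fun i => (i : ℝ) ^ t * ft t i) (g := fun n => (n : ℝ) ^ t) |>.mpr ?_ n hn
  intro m hm
  rw [Nat.sum_divisorsAntidiagonal
    (fun a b => ((ArithmeticFunction.moebius a : ℤ) : ℝ) * (b : ℝ) ^ t)]
  simp only [ft, Finset.mul_sum]
  refine Finset.sum_congr rfl fun d hd => ?_
  have hdm := Nat.dvd_of_mem_divisors hd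
  have hd0 : (d : ℝ) ≠ 0 := by exact_mod_cast (Nat.pos_of_mem_divisors hd).ne'
  rw [Nat.cast_div hdm hd0, Real.div_rpow (by positivity) (by positivity)]
  ring

lemma sum_divisorsAntidiagonal_ft_mul_rpow (t s : ℝ) {m : ℕ} (hm : 0 < m) :
    ∑ x ∈ m.divisorsAntidiagonal, ft t x.1 * (x.1 : ℝ) ^ s * (x.2 : ℝ) ^ (s - t) =
      (m : ℝ) ^ s := by
  have hm' : (0 : ℝ) < m := by exact_mod_cast hm
  have h := congrArg (fun y => (m : ℝ) ^ (s - t) * y) (sum_divisors_rpow_mul_ft t hm)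
  simp only [← Real.rpow_add hm', sub_add_cancel] at h
  rw [← h, Finset.mul_sum,
    Nat.sum_divisorsAntidiagonal (fun a b => ft t a * (a : ℝ) ^ s * (b : ℝ) ^ (s - t))]
  refine Finset.sum_congr rfl fun d hd => ?_
  have hdm := Nat.dvd_of_mem_divisors hd
  have hd0 : (0 : ℝ) < d := by exact_mod_cast Nat.pos_of_mem_divisors hd
  have hs : (d : ℝ) ^ s = (d : ℝ) ^ (s - t) * (d : ℝ) ^ t := by
    rw [← Real.rpow_add hd0, sub_add_cancel]
  have hp : (d : ℝ) ^ (s - t) ≠ 0 := (Real.rpow_pos_of_pos hd0 _).ne'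
  rw [Nat.cast_div hdm hd0.ne', Real.div_rpow hm'.le hd0.le, hs]
  field_simp

/-- The arithmetic function `n ↦ n ^ (-t)`. -/
noncomputable def invRpow (t : ℝ) : ArithmeticFunction ℝ :=
  ⟨fun n => if n = 0 then 0 else ((n : ℝ) ^ t)⁻¹, by simp⟩

lemma invRpow_apply (t : ℝ) {n : ℕ} (hn : n ≠ 0) : invRpow t n = ((n : ℝ) ^ t)⁻¹ := by
  simp [invRpow, hn]

lemma isMultiplicative_invRpow (t : ℝ) : (invRpow t).IsMultiplicative := by
  rw [ArithmeticFunction.IsMultiplicative.iff_ne_zero]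
  refine ⟨by simp [invRpow], fun {m n} hm hn _ => ?_⟩
  rw [invRpow_apply t hm, invRpow_apply t hn, invRpow_apply t (mul_ne_zero hm hn), Nat.cast_mul,
    Real.mul_rpow (by positivity) (by positivity), mul_inv]

lemma ft_eq_mul_zeta (t : ℝ) (m : ℕ) :
    ft t m = (((ArithmeticFunction.moebius : ArithmeticFunction ℝ).pmul (invRpow t)) *
      (ArithmeticFunction.zeta : ArithmeticFunction ℝ)) m := by
  rw [ArithmeticFunction.coe_mul_zeta_apply]
  refine Finset.sum_congr rfl fun d hd => ?_
  simp [invRpow_apply t (Nat.pos_of_mem_divisors hd).ne', div_eq_mul_inv]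

lemma ft_prime_pow (t : ℝ) {p k : ℕ} (hp : p.Prime) (hk : k ≠ 0) :
    ft t (p ^ k) = 1 - ((p : ℝ) ^ t)⁻¹ := by
  obtain ⟨k, rfl⟩ := Nat.exists_eq_succ_of_ne_zero hk
  rw [ft, Nat.sum_divisors_prime_pow hp, Finset.sum_range_succ', Finset.sum_range_succ']
  rw [Finset.sum_eq_zero]
  · simp [ArithmeticFunction.moebius_apply_prime hp]
    ring
  · intro i _
    rw [ArithmeticFunction.moebius_apply_prime_pow hp (by lia)]
    simp

lemma ft_nonneg {t : ℝ} (ht : 0 ≤ t) (m : ℕ) : 0 ≤ ft t m := by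
  rcases eq_or_ne m 0 with rfl | hm
  · simp [ft]
  have hmul : (((ArithmeticFunction.moebius : ArithmeticFunction ℝ).pmul (invRpow t)) *
      (ArithmeticFunction.zeta : ArithmeticFunction ℝ)).IsMultiplicative :=
    (ArithmeticFunction.isMultiplicative_moebius.intCast.pmul (isMultiplicative_invRpow t)).mul
      ArithmeticFunction.isMultiplicative_zeta.natCast
  rw [ft_eq_mul_zeta, hmul.multiplicative_factorization _ hm]
  refine Finset.prod_nonneg fun p hp => ?_
  have hpp : p.Prime := Nat.prime_of_mem_primeFactors hp
  beta_reduce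
  rw [← ft_eq_mul_zeta, ft_prime_pow t hpp (Finsupp.mem_support_iff.mp hp)]
  have : (1 : ℝ) ≤ (p : ℝ) ^ t := Real.one_le_rpow (by exact_mod_cast hpp.one_lt.le) ht
  exact sub_nonneg.mpr (inv_le_one_of_one_le₀ this)

lemma sum_Icc_one_eq_sum_range (f : ℝ → ℝ) (N : ℕ) :
    ∑ m ∈ Finset.Icc 1 N, f m = ∑ i ∈ Finset.range N, f (1 + i) := by
  rw [Finset.range_eq_Ico, ← Finset.Ico_add_one_right_eq_Icc]
  have := Finset.sum_Ico_add' (fun m : ℕ => f m) 0 N 1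
  simp only [zero_add] at this
  rw [← this]
  exact Finset.sum_congr rfl fun i _ => by push_cast; rw [add_comm]

lemma antitoneOn_rpow {u : ℝ} (hu : 0 < u) (N : ℕ) :
    AntitoneOn (fun x : ℝ => x ^ (-1 - u)) (Set.Icc 1 (1 + N)) := by
  intro a ha b _ hab
  exact Real.rpow_le_rpow_of_nonpos (by linarith [ha.1]) hab (by linarith)

lemma integral_one_rpow {u : ℝ} (hu : 0 < u) (N : ℕ) :
    ∫ x in (1 : ℝ)..1 + N, x ^ (-1 - u) = (1 - (1 + N : ℝ) ^ (-u)) / u := by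
  rw [integral_rpow (Or.inr ⟨by linarith, ?_⟩)]
  · have : -1 - u + 1 = -u := by ring
    rw [this, Real.one_rpow, div_neg, ← neg_div, neg_sub]
  · rw [Set.uIcc_of_le (by simp)]
    intro h
    linarith [h.1]

lemma sum_rpow_le {u : ℝ} (hu : 0 < u) (N : ℕ) :
    ∑ m ∈ Finset.Icc 1 N, (m : ℝ) ^ (-1 - u) ≤ 1 + 1 / u := by
  have h := (antitoneOn_rpow hu N).sum_le_integral
  rw [integral_one_rpow hu] at h
  have hp : 0 ≤ (1 + N : ℝ) ^ (-u) := by positivity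
  have hb : (1 - (1 + N : ℝ) ^ (-u)) / u ≤ 1 / u := by gcongr; linarith
  rw [sum_Icc_one_eq_sum_range (fun x => x ^ (-1 - u))]
  calc _ ≤ ∑ i ∈ Finset.range (N + 1), (1 + (i : ℝ)) ^ (-1 - u) :=
        Finset.sum_le_sum_of_subset_of_nonneg (Finset.range_mono N.le_succ)
          fun i _ _ => by positivity
    _ ≤ 1 + 1 / u := by
        rw [Finset.sum_range_succ']
        simp only [Nat.cast_zero, add_zero, Real.one_rpow]
        linarith

lemma le_sum_rpow {u : ℝ} (hu : 0 < u) (N : ℕ) :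
    (1 - (1 + N : ℝ) ^ (-u)) / u ≤ ∑ m ∈ Finset.Icc 1 N, (m : ℝ) ^ (-1 - u) := by
  rw [sum_Icc_one_eq_sum_range (fun x => x ^ (-1 - u)), ← integral_one_rpow hu]
  exact (antitoneOn_rpow hu N).integral_le_sum

lemma sum_ft_mul_sum_rpow_le {t : ℝ} (ht : 0 ≤ t) (s : ℝ) (N M : ℕ) :
    (∑ a ∈ Finset.Icc 1 N, ft t a * (a : ℝ) ^ s) * ∑ b ∈ Finset.Icc 1 M, (b : ℝ) ^ (s - t) ≤
      ∑ m ∈ Finset.Icc 1 (N * M), (m : ℝ) ^ s := by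
  have hmaps : ∀ x ∈ Finset.Icc 1 N ×ˢ Finset.Icc 1 M, x.1 * x.2 ∈ Finset.Icc 1 (N * M) := by
    intro x hx
    simp only [Finset.mem_product, Finset.mem_Icc] at hx ⊢
    exact ⟨Nat.mul_pos hx.1.1 hx.2.1, Nat.mul_le_mul hx.1.2 hx.2.2⟩
  rw [Finset.sum_mul_sum, ← Finset.sum_product', ← Finset.sum_fiberwise_of_maps_to hmaps]
  refine Finset.sum_le_sum fun m hm => ?_
  have hm0 : 0 < m := (Finset.mem_Icc.mp hm).1
  rw [← sum_divisorsAntidiagonal_ft_mul_rpow t s hm0]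
  refine Finset.sum_le_sum_of_subset_of_nonneg (fun x hx => ?_) fun x _ _ => ?_
  · exact Nat.mem_divisorsAntidiagonal.mpr ⟨(Finset.mem_filter.mp hx).2, hm0.ne'⟩
  · have := ft_nonneg ht x.1
    positivity

lemma sum_ft_mul_rpow_le {t u : ℝ} (ht : 0 < t) (hu : 0 < u) (N : ℕ) :
    ∑ a ∈ Finset.Icc 1 N, ft t a * (a : ℝ) ^ (-1 - u) ≤ 2 + t / u := by
  set S := ∑ a ∈ Finset.Icc 1 N, ft t a * (a : ℝ) ^ (-1 - u) with hS
  have hS0 : 0 ≤ S := Finset.sum_nonneg fun a _ => mul_nonneg (ft_nonneg ht.le a) (by positivity)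
  have hut : 0 < u + t := by linarith
  have hbound (M : ℕ) : S * ∑ b ∈ Finset.Icc 1 M, (b : ℝ) ^ (-1 - (u + t)) ≤ 1 + 1 / u := by
    have := (sum_ft_mul_sum_rpow_le ht.le (-1 - u) N M).trans (sum_rpow_le hu _)
    rwa [show -1 - u - t = -1 - (u + t) by ring] at this
  have hone : S ≤ 1 + 1 / u := by simpa using hbound 1
  have hlim : S * (1 / (u + t)) ≤ 1 + 1 / u := by
    have htend : Tendsto (fun M : ℕ => S * ((1 - (1 + M : ℝ) ^ (-(u + t))) / (u + t))) atTop
        (nhds (S * ((1 - 0) / (u + t)))) :=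
      (((tendsto_rpow_neg_atTop hut).comp
        (tendsto_atTop_add_const_left _ 1 tendsto_natCast_atTop_atTop)).const_sub 1
          |>.div_const _).const_mul S
    rw [sub_zero] at htend
    exact le_of_tendsto' htend fun M =>
      (mul_le_mul_of_nonneg_left (le_sum_rpow hut M) hS0).trans (hbound M)
  have hlim' : S ≤ (1 + 1 / u) * (u + t) := by
    rwa [mul_one_div, div_le_iff₀ hut] at hlim
  have htu : 0 < t / u := div_pos ht hu
  rcases le_total (u + t) 1 with h | h
  · have : (1 + 1 / u) * (u + t) = (u + t) + (1 + t / u) := by field_simp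
    linarith
  · have : 1 / u ≤ 1 + t / u := by
      rw [div_le_iff₀ hu, add_mul, div_mul_cancel₀ _ hu.ne']
      linarith
    linarith

/-- There is an absolute `C > 0` such that for all `x > 1` and `t > 0`,
`Σ_{m≤x} f_t(m)/m ≤ C (1 + t log x)`. -/
theorem stmt_6 :
    ∃ C : ℝ, 0 < C ∧ ∀ x : ℝ, 1 < x → ∀ t : ℝ, 0 < t →
      ∑ m ∈ Finset.Icc 1 ⌊x⌋₊, ft t m / m ≤ C * (1 + t * Real.log x) := by
  refine ⟨2 * Real.exp 1, by positivity, fun x hx t ht => ?_⟩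
  have hlog : 0 < Real.log x := Real.log_pos hx
  have hx0 : 0 < x := by linarith
  calc ∑ m ∈ Finset.Icc 1 ⌊x⌋₊, ft t m / m
      ≤ ∑ m ∈ Finset.Icc 1 ⌊x⌋₊,
          Real.exp 1 * (ft t m * (m : ℝ) ^ (-1 - (Real.log x)⁻¹)) := by
        refine Finset.sum_le_sum fun m hm => ?_
        have hm0 : (0 : ℝ) < m := by exact_mod_cast (Finset.mem_Icc.mp hm).1
        have hmx : (m : ℝ) ≤ x := (Nat.le_floor_iff hx0.le).mp (Finset.mem_Icc.mp hm).2
        have hexp : (m : ℝ) ^ (Real.log x)⁻¹ ≤ Real.exp 1 := by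
          refine (Real.rpow_le_rpow hm0.le hmx (by positivity)).trans_eq ?_
          rw [Real.rpow_def_of_pos hx0, mul_inv_cancel₀ hlog.ne']
        have hpos : 0 < (m : ℝ) ^ (Real.log x)⁻¹ := Real.rpow_pos_of_pos hm0 _
        have hf := ft_nonneg ht.le m
        rw [Real.rpow_sub hm0, Real.rpow_neg_one]
        calc ft t m / m = ft t m / m * 1 := (mul_one _).symm
          _ ≤ ft t m / m * (Real.exp 1 / (m : ℝ) ^ (Real.log x)⁻¹) := by
              gcongr
              exact (one_le_div hpos).mpr hexp
          _ = _ := by ring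
    _ ≤ Real.exp 1 * (2 + t / (Real.log x)⁻¹) := by
        rw [← Finset.mul_sum]
        gcongr
        exact sum_ft_mul_rpow_le ht (by positivity) _
    _ ≤ 2 * Real.exp 1 * (1 + t * Real.log x) := by
        rw [div_inv_eq_mul, mul_comm 2, mul_assoc]
        gcongr
        nlinarith [mul_pos ht hlog]
end

section
/- There is an absolute constant C > 0 such that for all real x > 1 and all t > 0, | Σ_{m≤x} f_t(m)/m − Σ_{d≤x} (μ(d)/d^{1+t}) log(x/d) | ≤ C. -/
open Filter Finset

open ArithmeticFunction in
/-- The partial sums `Σ_{d≤n} μ(d)/d` are bounded. -/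
lemma abs_sum_moebius_div_le_two (n : ℕ) :
    |∑ d ∈ Finset.Icc 1 n, (moebius d : ℝ) / d| ≤ 2 := by
  rcases Nat.eq_zero_or_pos n with rfl | hn
  · simp
  have hn' : (0 : ℝ) < n := by exact_mod_cast hn
  have hsum : ∑ d ∈ Finset.Icc 1 n, (moebius d : ℝ) * ((n / d : ℕ) : ℝ) = 1 := by
    have h := sum_Ioc_mul_zeta_eq_sum moebius n
    rw [moebius_mul_coe_zeta] at h
    have h1 : ∑ m ∈ Finset.Ioc 0 n, (1 : ArithmeticFunction ℤ) m = 1 := by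
      simp only [one_apply]
      rw [Finset.sum_ite_eq' (Finset.Ioc 0 n) 1]
      simp only [Finset.mem_Ioc]
      rw [if_pos ⟨one_pos, hn⟩]
    rw [h1] at h
    change ∑ d ∈ Finset.Ioc 0 n, (moebius d : ℝ) * ((n / d : ℕ) : ℝ) = 1
    simpa only [Int.cast_sum, Int.cast_mul, Int.cast_natCast, Int.cast_one] using
      congrArg (Int.cast : ℤ → ℝ) h.symm
  have hrem : |∑ d ∈ Finset.Icc 1 n, (moebius d : ℝ) * ((n : ℝ) / d - ((n / d : ℕ) : ℝ))| ≤ n := by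
    refine (Finset.abs_sum_le_sum_abs _ _).trans ?_
    calc _ ≤ ∑ _d ∈ Finset.Icc 1 n, (1 : ℝ) := Finset.sum_le_sum fun d _ => ?_
      _ = n := by simp
    rw [abs_mul]
    refine mul_le_one₀ (by exact_mod_cast abs_moebius_le_one (n := d)) (abs_nonneg _) ?_
    rw [← Nat.floor_div_eq_div (K := ℝ), abs_le]
    have := Nat.floor_le (div_nonneg n.cast_nonneg d.cast_nonneg : (0 : ℝ) ≤ (n : ℝ) / d)
    have := Nat.lt_floor_add_one ((n : ℝ) / d)
    constructor <;> linarith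
  have hsplit : ∑ d ∈ Finset.Icc 1 n, (moebius d : ℝ) * ((n : ℝ) / d - ((n / d : ℕ) : ℝ)) =
      n * ∑ d ∈ Finset.Icc 1 n, (moebius d : ℝ) / d - 1 := by
    simp_rw [mul_sub, Finset.sum_sub_distrib, hsum, Finset.mul_sum]
    congr 1
    exact Finset.sum_congr rfl fun d _ => by ring
  rw [hsplit] at hrem
  have h1 : (1 : ℝ) ≤ n := by exact_mod_cast hn
  rw [abs_le] at hrem ⊢
  constructor
  · nlinarith
  · nlinarith

/-- Abel's inequality: a nonnegative antitone weight does not increase the bound `B` on the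
partial sums of `a` by more than its first value. -/
lemma abs_sum_mul_le_of_antitone {a w : ℕ → ℝ} {B : ℝ}
    (ha : ∀ n, |∑ i ∈ Finset.Icc 1 n, a i| ≤ B) (hw0 : ∀ n, 0 ≤ w (n + 1))
    (hw : ∀ n, w (n + 2) ≤ w (n + 1)) (n : ℕ) :
    |∑ i ∈ Finset.Icc 1 n, a i * w i| ≤ B * w 1 := by
  have key : ∀ n, |∑ i ∈ Finset.Icc 1 n, a i * w i - w (n + 1) * ∑ i ∈ Finset.Icc 1 n, a i| ≤
      B * (w 1 - w (n + 1)) := by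
    intro n
    induction n with
    | zero => simp
    | succ n ih =>
      have h := mul_le_mul_of_nonneg_left (ha (n + 1)) (sub_nonneg.2 (hw n))
      rw [← abs_of_nonneg (sub_nonneg.2 (hw n)), ← abs_mul,
        abs_of_nonneg (sub_nonneg.2 (hw n))] at h
      rw [Finset.sum_Icc_succ_top (by lia)] at h ⊢
      rw [Finset.sum_Icc_succ_top (by lia)]
      calc _ = |(∑ i ∈ Finset.Icc 1 n, a i * w i - w (n + 1) * ∑ i ∈ Finset.Icc 1 n, a i) +
            (w (n + 1) - w (n + 2)) * (∑ i ∈ Finset.Icc 1 n, a i + a (n + 1))| := by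
            congr 1; ring
        _ ≤ B * (w 1 - w (n + 1)) + (w (n + 1) - w (n + 2)) * B :=
            (abs_add_le _ _).trans (add_le_add ih h)
        _ = _ := by ring
  have h1 := key n
  have h2 := mul_le_mul_of_nonneg_left (ha n) (hw0 n)
  rw [← abs_of_nonneg (hw0 n), ← abs_mul, abs_of_nonneg (hw0 n)] at h2
  have h3 := abs_add_le (∑ i ∈ Finset.Icc 1 n, a i * w i - w (n + 1) * ∑ i ∈ Finset.Icc 1 n, a i)
    (w (n + 1) * ∑ i ∈ Finset.Icc 1 n, a i)
  rw [sub_add_cancel] at h3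
  linarith

lemma abs_sum_moebius_div_rpow_le_two {t : ℝ} (ht : 0 ≤ t) (n : ℕ) :
    |∑ d ∈ Finset.Icc 1 n, (ArithmeticFunction.moebius d : ℝ) / (d : ℝ) ^ (1 + t)| ≤ 2 := by
  have h := abs_sum_mul_le_of_antitone (w := fun d => (d : ℝ) ^ (-t))
    abs_sum_moebius_div_le_two (fun n => by positivity)
    (fun n => Real.rpow_le_rpow_of_nonpos (by positivity) (by push_cast; linarith) (by linarith)) n
  simp only [Nat.cast_one, Real.one_rpow, mul_one] at h
  convert h using 3 with d hd
  have hd : (0 : ℝ) < d := by exact_mod_cast (Finset.mem_Icc.1 hd).1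
  rw [Real.rpow_add hd, Real.rpow_one, Real.rpow_neg hd.le]
  ring

lemma abs_harmonic_floor_sub_log_sub_eulerMascheroni_le {y : ℝ} (hy : 1 ≤ y) :
    |(harmonic ⌊y⌋₊ : ℝ) - Real.log y - Real.eulerMascheroniConstant| ≤ 2 / y := by
  set N := ⌊y⌋₊ with hN
  have hN1 : 1 ≤ N := Nat.floor_pos.2 hy
  have hN1' : (1 : ℝ) ≤ N := by exact_mod_cast hN1
  have hlo := Real.eulerMascheroniSeq_lt_eulerMascheroniConstant N
  have hhi := Real.eulerMascheroniConstant_lt_eulerMascheroniSeq' N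
  rw [Real.eulerMascheroniSeq] at hlo
  rw [Real.eulerMascheroniSeq', if_neg (by lia)] at hhi
  have hle : (N : ℝ) ≤ y := Nat.floor_le (by linarith)
  have hlt : y < N + 1 := Nat.lt_floor_add_one y
  have hl1 : Real.log N ≤ Real.log y := Real.log_le_log (by linarith) hle
  have hl2 : Real.log y ≤ Real.log (N + 1) := Real.log_le_log (by linarith) hlt.le
  have hl3 : Real.log (N + 1) - Real.log N ≤ 1 / N := by
    rw [← Real.log_div (by linarith) (by linarith)]
    refine (Real.log_le_sub_one_of_pos (by positivity)).trans_eq ?_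
    field_simp
    ring
  have hl4 : 1 / (N : ℝ) ≤ 2 / y := by
    rw [div_le_div_iff₀ (by linarith) (by linarith)]
    linarith
  rw [abs_le]
  constructor <;> linarith

lemma sum_ft_div (t : ℝ) (N : ℕ) :
    ∑ m ∈ Finset.Icc 1 N, ft t m / m = ∑ d ∈ Finset.Icc 1 N,
      (ArithmeticFunction.moebius d : ℝ) / (d : ℝ) ^ (1 + t) * (harmonic (N / d) : ℝ) := by
  let F : ArithmeticFunction ℝ :=
    ⟨fun d => (ArithmeticFunction.moebius d : ℝ) / (d : ℝ) ^ (1 + t), by simp⟩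
  let G : ArithmeticFunction ℝ := ⟨fun m => (m : ℝ)⁻¹, by simp⟩
  have h := ArithmeticFunction.sum_Ioc_mul_eq_sum_sum F G N
  calc _ = ∑ m ∈ Finset.Ioc 0 N, (F * G) m := Finset.sum_congr rfl fun m hm => ?_
    _ = _ := h
    _ = _ := Finset.sum_congr rfl fun d _ => ?_
  · rw [ArithmeticFunction.mul_apply, Nat.sum_divisorsAntidiagonal (fun d e => F d * G e), ft,
      Finset.sum_div]
    refine Finset.sum_congr rfl fun d hd => ?_
    obtain ⟨⟨e, rfl⟩, hne⟩ := Nat.mem_divisors.1 hd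
    have hd0 : 0 < d := Nat.pos_of_ne_zero (left_ne_zero_of_mul hne)
    have hd' : (0 : ℝ) < d := by exact_mod_cast hd0
    rw [Nat.mul_div_cancel_left _ hd0]
    simp only [F, G, ArithmeticFunction.coe_mk]
    rw [Real.rpow_add hd', Real.rpow_one, Nat.cast_mul]
    simp only [div_eq_mul_inv, mul_inv]
    ring
  · rw [harmonic_eq_sum_Icc]
    push_cast
    rfl

/-- There is an absolute `C > 0` such that for all `x > 1` and `t > 0`,
`|Σ_{m≤x} f_t(m)/m − Σ_{d≤x} (μ(d)/d^{1+t}) log(x/d)| ≤ C`. -/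
theorem stmt_8 :
    ∃ C : ℝ, 0 < C ∧ ∀ x : ℝ, 1 < x → ∀ t : ℝ, 0 < t →
      |∑ m ∈ Finset.Icc 1 ⌊x⌋₊, ft t m / m
        - ∑ d ∈ Finset.Icc 1 ⌊x⌋₊,
            (ArithmeticFunction.moebius d : ℝ) / (d : ℝ) ^ (1 + t) * Real.log (x / d)| ≤ C := by
  refine ⟨4, by norm_num, fun x hx t ht => ?_⟩
  have hx0 : 0 < x := by linarith
  set N := ⌊x⌋₊ with hN
  set γ := Real.eulerMascheroniConstant
  let c : ℕ → ℝ := fun d => (ArithmeticFunction.moebius d : ℝ) / (d : ℝ) ^ (1 + t)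
  let E : ℕ → ℝ := fun d => (harmonic (N / d) : ℝ) - Real.log (x / d) - γ
  have hmain : |γ * ∑ d ∈ Finset.Icc 1 N, c d| ≤ 2 := by
    have hγ0 : (0 : ℝ) < γ := by linarith [Real.one_half_lt_eulerMascheroniConstant]
    have hγ1 : γ < 1 := by linarith [Real.eulerMascheroniConstant_lt_two_thirds]
    rw [abs_mul, abs_of_pos hγ0]
    nlinarith [abs_sum_moebius_div_rpow_le_two ht.le N]
  have hterm : ∀ d ∈ Finset.Icc 1 N, |c d * E d| ≤ 2 / x := by
    intro d hd
    obtain ⟨hd1, hdN⟩ := Finset.mem_Icc.1 hd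
    have hd1' : (1 : ℝ) ≤ d := by exact_mod_cast hd1
    have hd0 : (0 : ℝ) < d := by linarith
    have hdx : (d : ℝ) ≤ x := (Nat.le_floor_iff hx0.le).1 hdN
    have hE : |E d| ≤ 2 / (x / d) := by
      have h := abs_harmonic_floor_sub_log_sub_eulerMascheroni_le ((one_le_div hd0).2 hdx)
      rwa [Nat.floor_div_natCast] at h
    have hc : |c d| ≤ 1 / d := by
      have hpow : (d : ℝ) ≤ (d : ℝ) ^ (1 + t) := by
        simpa using Real.rpow_le_rpow_of_exponent_le hd1' (by linarith : (1 : ℝ) ≤ 1 + t)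
      have hμ : |(ArithmeticFunction.moebius d : ℝ)| ≤ 1 := by
        exact_mod_cast ArithmeticFunction.abs_moebius_le_one (n := d)
      rw [abs_div, abs_of_pos (by linarith : (0 : ℝ) < (d : ℝ) ^ (1 + t))]
      exact div_le_div₀ zero_le_one hμ hd0 hpow
    rw [abs_mul]
    calc _ ≤ 1 / d * (2 / (x / d)) := by gcongr
      _ = 2 / x := by field_simp
  have herr : |∑ d ∈ Finset.Icc 1 N, c d * E d| ≤ 2 := by
    refine (Finset.abs_sum_le_sum_abs _ _).trans ((Finset.sum_le_sum hterm).trans ?_)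
    rw [Finset.sum_const, Nat.card_Icc, nsmul_eq_mul, Nat.add_sub_cancel, mul_div_assoc',
      div_le_iff₀ hx0]
    linarith [Nat.floor_le hx0.le]
  have hsplit : ∑ m ∈ Finset.Icc 1 N, ft t m / m
        - ∑ d ∈ Finset.Icc 1 N,
            (ArithmeticFunction.moebius d : ℝ) / (d : ℝ) ^ (1 + t) * Real.log (x / d) =
      γ * ∑ d ∈ Finset.Icc 1 N, c d + ∑ d ∈ Finset.Icc 1 N, c d * E d := by
    rw [sum_ft_div, ← Finset.sum_sub_distrib, Finset.mul_sum, ← Finset.sum_add_distrib]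
    exact Finset.sum_congr rfl fun d _ => by simp only [c, E]; ring
  rw [hsplit]
  linarith [abs_add_le (γ * ∑ d ∈ Finset.Icc 1 N, c d) (∑ d ∈ Finset.Icc 1 N, c d * E d)]
end

section
/- There is an absolute constant C > 0 such that for all real x > 1 and all t > 0, F_t(x) − F_t(x/2) ≤ C x ( 1/log x + t ). -/
open Filter Finset

/-- `F_t(x) = Σ_{1≤m≤x} f_t(m)`. -/
noncomputable def Ft (t : ℝ) (x : ℝ) : ℝ := ∑ m ∈ Finset.Icc 1 ⌊x⌋₊, ft t m

open scoped ArithmeticFunction.Moebius ArithmeticFunction.zeta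

namespace ArithmeticFunction

theorem pmul_mul_of_map_mul {R : Type*} [CommSemiring R] {k : ArithmeticFunction R}
    (hk : ∀ a b, k (a * b) = k a * k b) (f g : ArithmeticFunction R) :
    k.pmul (f * g) = k.pmul f * k.pmul g := by
  ext n
  simp only [pmul_apply, mul_apply, Finset.mul_sum]
  refine Finset.sum_congr rfl fun p hp ↦ ?_
  rw [← (Nat.mem_divisorsAntidiagonal.1 hp).1, hk]
  ring

/-- The completely multiplicative function `n ↦ n ^ (-t)`, vanishing at `0`. -/
noncomputable def rpowNeg (t : ℝ) : ArithmeticFunction ℝ :=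
  ⟨fun n ↦ if n = 0 then 0 else (n : ℝ) ^ (-t), by simp⟩

theorem rpowNeg_apply {t : ℝ} {n : ℕ} (hn : n ≠ 0) : rpowNeg t n = (n : ℝ) ^ (-t) := by
  simp [rpowNeg, hn]

theorem rpowNeg_nonneg (t : ℝ) (n : ℕ) : 0 ≤ rpowNeg t n := by
  rcases eq_or_ne n 0 with rfl | hn
  · simp
  · rw [rpowNeg_apply hn]; positivity

theorem rpowNeg_mul (t : ℝ) (a b : ℕ) : rpowNeg t (a * b) = rpowNeg t a * rpowNeg t b := by
  rcases eq_or_ne a 0 with rfl | ha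
  · simp
  rcases eq_or_ne b 0 with rfl | hb
  · simp
  rw [rpowNeg_apply ha, rpowNeg_apply hb, rpowNeg_apply (mul_ne_zero ha hb), Nat.cast_mul,
    Real.mul_rpow (by positivity) (by positivity)]

theorem rpowNeg_one (t : ℝ) : rpowNeg t 1 = 1 := by simp [rpowNeg]

theorem isMultiplicative_rpowNeg (t : ℝ) : (rpowNeg t).IsMultiplicative :=
  ⟨rpowNeg_one t, fun _ ↦ rpowNeg_mul t _ _⟩

/-- The arithmetic function `m ↦ ft t m`. -/
noncomputable def ftFun (t : ℝ) : ArithmeticFunction ℝ :=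
  (rpowNeg t).pmul ((μ : ArithmeticFunction ℤ) : ArithmeticFunction ℝ) * (ζ : ArithmeticFunction ℝ)

theorem ftFun_apply (t : ℝ) (m : ℕ) : ftFun t m = ft t m := by
  rw [ftFun, coe_mul_zeta_apply, ft]
  refine Finset.sum_congr rfl fun d hd ↦ ?_
  have hd0 : d ≠ 0 := (Nat.pos_of_mem_divisors hd).ne'
  rw [pmul_apply, rpowNeg_apply hd0, intCoe_apply, Real.rpow_neg (by positivity), div_eq_mul_inv,
    mul_comm]

theorem ftFun_mul_rpowNeg (t : ℝ) : ftFun t * rpowNeg t = (ζ : ArithmeticFunction ℝ) := by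
  have h : (rpowNeg t).pmul ((μ : ArithmeticFunction ℤ) : ArithmeticFunction ℝ) * rpowNeg t = 1 := by
    have h1 := pmul_mul_of_map_mul (rpowNeg_mul t) ((μ : ArithmeticFunction ℤ) :
      ArithmeticFunction ℝ) (ζ : ArithmeticFunction ℝ)
    rw [pmul_zeta, coe_moebius_mul_coe_zeta] at h1
    rw [← h1]
    ext n
    rcases eq_or_ne n 1 with rfl | hn
    · simp [rpowNeg_one]
    · simp [one_apply_ne hn]
  rw [ftFun, mul_right_comm, h, one_mul]

theorem ft_eq_prod (t : ℝ) {m : ℕ} (hm : m ≠ 0) :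
    ft t m = ∏ p ∈ m.primeFactors, (1 - (p : ℝ) ^ (-t)) := by
  have h1 : (ftFun t).IsMultiplicative :=
    ((isMultiplicative_rpowNeg t).pmul isMultiplicative_moebius.intCast).mul
      isMultiplicative_zeta.natCast
  have h2 : (prodPrimeFactors fun p : ℕ ↦ 1 - (p : ℝ) ^ (-t)).IsMultiplicative :=
    IsMultiplicative.prodPrimeFactors _
  rw [← ftFun_apply, ← prodPrimeFactors_apply hm]
  congr 1
  refine (h1.eq_iff_eq_on_prime_powers _ _ h2).2 fun p i hp ↦ ?_
  rcases i with _ | i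
  · simp [h1.1, h2.1]
  rw [prodPrimeFactors_apply (pow_ne_zero _ hp.ne_zero), Nat.primeFactors_prime_pow (by simp) hp,
    Finset.prod_singleton, ftFun, coe_mul_zeta_apply, Nat.sum_divisors_prime_pow hp,
    Finset.sum_range_succ', Finset.sum_range_succ']
  have : ∀ k ∈ Finset.range i, ((rpowNeg t).pmul ((μ : ArithmeticFunction ℤ) :
      ArithmeticFunction ℝ)) (p ^ (k + 1 + 1)) = 0 := fun k _ ↦ by
    rw [pmul_apply, intCoe_apply, moebius_apply_prime_pow hp (by simp)]
    simp
  rw [Finset.sum_eq_zero this]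
  simp [rpowNeg_apply hp.ne_zero, rpowNeg_one, moebius_apply_prime hp]
  ring

theorem one_sub_rpow_neg_mem_Icc {t : ℝ} (ht : 0 < t) {n : ℕ} (hn : n ≠ 0) :
    0 ≤ 1 - (n : ℝ) ^ (-t) ∧ 1 - (n : ℝ) ^ (-t) ≤ 1 := by
  have h1 : (1 : ℝ) ≤ n := by exact_mod_cast Nat.one_le_iff_ne_zero.2 hn
  have := Real.rpow_le_one_of_one_le_of_nonpos h1 (neg_nonpos.2 ht.le)
  have : 0 ≤ (n : ℝ) ^ (-t) := by positivity
  constructor <;> linarith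

theorem ft_nonneg {t : ℝ} (ht : 0 < t) (m : ℕ) : 0 ≤ ft t m := by
  rcases eq_or_ne m 0 with rfl | hm
  · simp [ft]
  rw [ft_eq_prod t hm]
  exact Finset.prod_nonneg fun p hp ↦
    (one_sub_rpow_neg_mem_Icc ht (Nat.prime_of_mem_primeFactors hp).ne_zero).1

theorem ft_le_of_dvd {t : ℝ} (ht : 0 < t) {m n : ℕ} (hn : n ≠ 0) (h : m ∣ n) :
    ft t n ≤ ft t m := by
  rw [ft_eq_prod t hn, ft_eq_prod t (ne_zero_of_dvd_ne_zero hn h)]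
  have hb : ∀ p ∈ n.primeFactors, 0 ≤ 1 - (p : ℝ) ^ (-t) ∧ 1 - (p : ℝ) ^ (-t) ≤ 1 := fun p hp ↦
    one_sub_rpow_neg_mem_Icc ht (Nat.prime_of_mem_primeFactors hp).ne_zero
  have hs := Nat.primeFactors_mono h hn
  rw [← Finset.prod_sdiff hs]
  refine mul_le_of_le_one_left (Finset.prod_nonneg fun p hp ↦ (hb p (hs hp)).1) ?_
  exact Finset.prod_le_one (fun p hp ↦ (hb p (Finset.sdiff_subset hp)).1)
    fun p hp ↦ (hb p (Finset.sdiff_subset hp)).2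

theorem ft_le_one {t : ℝ} (ht : 0 < t) {m : ℕ} (hm : m ≠ 0) : ft t m ≤ 1 := by
  simpa [ft_eq_prod t one_ne_zero] using ft_le_of_dvd ht hm (one_dvd m)

/-- Chebyshev's bound turns the logarithmically weighted sum into a logarithmic mean. -/
theorem sum_ft_mul_log_le {t : ℝ} (ht : 0 < t) (N : ℕ) :
    ∑ n ∈ Ioc 0 N, ft t n * Real.log n ≤
      (Real.log 4 + 4) * N * ∑ n ∈ Ioc 0 N, ft t n / n := by
  calc ∑ n ∈ Ioc 0 N, ft t n * Real.log n
      ≤ ∑ n ∈ Ioc 0 N, (ftFun t * vonMangoldt) n := by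
        refine Finset.sum_le_sum fun n hn ↦ ?_
        have hn0 : n ≠ 0 := (Finset.mem_Ioc.1 hn).1.ne'
        rw [← log_apply, ← zeta_mul_vonMangoldt, mul_apply, mul_apply, Finset.mul_sum]
        refine Finset.sum_le_sum fun p hp ↦ ?_
        have hp' := Nat.mem_divisorsAntidiagonal.1 hp
        have h1 : p.1 ≠ 0 := Nat.ne_zero_of_mul_ne_zero_left (hp'.1 ▸ hp'.2)
        rw [natCoe_apply, zeta_apply_ne h1, Nat.cast_one, one_mul, ftFun_apply]
        exact mul_le_mul_of_nonneg_right (ft_le_of_dvd ht hn0 (Dvd.intro _ hp'.1))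
          vonMangoldt_nonneg
    _ = ∑ n ∈ Ioc 0 N, ft t n * Chebyshev.psi ((N : ℝ) / n) := by
        rw [sum_Ioc_mul_eq_sum_sum]
        simp [Chebyshev.psi, ftFun_apply, Nat.floor_div_eq_div]
    _ ≤ ∑ n ∈ Ioc 0 N, ft t n * ((Real.log 4 + 4) * ((N : ℝ) / n)) := by
        refine Finset.sum_le_sum fun n _ ↦ mul_le_mul_of_nonneg_left ?_ (ft_nonneg ht n)
        exact Chebyshev.psi_le_const_mul_self (by positivity)
    _ = _ := by
        rw [Finset.mul_sum]
        exact Finset.sum_congr rfl fun n _ ↦ by ring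

theorem sum_ft_div_mul_sum_rpow_le {t : ℝ} (ht : 0 < t) {N : ℕ} (hN : N ≠ 0) :
    (∑ n ∈ Ioc 0 N, ft t n / n) * (∑ n ∈ Ioc 0 N, (n : ℝ) ^ (-t) / n) ≤
      1 + 2 * Real.log N := by
  have key := pmul_mul_of_map_mul (rpowNeg_mul 1) (ftFun t) (rpowNeg t)
  rw [ftFun_mul_rpowNeg, pmul_zeta] at key
  calc (∑ n ∈ Ioc 0 N, ft t n / n) * (∑ n ∈ Ioc 0 N, (n : ℝ) ^ (-t) / n)
      = ∑ p ∈ Ioc 0 N ×ˢ Ioc 0 N,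
          ((rpowNeg 1).pmul (ftFun t)) p.1 * ((rpowNeg 1).pmul (rpowNeg t)) p.2 := by
        rw [Finset.sum_mul_sum, Finset.sum_product]
        refine Finset.sum_congr rfl fun a ha ↦ Finset.sum_congr rfl fun b hb ↦ ?_
        have ha' := (Finset.mem_Ioc.1 ha).1.ne'
        have hb' := (Finset.mem_Ioc.1 hb).1.ne'
        rw [pmul_apply, pmul_apply, rpowNeg_apply ha', rpowNeg_apply hb', rpowNeg_apply hb',
          Real.rpow_neg_one, Real.rpow_neg_one, ftFun_apply]
        ring
    _ ≤ ∑ n ∈ Ioc 0 (N * N), rpowNeg 1 n := by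
        rw [congrArg (fun k : ArithmeticFunction ℝ ↦ ∑ n ∈ Ioc 0 (N * N), k n) key,
          sum_Ioc_mul_eq_sum_prod_filter]
        refine Finset.sum_le_sum_of_subset_of_nonneg (fun p hp ↦ ?_) fun p _ _ ↦ ?_
        · simp only [Finset.mem_product, Finset.mem_filter, Finset.mem_Ioc] at hp ⊢
          have := Nat.mul_le_mul hp.1.2 hp.2.2
          have := Nat.le_mul_self N
          omega
        · rw [pmul_apply, pmul_apply, ftFun_apply]
          have := ft_nonneg ht p.1
          have := rpowNeg_nonneg 1 p.1
          have := rpowNeg_nonneg 1 p.2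
          have := rpowNeg_nonneg t p.2
          positivity
    _ = (harmonic (N * N) : ℝ) := by
        rw [harmonic_eq_sum_Icc, Rat.cast_sum]
        refine Finset.sum_congr (by ext; simp [Nat.one_le_iff_ne_zero, Nat.pos_iff_ne_zero]) ?_
        intro n hn
        rw [rpowNeg_apply (Nat.one_le_iff_ne_zero.1 (Finset.mem_Icc.1 hn).1), Real.rpow_neg_one]
        simp
    _ ≤ 1 + Real.log ((N * N : ℕ) : ℝ) := harmonic_le_one_add_log _
    _ = 1 + 2 * Real.log N := by
        have : (N : ℝ) ≠ 0 := by exact_mod_cast hN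
        rw [Nat.cast_mul, Real.log_mul this this]
        ring

theorem one_sub_rpow_neg_le_mul_sum {t : ℝ} (ht : 0 < t) (N : ℕ) :
    1 - ((N + 1 : ℕ) : ℝ) ^ (-t) ≤ t * ∑ n ∈ Ioc 0 N, (n : ℝ) ^ (-t) / n := by
  induction N with
  | zero => simp
  | succ N ih =>
    rw [Finset.sum_Ioc_succ_top (Nat.zero_le N), mul_add]
    set a : ℝ := ((N + 1 : ℕ) : ℝ) with ha
    have ha0 : 0 < a := by positivity
    have hsplit : ((N + 1 + 1 : ℕ) : ℝ) = a * (1 + 1 / a) := by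
      rw [mul_add, mul_one_div_cancel ha0.ne', mul_one, ha, Nat.cast_add_one (N + 1)]
    have hlog : Real.log (1 + 1 / a) ≤ 1 / a := by
      linarith [Real.log_le_sub_one_of_pos (show 0 < 1 + 1 / a by positivity)]
    have hpow : 1 - t * (1 / a) ≤ (1 + 1 / a) ^ (-t) := by
      rw [Real.rpow_def_of_pos (by positivity)]
      nlinarith [Real.add_one_le_exp (Real.log (1 + 1 / a) * -t)]
    rw [hsplit, Real.mul_rpow ha0.le (by positivity)]
    have hmul := mul_le_mul_of_nonneg_left hpow (Real.rpow_nonneg ha0.le (-t))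
    have : a ^ (-t) * (1 - t * (1 / a)) = a ^ (-t) - t * (a ^ (-t) / a) := by ring
    linarith

theorem log_le_mul_sum_rpow {t x : ℝ} (ht : 0 < t) (hx : 1 < x) :
    Real.log x ≤ (1 + t * Real.log x) * ∑ n ∈ Ioc 0 ⌊x⌋₊, (n : ℝ) ^ (-t) / n := by
  have hL : 0 < Real.log x := Real.log_pos hx
  have h1 := one_sub_rpow_neg_le_mul_sum ht ⌊x⌋₊
  set B := ∑ n ∈ Ioc 0 ⌊x⌋₊, (n : ℝ) ^ (-t) / n
  have h2 : ((⌊x⌋₊ + 1 : ℕ) : ℝ) ^ (-t) ≤ x ^ (-t) := by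
    refine Real.rpow_le_rpow_of_nonpos (by linarith) ?_ (by linarith)
    push_cast
    exact (Nat.lt_floor_add_one x).le
  have h3 : x ^ (-t) * (1 + t * Real.log x) ≤ 1 := by
    calc x ^ (-t) * (1 + t * Real.log x) ≤ x ^ (-t) * x ^ t := by
          refine mul_le_mul_of_nonneg_left ?_ (by positivity)
          rw [Real.rpow_def_of_pos (by linarith)]
          linarith [Real.add_one_le_exp (Real.log x * t)]
      _ = 1 := by rw [← Real.rpow_add (by linarith)]; simp
  have h4 : 0 < 1 + t * Real.log x := by positivity
  have h5 := mul_le_mul_of_nonneg_right (h1.trans' (sub_le_sub_left h2 1)) h4.le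
  refine le_of_mul_le_mul_left ?_ ht
  linarith

theorem sum_ft_div_le {t x : ℝ} (ht : 0 < t) (hx : 1 < x) :
    ∑ n ∈ Ioc 0 ⌊x⌋₊, ft t n / n ≤ 3 * (1 + t * Real.log x) := by
  have hL : 0 < Real.log x := Real.log_pos hx
  have hN : 0 < ⌊x⌋₊ := Nat.floor_pos.2 hx.le
  have hAB := sum_ft_div_mul_sum_rpow_le ht hN.ne'
  have hB := log_le_mul_sum_rpow ht hx
  have hB1 : 1 ≤ ∑ n ∈ Ioc 0 ⌊x⌋₊, (n : ℝ) ^ (-t) / n := by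
    have := Finset.single_le_sum (f := fun n : ℕ ↦ (n : ℝ) ^ (-t) / n)
      (fun n _ ↦ by positivity) (Finset.mem_Ioc.2 ⟨one_pos, hN⟩)
    simpa using this
  have hA : 0 ≤ ∑ n ∈ Ioc 0 ⌊x⌋₊, ft t n / n :=
    Finset.sum_nonneg fun n _ ↦ div_nonneg (ft_nonneg ht n) n.cast_nonneg
  have hlog : Real.log ⌊x⌋₊ ≤ Real.log x :=
    Real.log_le_log (by exact_mod_cast hN) (Nat.floor_le (by linarith))
  set A := ∑ n ∈ Ioc 0 ⌊x⌋₊, ft t n / n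
  set B := ∑ n ∈ Ioc 0 ⌊x⌋₊, (n : ℝ) ^ (-t) / n
  set L := Real.log x
  have hy : 0 < t * L := by positivity
  rcases le_total L 1 with h | h
  · nlinarith [mul_le_mul_of_nonneg_left hB1 hA]
  · refine le_of_mul_le_mul_right ?_ hL
    calc A * L ≤ A * ((1 + t * L) * B) := mul_le_mul_of_nonneg_left hB hA
      _ = (A * B) * (1 + t * L) := by ring
      _ ≤ (3 * L) * (1 + t * L) := mul_le_mul_of_nonneg_right (by linarith) (by linarith)
      _ = 3 * (1 + t * L) * L := by ring

theorem Ft_sub_eq_sum (t : ℝ) {x : ℝ} (hx : 0 ≤ x) :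
    Ft t x - Ft t (x / 2) = ∑ n ∈ Ioc ⌊x / 2⌋₊ ⌊x⌋₊, ft t n := by
  have hle : ⌊x / 2⌋₊ ≤ ⌊x⌋₊ := Nat.floor_mono (by linarith)
  have hI : ∀ N : ℕ, Icc 1 N = Ioc 0 N := fun N ↦ by ext; simp [Nat.succ_le_iff]
  rw [Ft, Ft, hI, hI, ← Finset.sum_Ioc_consecutive _ (Nat.zero_le _) hle]
  ring

end ArithmeticFunction

open ArithmeticFunction

/-- There is an absolute `C > 0` such that for all `x > 1` and `t > 0`,
`F_t(x) − F_t(x/2) ≤ C x (1/log x + t)`. -/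
theorem stmt_9 :
    ∃ C : ℝ, 0 < C ∧ ∀ x : ℝ, 1 < x → ∀ t : ℝ, 0 < t →
      Ft t x - Ft t (x / 2) ≤ C * x * (1 / Real.log x + t) := by
  have hK : 0 < Real.log 4 + 4 := by
    have := Real.log_pos (show (1 : ℝ) < 4 by norm_num)
    positivity
  refine ⟨3 * (Real.log 4 + 4) + 1, by positivity, fun x hx t ht ↦ ?_⟩
  have hx0 : 0 < x := by linarith
  have hL : 0 < Real.log x := Real.log_pos hx
  have hNx : (⌊x⌋₊ : ℝ) ≤ x := Nat.floor_le hx0.le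
  have hpoint : ∀ n ∈ Ioc ⌊x / 2⌋₊ ⌊x⌋₊, ft t n * Real.log x ≤ ft t n * Real.log n + 1 := by
    intro n hn
    have hn' := Finset.mem_Ioc.1 hn
    have hxn : x / 2 < n := (Nat.floor_lt (by positivity)).1 hn'.1
    have hn0 : (0 : ℝ) < n := by linarith
    have h1 : Real.log x ≤ Real.log n + Real.log 2 := by
      rw [← Real.log_mul hn0.ne' (by norm_num)]
      exact Real.log_le_log hx0 (by linarith)
    have h2 : Real.log 2 ≤ 1 := by linarith [Real.log_two_lt_d9]
    have h3 := ft_nonneg ht n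
    have h4 := ft_le_one ht (show n ≠ 0 by lia)
    nlinarith
  have hmain : (Ft t x - Ft t (x / 2)) * Real.log x ≤
      (3 * (Real.log 4 + 4) + 1) * x * (1 + t * Real.log x) := by
    calc (Ft t x - Ft t (x / 2)) * Real.log x
        = ∑ n ∈ Ioc ⌊x / 2⌋₊ ⌊x⌋₊, ft t n * Real.log x := by
          rw [Ft_sub_eq_sum t hx0.le, Finset.sum_mul]
      _ ≤ ∑ n ∈ Ioc ⌊x / 2⌋₊ ⌊x⌋₊, (ft t n * Real.log n + 1) := Finset.sum_le_sum hpoint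
      _ ≤ ∑ n ∈ Ioc 0 ⌊x⌋₊, (ft t n * Real.log n + 1) := by
          refine Finset.sum_le_sum_of_subset_of_nonneg
            (Finset.Ioc_subset_Ioc_left (Nat.zero_le _)) fun n _ _ ↦ ?_
          have := ft_nonneg ht n
          have := Real.log_natCast_nonneg n
          positivity
      _ = ∑ n ∈ Ioc 0 ⌊x⌋₊, ft t n * Real.log n + ⌊x⌋₊ := by
          rw [Finset.sum_add_distrib]
          simp
      _ ≤ (Real.log 4 + 4) * ⌊x⌋₊ * (3 * (1 + t * Real.log x)) + ⌊x⌋₊ := by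
          refine add_le_add_left ((sum_ft_mul_log_le ht _).trans ?_) _
          exact mul_le_mul_of_nonneg_left (sum_ft_div_le ht hx) (by positivity)
      _ ≤ (Real.log 4 + 4) * x * (3 * (1 + t * Real.log x)) + x * (1 + t * Real.log x) := by
          have : 0 < t * Real.log x := by positivity
          gcongr
          nlinarith
      _ = _ := by ring
  refine le_of_mul_le_mul_right (hmain.trans_eq ?_) hL
  field_simp
end

section
/- There is an absolute constant C > 0 such that for every integer k ≥ 2 and every real x ≥ 1, | ∫_0^∞ F_t(x) ( k^{−t} − (k+1)^{−t} ) dt − x ∫_0^∞ ( k^{−t} − (k+1)^{−t} ) dt/ζ(1+t) | ≤ C x / ( k log²(xk) ). -/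
open Filter Finset

open ArithmeticFunction in
lemma sum_Icc_divisors_eq_sum_mul_div {R : Type*} [Semiring R] (g : ℕ → R) (hg : g 0 = 0) (N : ℕ) :
    ∑ m ∈ Icc 1 N, ∑ d ∈ m.divisors, g d = ∑ d ∈ Icc 1 N, g d * ((N / d : ℕ) : R) := by
  have h := sum_Ioc_mul_zeta_eq_sum (⟨g, hg⟩ : ArithmeticFunction R) N
  rw [← Finset.Icc_succ_left_eq_Ioc] at h
  exact (sum_congr rfl fun m _ ↦ coe_mul_zeta_apply.symm).trans h

lemma sum_moebius_mul_div {N : ℕ} (hN : 1 ≤ N) :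
    ∑ d ∈ Icc 1 N, (ArithmeticFunction.moebius d : ℝ) * ((N / d : ℕ) : ℝ) = 1 := by
  rw [← sum_Icc_divisors_eq_sum_mul_div (fun d ↦ (ArithmeticFunction.moebius d : ℝ)) (by simp)]
  have h (m : ℕ) : ∑ d ∈ m.divisors, (ArithmeticFunction.moebius d : ℝ) =
      if m = 1 then 1 else 0 := by
    have := congrArg (fun f : ArithmeticFunction ℤ ↦ f m)
      ArithmeticFunction.moebius_mul_coe_zeta
    simp only [ArithmeticFunction.coe_mul_zeta_apply, ArithmeticFunction.one_apply] at this
    exact_mod_cast this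
  simp [h, hN]

lemma abs_moebius_cast_le_one (d : ℕ) : |(ArithmeticFunction.moebius d : ℝ)| ≤ 1 := by
  exact_mod_cast ArithmeticFunction.abs_moebius_le_one (n := d)

/-- The partial sums of `Σ μ(d)/d` are bounded. -/
lemma abs_sum_moebius_div_le (N : ℕ) :
    |∑ d ∈ Icc 1 N, (ArithmeticFunction.moebius d : ℝ) / d| ≤ 2 := by
  rcases Nat.eq_zero_or_pos N with rfl | hN
  · simp
  have hN' : (1 : ℝ) ≤ N := by exact_mod_cast hN
  have h1 : (N : ℝ) * ∑ d ∈ Icc 1 N, (ArithmeticFunction.moebius d : ℝ) / d - 1 =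
      ∑ d ∈ Icc 1 N, (ArithmeticFunction.moebius d : ℝ) * ((N : ℝ) / d - ((N / d : ℕ) : ℝ)) := by
    rw [← sum_moebius_mul_div hN, mul_sum, ← sum_sub_distrib]
    exact sum_congr rfl fun d _ ↦ by ring
  have h2 : |(N : ℝ) * ∑ d ∈ Icc 1 N, (ArithmeticFunction.moebius d : ℝ) / d - 1| ≤ N := by
    rw [h1]
    refine (abs_sum_le_sum_abs _ _).trans ?_
    calc _ ≤ ∑ d ∈ Icc 1 N, (1 : ℝ) := sum_le_sum fun d hd ↦ ?_
      _ = N := by simp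
    rw [abs_mul]
    refine mul_le_one₀ (abs_moebius_cast_le_one d) (abs_nonneg _) ?_
    rw [← Nat.floor_div_eq_div (K := ℝ)]
    have h1 := Nat.floor_le (show 0 ≤ (N : ℝ) / d by positivity)
    have h2 := Nat.lt_floor_add_one ((N : ℝ) / d)
    exact abs_le.2 ⟨by linarith, by linarith⟩
  have h3 := abs_le.1 h2
  refine abs_le.2 ⟨?_, ?_⟩ <;> nlinarith

/-- A tail estimate by partial summation. -/
lemma abs_sum_Ioc_mul_le {a b : ℕ → ℝ} {B : ℝ} {N : ℕ} (hb : ∀ n, 0 ≤ b n)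
    (hanti : ∀ n, N ≤ n → b (n + 1) ≤ b n)
    (hB : ∀ M, |∑ d ∈ Ioc N M, a d| ≤ B) {M : ℕ} (hNM : N ≤ M) :
    |∑ d ∈ Ioc N M, a d * b d| ≤ B * b N := by
  have key : |∑ d ∈ Ioc N M, a d * b d - (∑ d ∈ Ioc N M, a d) * b M| ≤ B * (b N - b M) := by
    induction M, hNM using Nat.le_induction with
    | base => simp
    | succ M hM ih =>
      rw [sum_Ioc_succ_top hM, sum_Ioc_succ_top hM]
      have h2 : |(∑ d ∈ Ioc N M, a d) * (b M - b (M + 1))| ≤ B * (b M - b (M + 1)) := by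
        rw [abs_mul, abs_of_nonneg (sub_nonneg.2 (hanti M hM))]
        exact mul_le_mul_of_nonneg_right (hB M) (sub_nonneg.2 (hanti M hM))
      have h3 := abs_add_le (∑ d ∈ Ioc N M, a d * b d - (∑ d ∈ Ioc N M, a d) * b M)
        ((∑ d ∈ Ioc N M, a d) * (b M - b (M + 1)))
      calc _ = |∑ d ∈ Ioc N M, a d * b d - (∑ d ∈ Ioc N M, a d) * b M +
          (∑ d ∈ Ioc N M, a d) * (b M - b (M + 1))| := by congr 1; ring
        _ ≤ _ := by linarith
  have h2 : |(∑ d ∈ Ioc N M, a d) * b M| ≤ B * b M := by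
    rw [abs_mul, abs_of_nonneg (hb M)]
    exact mul_le_mul_of_nonneg_right (hB M) (hb M)
  have h3 := abs_add_le (∑ d ∈ Ioc N M, a d * b d - (∑ d ∈ Ioc N M, a d) * b M)
    ((∑ d ∈ Ioc N M, a d) * b M)
  rw [sub_add_cancel] at h3
  linarith

lemma sum_Icc_add_sum_Ioc {M : Type*} [AddCommMonoid M] (g : ℕ → M) {m n : ℕ} (h : m ≤ n) :
    ∑ d ∈ Icc 1 m, g d + ∑ d ∈ Ioc m n, g d = ∑ d ∈ Icc 1 n, g d := by
  simpa only [← Finset.Icc_succ_left_eq_Ioc, Nat.succ_eq_succ, Nat.succ_eq_add_one, zero_add] using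
    sum_Ioc_consecutive g (Nat.zero_le m) h

lemma abs_sum_Ioc_moebius_div_le (N M : ℕ) :
    |∑ d ∈ Ioc N M, (ArithmeticFunction.moebius d : ℝ) / d| ≤ 4 := by
  rcases le_total N M with h | h
  · have h1 := sum_Icc_add_sum_Ioc (fun d ↦ (ArithmeticFunction.moebius d : ℝ) / d) h
    have h2 := abs_le.1 (abs_sum_moebius_div_le N)
    have h3 := abs_le.1 (abs_sum_moebius_div_le M)
    exact abs_le.2 ⟨by linarith, by linarith⟩
  · simp [Ioc_eq_empty_of_le h]

lemma exists_hasSum_moebius {t : ℝ} (ht : 0 < t) :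
    ∃ Z : ℝ, (Z : ℂ) = (riemannZeta ((1 + t : ℝ) : ℂ))⁻¹ ∧
      HasSum (fun d : ℕ ↦ (ArithmeticFunction.moebius d : ℝ) / d * (d : ℝ) ^ (-t)) Z := by
  have hs : 1 < (((1 + t : ℝ) : ℂ)).re := by simpa using ht
  have h1 := ArithmeticFunction.LSeries_zeta_mul_Lseries_moebius hs
  rw [ArithmeticFunction.LSeries_zeta_eq_riemannZeta hs] at h1
  have h2 := (ArithmeticFunction.LSeriesSummable_moebius_iff.2 hs).LSeriesHasSum
  rw [eq_inv_of_mul_eq_one_right h1] at h2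
  have h3 : HasSum (fun d : ℕ ↦
      (((ArithmeticFunction.moebius d : ℝ) / d * (d : ℝ) ^ (-t) : ℝ) : ℂ))
      (riemannZeta ((1 + t : ℝ) : ℂ))⁻¹ := by
    unfold LSeriesHasSum at h2
    convert h2 using 2 with d
    rcases Nat.eq_zero_or_pos d with rfl | hd
    · simp
    have hd' : (0 : ℝ) < d := by exact_mod_cast hd
    rw [LSeries.term_of_ne_zero hd.ne', div_mul_eq_mul_div, mul_div_assoc,
      ← Complex.ofReal_natCast d, ← Complex.ofReal_cpow hd'.le, Real.rpow_neg hd'.le,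
      Real.rpow_add hd', Real.rpow_one]
    push_cast
    ring
  have h4 := Complex.hasSum_re h3
  simp only [Complex.ofReal_re] at h4
  refine ⟨_, ?_, h4⟩
  exact (Complex.hasSum_ofReal.2 h4).unique h3

/-- Pointwise comparison of `F_t(x)` and `x/ζ(1+t)`. -/
lemma norm_Ft_sub_le {t x : ℝ} (ht : 0 < t) (hx : 1 ≤ x) :
    ‖(Ft t x : ℂ) - x * (riemannZeta ((1 + t : ℝ) : ℂ))⁻¹‖ ≤
      ∑ d ∈ Icc 1 ⌊x⌋₊, (d : ℝ) ^ (-t) + 4 * x * (⌊x⌋₊ : ℝ) ^ (-t) := by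
  obtain ⟨Z, hZ, hsum⟩ := exists_hasSum_moebius ht
  rw [← hZ, ← Complex.ofReal_mul, ← Complex.ofReal_sub, Complex.norm_real, Real.norm_eq_abs]
  set N := ⌊x⌋₊ with hN
  have hN1 : 1 ≤ N := Nat.one_le_floor_iff x |>.2 hx
  have hF : Ft t x = ∑ d ∈ Icc 1 N,
      (ArithmeticFunction.moebius d : ℝ) / (d : ℝ) ^ t * ((N / d : ℕ) : ℝ) := by
    unfold Ft ft
    exact sum_Icc_divisors_eq_sum_mul_div
      (fun d ↦ (ArithmeticFunction.moebius d : ℝ) / (d : ℝ) ^ t) (by simp) N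
  set a : ℕ → ℝ := fun d ↦ (ArithmeticFunction.moebius d : ℝ) / d * (d : ℝ) ^ (-t) with ha
  have htail : |Z - ∑ d ∈ Icc 1 N, a d| ≤ 4 * (N : ℝ) ^ (-t) := by
    have hlim : Tendsto (fun M : ℕ ↦ |∑ d ∈ Icc 1 M, a d - ∑ d ∈ Icc 1 N, a d|) atTop
        (nhds |Z - ∑ d ∈ Icc 1 N, a d|) := by
      refine ((Tendsto.sub_const ?_ _).abs)
      have := (tendsto_add_atTop_iff_nat 1).2 hsum.tendsto_sum_nat
      refine this.congr fun M ↦ ?_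
      rw [sum_range_eq_add_Ico _ (by omega)]
      simp [ha, Ico_add_one_right_eq_Icc]
    refine le_of_tendsto hlim ?_
    filter_upwards [eventually_ge_atTop N] with M hM
    rw [← sum_Icc_add_sum_Ioc a hM, add_sub_cancel_left]
    refine abs_sum_Ioc_mul_le (b := fun d : ℕ ↦ (d : ℝ) ^ (-t)) (fun n ↦ by positivity) ?_
      (abs_sum_Ioc_moebius_div_le N) hM
    intro n hn
    have : 0 < n := by omega
    exact Real.rpow_le_rpow_of_nonpos (by positivity) (by push_cast; linarith) (by linarith)
  have hmain : |Ft t x - x * ∑ d ∈ Icc 1 N, a d| ≤ ∑ d ∈ Icc 1 N, (d : ℝ) ^ (-t) := by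
    rw [hF, mul_sum, ← sum_sub_distrib]
    refine (abs_sum_le_sum_abs _ _).trans (sum_le_sum fun d hd ↦ ?_)
    have hd1 : (0 : ℝ) < d := by exact_mod_cast (mem_Icc.1 hd).1
    have e : (ArithmeticFunction.moebius d : ℝ) / (d : ℝ) ^ t * ((N / d : ℕ) : ℝ) - x * a d =
        (ArithmeticFunction.moebius d : ℝ) * (((N / d : ℕ) : ℝ) - x / d) * (d : ℝ) ^ (-t) := by
      simp only [ha, Real.rpow_neg hd1.le]; ring
    rw [e, abs_mul, abs_mul, abs_of_pos (Real.rpow_pos_of_pos hd1 _)]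
    refine mul_le_of_le_one_left (by positivity) ?_
    refine mul_le_one₀ (abs_moebius_cast_le_one d) (abs_nonneg _) ?_
    rw [hN, ← Nat.floor_div_natCast]
    have h1 := Nat.floor_le (show 0 ≤ x / d by positivity)
    have h2 := Nat.lt_floor_add_one (x / d)
    exact abs_le.2 ⟨by linarith, by linarith⟩
  calc |Ft t x - x * Z| = |(Ft t x - x * ∑ d ∈ Icc 1 N, a d) - x * (Z - ∑ d ∈ Icc 1 N, a d)| := by
        congr 1; ring
    _ ≤ |Ft t x - x * ∑ d ∈ Icc 1 N, a d| + |x * (Z - ∑ d ∈ Icc 1 N, a d)| := abs_sub _ _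
    _ ≤ _ := by
        rw [abs_mul, abs_of_nonneg (by linarith : 0 ≤ x)]
        nlinarith

open MeasureTheory

/-- The kernel `k^{-t} - (k+1)^{-t}`. -/
noncomputable def powGap (k : ℕ) (t : ℝ) : ℝ := (k : ℝ) ^ (-t) - ((k : ℝ) + 1) ^ (-t)

lemma powGap_nonneg {k : ℕ} (hk : 2 ≤ k) {t : ℝ} (ht : 0 < t) : 0 ≤ powGap k t := by
  have : (0 : ℝ) < k := by positivity
  exact sub_nonneg.2 (Real.rpow_le_rpow_of_nonpos this (by linarith) (by linarith))

lemma integral_rpow_neg {y : ℝ} (hy : 1 < y) :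
    IntegrableOn (fun t : ℝ ↦ y ^ (-t)) (Set.Ioi 0) ∧
      ∫ t in Set.Ioi (0 : ℝ), y ^ (-t) = 1 / Real.log y := by
  have hl := Real.log_pos hy
  have e : (fun t : ℝ ↦ y ^ (-t)) = fun t ↦ Real.exp (-Real.log y * t) := by
    ext t; rw [Real.rpow_def_of_pos (by linarith)]; congr 1; ring
  rw [e]
  refine ⟨integrableOn_exp_mul_Ioi (by linarith) 0, ?_⟩
  rw [integral_exp_mul_Ioi (by linarith) 0]
  simp

lemma rpow_mul_powGap {d k : ℕ} (t : ℝ) :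
    (d : ℝ) ^ (-t) * powGap k t = ((d : ℝ) * k) ^ (-t) - ((d : ℝ) * (k + 1)) ^ (-t) := by
  rw [Real.mul_rpow (by positivity) (by positivity), Real.mul_rpow (by positivity) (by positivity),
    powGap]
  ring

lemma integrableOn_rpow_mul_powGap {d k : ℕ} (hd : 1 ≤ d) (hk : 2 ≤ k) :
    IntegrableOn (fun t ↦ (d : ℝ) ^ (-t) * powGap k t) (Set.Ioi 0) := by
  have hd' : (1 : ℝ) ≤ d := by exact_mod_cast hd
  have hk' : (2 : ℝ) ≤ k := by exact_mod_cast hk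
  simp only [rpow_mul_powGap]
  exact (integral_rpow_neg (by nlinarith)).1.sub (integral_rpow_neg (by nlinarith)).1

lemma integral_rpow_mul_powGap_le {d k : ℕ} (hd : 1 ≤ d) (hk : 2 ≤ k) :
    ∫ t in Set.Ioi (0 : ℝ), (d : ℝ) ^ (-t) * powGap k t ≤
      1 / (k * Real.log (d * k) ^ 2) := by
  have hd' : (1 : ℝ) ≤ d := by exact_mod_cast hd
  have hk' : (2 : ℝ) ≤ k := by exact_mod_cast hk
  have h1 : (1 : ℝ) < d * k := by nlinarith
  have h2 : (1 : ℝ) < d * (k + 1) := by nlinarith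
  simp only [rpow_mul_powGap]
  rw [integral_sub (integral_rpow_neg h1).1 (integral_rpow_neg h2).1, (integral_rpow_neg h1).2,
    (integral_rpow_neg h2).2]
  have hl1 := Real.log_pos h1
  have hle : Real.log (d * (k + 1)) - Real.log (d * k) ≤ 1 / k := by
    rw [← Real.log_div (by positivity) (by positivity)]
    refine (Real.log_le_sub_one_of_pos (by positivity)).trans (le_of_eq ?_)
    field_simp
    ring
  have hmono : Real.log (d * k) ≤ Real.log (d * (k + 1)) :=
    Real.log_le_log (by positivity) (by nlinarith)
  have hl2 := hl1.trans_le hmono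
  rw [div_sub_div _ _ hl1.ne' hl2.ne', one_mul, mul_one, ← div_div (1 : ℝ)]
  refine div_le_div₀ (by positivity) hle (by positivity) ?_
  nlinarith

/-- Comparison of `log (d k)` with `log (x k)`. -/
lemma inv_log_sq_le {d k x : ℝ} (hd : 1 ≤ d) (hk : 2 ≤ k) (hdx : d ≤ x) :
    1 / (k * Real.log (d * k) ^ 2) ≤ 49 * √(x / d) / (k * Real.log (x * k) ^ 2) := by
  have hx : 1 ≤ x := hd.trans hdx
  have hL : 0 < Real.log (d * k) := Real.log_pos (by nlinarith)
  have hL' : 0 < Real.log (x * k) := Real.log_pos (by nlinarith)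
  set u := (x / d) ^ (1 / 4 : ℝ) with hu
  have hr : 1 ≤ x / d := (one_le_div (by linarith)).2 hdx
  have hu1 : 1 ≤ u := Real.one_le_rpow hr (by norm_num)
  have hsq : √(x / d) = u ^ 2 := by
    rw [Real.sqrt_eq_rpow, hu, ← Real.rpow_natCast, ← Real.rpow_mul (by positivity)]
    norm_num
  have hlog : Real.log (x / d) ≤ 4 * u := by
    have := Real.log_le_rpow_div (show 0 ≤ x / d by positivity) (show (0 : ℝ) < 1 / 4 by norm_num)
    linarith
  have hdk : (2 / 3 : ℝ) ≤ Real.log (d * k) := by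
    have h2 : Real.log 2 ≤ Real.log (d * k) := Real.log_le_log (by norm_num) (by nlinarith)
    linarith [Real.log_two_gt_d9]
  have hadd : Real.log (x * k) = Real.log (d * k) + Real.log (x / d) := by
    rw [← Real.log_mul (by positivity) (by positivity)]
    congr 1; field_simp
  have hmain : Real.log (x * k) ≤ 7 * u * Real.log (d * k) := by
    rw [hadd]; nlinarith
  rw [hsq, div_le_div_iff₀ (by positivity) (by positivity)]
  have := mul_le_mul hmain hmain hL'.le (by positivity)
  nlinarith

lemma sum_sqrt_div_le (x : ℝ) (hx : 1 ≤ x) :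
    ∑ d ∈ Icc 1 ⌊x⌋₊, √(x / d) ≤ 2 * x := by
  have h (N : ℕ) : ∑ d ∈ Icc 1 N, 1 / √(d : ℝ) ≤ 2 * √(N : ℝ) := by
    induction N with
    | zero => simp
    | succ N ih =>
      rw [sum_Icc_succ_top (by omega)]
      have h1 : 0 < √((N + 1 : ℕ) : ℝ) := by positivity
      have h2 := Real.sq_sqrt (show (0 : ℝ) ≤ ((N + 1 : ℕ) : ℝ) by positivity)
      have h3 := Real.sq_sqrt (show (0 : ℝ) ≤ (N : ℝ) by positivity)
      have h4 : 1 / √((N + 1 : ℕ) : ℝ) ≤ 2 * √((N + 1 : ℕ) : ℝ) - 2 * √(N : ℝ) := by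
        rw [div_le_iff₀ h1]
        push_cast at *
        nlinarith [sq_nonneg (√((N : ℝ) + 1) - √(N : ℝ))]
      linarith
  calc ∑ d ∈ Icc 1 ⌊x⌋₊, √(x / d) = √x * ∑ d ∈ Icc 1 ⌊x⌋₊, 1 / √(d : ℝ) := by
        rw [mul_sum]
        exact sum_congr rfl fun d _ ↦ by rw [Real.sqrt_div (by linarith)]; ring
    _ ≤ √x * (2 * √x) := by
        refine mul_le_mul_of_nonneg_left ((h _).trans ?_) (Real.sqrt_nonneg x)
        have := Real.sqrt_le_sqrt (Nat.floor_le (by linarith : 0 ≤ x))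
        linarith
    _ = 2 * x := by nlinarith [Real.mul_self_sqrt (by linarith : 0 ≤ x)]

lemma continuous_Ft (x : ℝ) : Continuous fun t ↦ Ft t x := by
  unfold Ft ft
  refine continuous_finsetSum _ fun m _ ↦ continuous_finsetSum _ fun d hd ↦ ?_
  have hd0 : (0 : ℝ) < d := by exact_mod_cast Nat.pos_of_mem_divisors hd
  exact continuous_const.div (Real.continuous_const_rpow hd0.ne')
    fun t ↦ (Real.rpow_pos_of_pos hd0 t).ne'

lemma abs_Ft_le {t : ℝ} (ht : 0 < t) (x : ℝ) :
    |Ft t x| ≤ ∑ m ∈ Icc 1 ⌊x⌋₊, ((m.divisors.card : ℕ) : ℝ) := by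
  unfold Ft ft
  refine (abs_sum_le_sum_abs _ _).trans (sum_le_sum fun m _ ↦ ?_)
  refine (abs_sum_le_sum_abs _ _).trans ?_
  rw [card_eq_sum_ones, Nat.cast_sum]
  refine sum_le_sum fun d hd ↦ ?_
  have hd0 : (1 : ℝ) ≤ d := by exact_mod_cast Nat.pos_of_mem_divisors hd
  have h1 := Real.one_le_rpow hd0 ht.le
  rw [abs_div, abs_of_pos (by linarith : 0 < (d : ℝ) ^ t), Nat.cast_one]
  exact div_le_one_of_le₀ ((abs_moebius_cast_le_one d).trans h1) (by linarith)

lemma continuous_powGap {k : ℕ} (hk : 2 ≤ k) : Continuous (powGap k) := by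
  have hk' : (0 : ℝ) < k := by positivity
  unfold powGap
  exact ((Real.continuous_const_rpow hk'.ne').comp continuous_neg).sub
    ((Real.continuous_const_rpow (by positivity)).comp continuous_neg)

lemma integrableOn_powGap {k : ℕ} (hk : 2 ≤ k) : IntegrableOn (powGap k) (Set.Ioi 0) := by
  simpa using integrableOn_rpow_mul_powGap (d := 1) le_rfl hk

lemma integrableOn_Ft_mul_powGap {k : ℕ} (hk : 2 ≤ k) (x : ℝ) :
    IntegrableOn (fun t ↦ Ft t x * powGap k t) (Set.Ioi 0) := by
  refine Integrable.bdd_mul (integrableOn_powGap hk) (continuous_Ft x).aestronglyMeasurable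
    (c := ∑ m ∈ Icc 1 ⌊x⌋₊, ((m.divisors.card : ℕ) : ℝ)) ?_
  filter_upwards [ae_restrict_mem measurableSet_Ioi] with t ht
  exact abs_Ft_le ht x

lemma norm_inv_riemannZeta_le {t : ℝ} (ht : 0 < t) :
    ‖(riemannZeta ((1 + t : ℝ) : ℂ))⁻¹‖ ≤ 6 := by
  have h := norm_Ft_sub_le ht le_rfl
  have h1 : Ft t 1 = 1 := by simp [Ft, ft]
  simp only [h1, Nat.floor_one, Icc_self, sum_singleton, Nat.cast_one, Real.one_rpow,
    Complex.ofReal_one, one_mul] at h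
  have h2 := norm_sub_norm_le (riemannZeta ((1 + t : ℝ) : ℂ))⁻¹ 1
  rw [norm_sub_rev, norm_one] at h2
  linarith

lemma integrableOn_powGap_div_riemannZeta {k : ℕ} (hk : 2 ≤ k) :
    IntegrableOn (fun t ↦ ((powGap k t : ℝ) : ℂ) / riemannZeta ((1 + t : ℝ) : ℂ))
      (Set.Ioi 0) := by
  simp only [div_eq_mul_inv]
  refine Integrable.mul_bdd (integrableOn_powGap hk).ofReal (c := 6) ?_ ?_
  · refine ContinuousOn.aestronglyMeasurable (fun t ht ↦ ?_) measurableSet_Ioi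
    have ht' : (0 : ℝ) < t := ht
    have hne : ((1 + t : ℝ) : ℂ) ≠ 1 := by
      intro h
      have : 1 + t = 1 := by exact_mod_cast h
      linarith
    refine ContinuousAt.continuousWithinAt (ContinuousAt.inv₀ ?_ ?_)
    · exact ContinuousAt.comp (f := fun t : ℝ ↦ ((1 + t : ℝ) : ℂ))
        (differentiableAt_riemannZeta hne).continuousAt (by fun_prop)
    · exact riemannZeta_ne_zero_of_one_lt_re (by simpa using ht')
  · filter_upwards [ae_restrict_mem measurableSet_Ioi] with t ht
    exact norm_inv_riemannZeta_le ht

/-- There is an absolute `C > 0` such that for every integer `k ≥ 2` and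
every real `x ≥ 1`,
`|∫_0^∞ F_t(x)(k^{−t} − (k+1)^{−t}) dt − x ∫_0^∞ (k^{−t} − (k+1)^{−t}) dt/ζ(1+t)|
  ≤ C x/(k log²(xk))`. -/
theorem stmt_10 :
    ∃ C : ℝ, 0 < C ∧ ∀ k : ℕ, 2 ≤ k → ∀ x : ℝ, 1 ≤ x →
      ‖Complex.ofReal (∫ t in Set.Ioi (0 : ℝ), Ft t x * ((k : ℝ) ^ (-t) - ((k : ℝ) + 1) ^ (-t)))
          - (x : ℂ) * ∫ t in Set.Ioi (0 : ℝ),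
              Complex.ofReal ((k : ℝ) ^ (-t) - ((k : ℝ) + 1) ^ (-t))
                / riemannZeta ((1 + t : ℝ) : ℂ)‖ ≤
        C * x / (k * Real.log (x * k) ^ 2) := by
  refine ⟨500, by norm_num, fun k hk x hx ↦ ?_⟩
  have hk' : (2 : ℝ) ≤ k := by exact_mod_cast hk
  change ‖Complex.ofReal (∫ t in Set.Ioi (0 : ℝ), Ft t x * powGap k t) - (x : ℂ) *
    ∫ t in Set.Ioi (0 : ℝ), ((powGap k t : ℝ) : ℂ) / riemannZeta ((1 + t : ℝ) : ℂ)‖ ≤ _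
  set N := ⌊x⌋₊ with hN
  have hN1 : 1 ≤ N := Nat.one_le_floor_iff x |>.2 hx
  have hN1' : (1 : ℝ) ≤ N := by exact_mod_cast hN1
  have hNx : (N : ℝ) ≤ x := Nat.floor_le (by linarith)
  have hxN : x < N + 1 := Nat.lt_floor_add_one x
  have hFt : IntegrableOn (fun t ↦ ((Ft t x * powGap k t : ℝ) : ℂ)) (Set.Ioi 0) :=
    (integrableOn_Ft_mul_powGap hk x).ofReal
  rw [← integral_complex_ofReal, ← integral_const_mul, ← integral_sub hFt
    ((integrableOn_powGap_div_riemannZeta hk).const_mul _)]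
  have hint (d : ℕ) (hd : d ∈ Icc 1 N) := integrableOn_rpow_mul_powGap (mem_Icc.1 hd).1 hk
  have hintN := (integrableOn_rpow_mul_powGap hN1 hk).const_mul (4 * x)
  set D := k * Real.log (x * k) ^ 2 with hD
  have hD0 : 0 < D := by
    have := Real.log_pos (show 1 < x * k by nlinarith)
    positivity
  have hw (d : ℕ) (hd : d ∈ Icc 1 N) :
      ∫ t in Set.Ioi (0 : ℝ), (d : ℝ) ^ (-t) * powGap k t ≤ 49 * √(x / d) / D := by
    have hd1 := (mem_Icc.1 hd).1
    have hdN : (d : ℝ) ≤ N := by exact_mod_cast (mem_Icc.1 hd).2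
    exact (integral_rpow_mul_powGap_le hd1 hk).trans
      (inv_log_sq_le (by exact_mod_cast hd1) hk' (hdN.trans hNx))
  calc _ ≤ ∫ t in Set.Ioi (0 : ℝ), (∑ d ∈ Icc 1 N, (d : ℝ) ^ (-t) * powGap k t +
        4 * x * ((N : ℝ) ^ (-t) * powGap k t)) := by
        refine norm_integral_le_of_norm_le ((integrable_finsetSum _ hint).add hintN) ?_
        filter_upwards [ae_restrict_mem measurableSet_Ioi] with t ht
        have h := mul_le_mul_of_nonneg_right (norm_Ft_sub_le ht hx) (powGap_nonneg hk ht)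
        rw [add_mul, sum_mul] at h
        refine le_trans (le_of_eq ?_) (h.trans (le_of_eq (by ring)))
        have hp : ‖((powGap k t : ℝ) : ℂ)‖ = powGap k t := by
          rw [Complex.norm_real, Real.norm_of_nonneg (powGap_nonneg hk ht)]
        nth_rw 3 [← hp]
        rw [← norm_mul]
        congr 1
        simp only [Complex.ofReal_mul]
        ring
    _ = ∑ d ∈ Icc 1 N, (∫ t in Set.Ioi (0 : ℝ), (d : ℝ) ^ (-t) * powGap k t) +
        4 * x * ∫ t in Set.Ioi (0 : ℝ), (N : ℝ) ^ (-t) * powGap k t := by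
        rw [integral_add (integrable_finsetSum _ hint) hintN, integral_finsetSum _ hint,
          integral_const_mul]
    _ ≤ ∑ d ∈ Icc 1 N, 49 * √(x / d) / D + 4 * x * (49 * 2 / D) := by
        refine add_le_add (sum_le_sum hw) (mul_le_mul_of_nonneg_left ?_ (by linarith))
        refine (hw N (mem_Icc.2 ⟨hN1, le_rfl⟩)).trans ?_
        gcongr
        refine Real.sqrt_le_iff.2 ⟨by norm_num, ?_⟩
        rw [div_le_iff₀ (by linarith)]
        linarith
    _ = (49 * ∑ d ∈ Icc 1 N, √(x / d) + 392 * x) / D := by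
        rw [← sum_div, ← mul_sum]; ring
    _ ≤ 500 * x / D := by
        gcongr
        linarith [sum_sqrt_div_le x hx]
end

section
/- Let (a_k)_{k≥1} be a sequence of complex numbers and C ∈ ℂ such that A(n) = Σ_{k≤n} a_k ⌊n/k⌋ = Cn + o(n) as n → ∞. Then S(n) = Σ_{k≤n} a_k ⌊n/k⌋ log k = o(n log n) as n → ∞. -/
open Filter Finset

/-- The logarithm as a complex-valued arithmetic function. -/
noncomputable def complexLog : ArithmeticFunction ℂ :=
  ⟨fun n => (Real.log n : ℂ), by simp⟩

lemma complexLog_apply (n : ℕ) : complexLog n = (Real.log n : ℂ) := rfl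

/-- The von Mangoldt function as a complex-valued arithmetic function. -/
noncomputable def complexVonMangoldt : ArithmeticFunction ℂ :=
  ⟨fun n => (ArithmeticFunction.vonMangoldt n : ℂ), by simp⟩

lemma complexVonMangoldt_mul_zeta :
    complexVonMangoldt * (ArithmeticFunction.zeta : ArithmeticFunction ℂ) = complexLog := by
  ext n
  have h := congrArg (fun f : ArithmeticFunction ℝ => ((f n : ℝ) : ℂ))
    ArithmeticFunction.vonMangoldt_mul_zeta
  simp only [ArithmeticFunction.coe_mul_zeta_apply, ArithmeticFunction.log_apply,
    Complex.ofReal_sum] at h ⊢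
  exact h

/-- Pointwise multiplication by `log` is a derivation on the Dirichlet ring; here it is applied
to `f * ζ`. -/
lemma pmul_log_mul_zeta (f : ArithmeticFunction ℂ) :
    f.pmul complexLog * (ArithmeticFunction.zeta : ArithmeticFunction ℂ) +
      complexVonMangoldt * (f * (ArithmeticFunction.zeta : ArithmeticFunction ℂ)) =
      (f * (ArithmeticFunction.zeta : ArithmeticFunction ℂ)).pmul complexLog := by
  have h : complexVonMangoldt * (f * (ArithmeticFunction.zeta : ArithmeticFunction ℂ)) =
      f * complexLog := by
    rw [← complexVonMangoldt_mul_zeta]; ring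
  rw [h]
  ext n
  simp only [ArithmeticFunction.add_apply, ArithmeticFunction.mul_apply,
    ArithmeticFunction.pmul_apply, ← sum_add_distrib, sum_mul]
  refine sum_congr rfl fun x hx => ?_
  obtain ⟨hx, hn⟩ := Nat.mem_divisorsAntidiagonal.mp hx
  have h1 : x.1 ≠ 0 := by rintro h; simp [h] at hx; exact hn hx.symm
  have h2 : x.2 ≠ 0 := by rintro h; simp [h] at hx; exact hn hx.symm
  have hlog : complexLog n = complexLog x.1 + complexLog x.2 := by
    simp only [complexLog_apply, ← hx, Nat.cast_mul]
    rw [Real.log_mul (by exact_mod_cast h1) (by exact_mod_cast h2), Complex.ofReal_add]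
  rw [hlog, ArithmeticFunction.natCoe_apply, ArithmeticFunction.zeta_apply_ne h2]
  push_cast
  ring

lemma sum_vonMangoldt_mul_div_le (n : ℕ) :
    ∑ d ∈ Ioc 0 n, ArithmeticFunction.vonMangoldt d * ((n / d : ℕ) : ℝ) ≤ n * Real.log n := by
  rw [← ArithmeticFunction.sum_Ioc_mul_zeta_eq_sum, ArithmeticFunction.vonMangoldt_mul_zeta]
  calc ∑ m ∈ Ioc 0 n, ArithmeticFunction.log m ≤ ∑ _m ∈ Ioc 0 n, Real.log n := by
        refine sum_le_sum fun m hm => ?_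
        obtain ⟨h0, h1⟩ := mem_Ioc.mp hm
        exact Real.log_le_log (by exact_mod_cast h0) (by exact_mod_cast h1)
    _ = n * Real.log n := by simp

/-- Partial summation against `log`. -/
lemma norm_sum_mul_log_sub_le (b : ℕ → ℂ) {ε K : ℝ} (hε : 0 ≤ ε)
    (hb : ∀ n : ℕ, ‖∑ m ∈ Ioc 0 n, b m‖ ≤ ε * n + K) (n : ℕ) :
    ‖∑ m ∈ Ioc 0 n, b m * (Real.log m : ℂ) - (∑ m ∈ Ioc 0 n, b m) * (Real.log n : ℂ)‖ ≤
      (ε * n + K) * Real.log n := by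
  induction n with
  | zero => simp
  | succ n ih =>
    rw [sum_Ioc_succ_top (Nat.zero_le n), sum_Ioc_succ_top (Nat.zero_le n)]
    have hlog : Real.log n ≤ Real.log (n + 1 : ℕ) := by
      rcases n.eq_zero_or_pos with rfl | h
      · simp
      · exact Real.log_le_log (by exact_mod_cast h) (by push_cast; linarith)
    have h0 : 0 ≤ Real.log (n + 1 : ℕ) := Real.log_natCast_nonneg _
    have hnorm : ‖((Real.log (n + 1 : ℕ) - Real.log n : ℝ) : ℂ)‖ =
        Real.log (n + 1 : ℕ) - Real.log n := by
      rw [Complex.norm_real, Real.norm_of_nonneg (sub_nonneg.mpr hlog)]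
    calc _ = ‖(∑ m ∈ Ioc 0 n, b m * (Real.log m : ℂ) -
              (∑ m ∈ Ioc 0 n, b m) * (Real.log n : ℂ)) -
            (∑ m ∈ Ioc 0 n, b m) * ((Real.log (n + 1 : ℕ) - Real.log n : ℝ) : ℂ)‖ := by
          congr 1; rw [Complex.ofReal_sub]; ring
      _ ≤ (ε * n + K) * Real.log n + (ε * n + K) * (Real.log (n + 1 : ℕ) - Real.log n) := by
          refine (norm_sub_le _ _).trans (add_le_add ih ?_)
          rw [norm_mul, hnorm]
          exact mul_le_mul_of_nonneg_right (hb n) (sub_nonneg.mpr hlog)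
      _ ≤ (ε * (n + 1 : ℕ) + K) * Real.log (n + 1 : ℕ) := by
          push_cast at h0 ⊢
          nlinarith [mul_nonneg hε h0]

lemma norm_sum_vonMangoldt_mul_le (A : ℕ → ℂ) {ε K : ℝ} (hε : 0 ≤ ε) (hK : 0 ≤ K)
    (hA : ∀ n : ℕ, ‖A n‖ ≤ ε * n + K) (n : ℕ) :
    ‖∑ d ∈ Ioc 0 n, complexVonMangoldt d * A (n / d)‖ ≤
      ε * (n * Real.log n) + K * ((Real.log 4 + 4) * n) := by
  have hpsi : ∑ d ∈ Ioc 0 n, ArithmeticFunction.vonMangoldt d ≤ (Real.log 4 + 4) * n := by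
    simpa [Chebyshev.psi] using Chebyshev.psi_le_const_mul_self (Nat.cast_nonneg (α := ℝ) n)
  calc ‖∑ d ∈ Ioc 0 n, complexVonMangoldt d * A (n / d)‖
      ≤ ∑ d ∈ Ioc 0 n, ArithmeticFunction.vonMangoldt d * (ε * ((n / d : ℕ) : ℝ) + K) := by
        refine norm_sum_le_of_le _ fun d _ => ?_
        rw [norm_mul]
        have : ‖complexVonMangoldt d‖ = ArithmeticFunction.vonMangoldt d := by
          simp [complexVonMangoldt, abs_of_nonneg]
        rw [this]
        exact mul_le_mul_of_nonneg_left (hA _) ArithmeticFunction.vonMangoldt_nonneg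
    _ = ε * ∑ d ∈ Ioc 0 n, ArithmeticFunction.vonMangoldt d * ((n / d : ℕ) : ℝ) +
          K * ∑ d ∈ Ioc 0 n, ArithmeticFunction.vonMangoldt d := by
        rw [mul_sum, mul_sum, ← sum_add_distrib]
        exact sum_congr rfl fun d _ => by ring
    _ ≤ _ := add_le_add (mul_le_mul_of_nonneg_left (sum_vonMangoldt_mul_div_le n) hε)
        (mul_le_mul_of_nonneg_left hpsi hK)

lemma norm_sum_mul_div_mul_log_le (f : ArithmeticFunction ℂ) {ε K : ℝ} (hε : 0 ≤ ε) (hK : 0 ≤ K)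
    (hA : ∀ n : ℕ, ‖∑ k ∈ Ioc 0 n, f k * ((n / k : ℕ) : ℂ)‖ ≤ ε * n + K) (n : ℕ) :
    ‖∑ k ∈ Ioc 0 n, f k * ((n / k : ℕ) : ℂ) * (Real.log k : ℂ)‖ ≤
      3 * ε * (n * Real.log n) + 2 * K * Real.log n + K * (Real.log 4 + 4) * n := by
  set g := f * (ArithmeticFunction.zeta : ArithmeticFunction ℂ) with hg
  have hsum : ∀ n : ℕ, ‖∑ m ∈ Ioc 0 n, g m‖ ≤ ε * n + K := fun n => by
    rw [hg, ArithmeticFunction.sum_Ioc_mul_zeta_eq_sum]; exact hA n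
  have hS : ∑ k ∈ Ioc 0 n, f k * ((n / k : ℕ) : ℂ) * (Real.log k : ℂ) =
      (∑ m ∈ Ioc 0 n, g m * (Real.log m : ℂ) - (∑ m ∈ Ioc 0 n, g m) * (Real.log n : ℂ)) +
        (∑ m ∈ Ioc 0 n, g m) * (Real.log n : ℂ) -
      ∑ d ∈ Ioc 0 n, complexVonMangoldt d * ∑ m ∈ Ioc 0 (n / d), g m := by
    have h1 : ∑ k ∈ Ioc 0 n, f k * ((n / k : ℕ) : ℂ) * (Real.log k : ℂ) =
        ∑ m ∈ Ioc 0 n, (f.pmul complexLog *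
          (ArithmeticFunction.zeta : ArithmeticFunction ℂ)) m := by
      rw [ArithmeticFunction.sum_Ioc_mul_zeta_eq_sum]
      exact sum_congr rfl fun k _ => by
        rw [ArithmeticFunction.pmul_apply, complexLog_apply]; ring
    rw [h1, ← ArithmeticFunction.sum_Ioc_mul_eq_sum_sum, sub_add_cancel, ← sum_sub_distrib]
    refine sum_congr rfl fun m _ => ?_
    have h2 := congrArg (fun F : ArithmeticFunction ℂ => F m) (pmul_log_mul_zeta f)
    simp only [ArithmeticFunction.add_apply] at h2
    exact eq_sub_of_add_eq h2
  have hlog : ‖(Real.log n : ℂ)‖ = Real.log n := by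
    rw [Complex.norm_real, Real.norm_of_nonneg (Real.log_natCast_nonneg n)]
  have h3 : ‖(∑ m ∈ Ioc 0 n, g m) * (Real.log n : ℂ)‖ ≤ (ε * n + K) * Real.log n := by
    rw [norm_mul, hlog]
    exact mul_le_mul_of_nonneg_right (hsum n) (Real.log_natCast_nonneg n)
  rw [hS]
  have h1 := norm_sum_mul_log_sub_le g hε hsum n
  have h2 := norm_sum_vonMangoldt_mul_le (fun m => ∑ k ∈ Ioc 0 m, g k) hε hK hsum n
  grw [norm_sub_le, norm_add_le, h1, h2, h3]
  apply le_of_eq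
  ring

lemma exists_norm_le_mul_add_of_isLittleO {A : ℕ → ℂ}
    (hA : A =o[atTop] (fun n : ℕ => (n : ℝ))) {ε : ℝ} (hε : 0 < ε) :
    ∃ K, 0 ≤ K ∧ ∀ n : ℕ, ‖A n‖ ≤ ε * n + K := by
  obtain ⟨N, hN⟩ := eventually_atTop.mp (hA.def hε)
  have hK : 0 ≤ ∑ m ∈ range N, ‖A m‖ := sum_nonneg fun _ _ => norm_nonneg _
  refine ⟨∑ m ∈ range N, ‖A m‖, hK, fun n => ?_⟩
  rcases lt_or_ge n N with h | h
  · have h1 := single_le_sum (f := fun m => ‖A m‖) (fun _ _ => norm_nonneg _) (mem_range.mpr h)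
    have h2 : 0 ≤ ε * (n : ℝ) := by positivity
    linarith
  · have h1 := hN n h
    rw [Real.norm_of_nonneg (Nat.cast_nonneg n)] at h1
    linarith

lemma isLittleO_sum_mul_div_mul_log (f : ArithmeticFunction ℂ)
    (hA : (fun n : ℕ => ∑ k ∈ Ioc 0 n, f k * ((n / k : ℕ) : ℂ)) =o[atTop]
      (fun n : ℕ => (n : ℝ))) :
    (fun n : ℕ => ∑ k ∈ Ioc 0 n, f k * ((n / k : ℕ) : ℂ) * (Real.log k : ℂ))
      =o[atTop] (fun n : ℕ => (n : ℝ) * Real.log n) := by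
  refine Asymptotics.isLittleO_iff.mpr fun c hc => ?_
  obtain ⟨K, hK, hbound⟩ := exists_norm_le_mul_add_of_isLittleO hA (ε := c / 9) (by positivity)
  have hlog : Tendsto (fun n : ℕ => Real.log n) atTop atTop :=
    Real.tendsto_log_atTop.comp tendsto_natCast_atTop_atTop
  filter_upwards [hlog.eventually_ge_atTop (K * (Real.log 4 + 4) / (c / 3)),
    tendsto_natCast_atTop_atTop.eventually_ge_atTop (2 * K / (c / 3))] with n h1 h2
  have hn : (0 : ℝ) ≤ n := Nat.cast_nonneg n
  have hl : 0 ≤ Real.log n := Real.log_natCast_nonneg n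
  rw [Real.norm_of_nonneg (mul_nonneg hn hl)]
  rw [div_le_iff₀ (by positivity)] at h1 h2
  have h := norm_sum_mul_div_mul_log_le f (by positivity) hK hbound n
  nlinarith [mul_le_mul_of_nonneg_right h1 hn, mul_le_mul_of_nonneg_right h2 hl]

/-- If `A(n) = Σ_{k≤n} a_k ⌊n/k⌋ = Cn + o(n)`, then
`S(n) = Σ_{k≤n} a_k ⌊n/k⌋ log k = o(n log n)`. -/
theorem stmt_11 (a : ℕ → ℂ) (C : ℂ)
    (hA : (fun n : ℕ => (∑ k ∈ Finset.Icc 1 n, a k * ((n / k : ℕ) : ℂ)) - C * n)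
      =o[atTop] (fun n : ℕ => (n : ℝ))) :
    (fun n : ℕ => ∑ k ∈ Finset.Icc 1 n, a k * ((n / k : ℕ) : ℂ) * (Real.log k : ℂ))
      =o[atTop] (fun n : ℕ => (n : ℝ) * Real.log n) := by
  -- Subtracting `C` from `a 1` reduces to the case `C = 0` and does not change `S`.
  let f : ArithmeticFunction ℂ :=
    ⟨fun k => if k = 0 then 0 else a k - if k = 1 then C else 0, by simp⟩
  have hf : ∀ k, k ≠ 0 → f k = a k - if k = 1 then C else 0 := fun k hk => by
    simp [f, hk]
  have hIcc : ∀ n : ℕ, Icc 1 n = Ioc 0 n := fun n => rfl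
  refine (isLittleO_sum_mul_div_mul_log f (hA.congr_left fun n => ?_)).congr_left fun n => ?_
  · symm
    rw [hIcc, sum_congr rfl fun k hk => by rw [hf k (mem_Ioc.mp hk).1.ne', sub_mul],
      sum_sub_distrib]
    congr 1
    rcases n.eq_zero_or_pos with rfl | hn
    · simp
    · rw [sum_eq_single_of_mem 1 (by simp; omega) fun k _ hk => by simp [hk]]
      simp
  · rw [hIcc]
    refine sum_congr rfl fun k hk => ?_
    rw [hf k (mem_Ioc.mp hk).1.ne']
    by_cases h : k = 1 <;> simp [h]
end

section
/- For all integers n ≥ 1 and k ≥ 2, Σ_{m : 1 ≤ m ≤ n, k ∣ m} ⌊n/m⌋ μ(m/k)/log m = ∫_0^∞ F_t(n/k) k^{−t} dt. -/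
open Filter Finset

theorem Ft_natCast_div (t : ℝ) (n k : ℕ) :
    Ft t ((n : ℝ) / k) = ∑ d ∈ Icc 1 (n / k),
      ((n / k / d : ℕ) : ℝ) * (ArithmeticFunction.moebius d : ℝ) / (d : ℝ) ^ t := by
  simp only [Ft, ft, Nat.floor_div_eq_div]
  rw [sum_comm' (t' := Icc 1 (n / k)) (s' := fun d => (Ioc 0 (n / k)).filter (d ∣ ·))]
  · refine sum_congr rfl fun d _ => ?_
    rw [sum_const, Nat.Ioc_filter_dvd_card_eq_div, nsmul_eq_mul, mul_div_assoc]
  · intro m d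
    simp only [mem_Icc, Nat.mem_divisors, mem_filter, mem_Ioc]
    constructor
    · rintro ⟨⟨h1, h2⟩, h3, h4⟩
      exact ⟨⟨⟨h1, h2⟩, h3⟩, Nat.pos_of_dvd_of_pos h3 h1, (Nat.le_of_dvd h1 h3).trans h2⟩
    · rintro ⟨⟨⟨h1, h2⟩, h3⟩, -⟩
      exact ⟨⟨h1, h2⟩, h3, h1.ne'⟩

theorem inv_rpow_eq_exp {a : ℝ} (ha : 1 < a) (t : ℝ) :
    (a ^ t)⁻¹ = Real.exp (-Real.log a * t) := by
  rw [Real.rpow_def_of_pos (by linarith), ← Real.exp_neg, neg_mul]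

theorem integrableOn_inv_rpow_Ioi {a : ℝ} (ha : 1 < a) :
    MeasureTheory.IntegrableOn (fun t : ℝ => (a ^ t)⁻¹) (Set.Ioi 0) := by
  simp only [inv_rpow_eq_exp ha]
  exact integrableOn_exp_mul_Ioi (neg_lt_zero.2 (Real.log_pos ha)) 0

theorem integral_inv_rpow_Ioi {a : ℝ} (ha : 1 < a) :
    ∫ t in Set.Ioi (0 : ℝ), (a ^ t)⁻¹ = (Real.log a)⁻¹ := by
  simp only [inv_rpow_eq_exp ha]
  rw [integral_exp_mul_Ioi (neg_lt_zero.2 (Real.log_pos ha)) 0]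
  simp [neg_div_neg_eq]

theorem sum_filter_dvd_Icc {M : Type*} [AddCommMonoid M] (f : ℕ → M) (n : ℕ) {k : ℕ}
    (hk : 0 < k) :
    ∑ m ∈ (Icc 1 n).filter (k ∣ ·), f m = ∑ d ∈ Icc 1 (n / k), f (k * d) := by
  symm
  refine sum_nbij (k * ·) ?_ (fun a _ b _ h => Nat.eq_of_mul_eq_mul_left hk h) ?_ (fun _ _ => rfl)
  · intro d hd
    rw [mem_Icc, Nat.le_div_iff_mul_le hk] at hd
    simp only [mem_filter, mem_Icc]
    exact ⟨⟨Nat.mul_pos hk hd.1, by rw [mul_comm]; exact hd.2⟩, dvd_mul_right k d⟩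
  · intro m hm
    simp only [coe_filter, mem_Icc, Set.mem_ofPred_eq] at hm
    obtain ⟨⟨h1, h2⟩, d, rfl⟩ := hm
    refine ⟨d, ?_, rfl⟩
    rw [coe_Icc, Set.mem_Icc, Nat.le_div_iff_mul_le hk, mul_comm d]
    exact ⟨Nat.pos_of_mul_pos_left h1, h2⟩

/-- For all integers `n ≥ 1` and `k ≥ 2`,
`Σ_{1≤m≤n, k∣m} ⌊n/m⌋ μ(m/k)/log m = ∫_0^∞ F_t(n/k) k^{−t} dt`. -/
theorem stmt_14 (n k : ℕ) (hn : 1 ≤ n) (hk : 2 ≤ k) :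
    ∑ m ∈ (Finset.Icc 1 n).filter (fun m => k ∣ m),
        ((n / m : ℕ) : ℝ) * (ArithmeticFunction.moebius (m / k) : ℝ) / Real.log m =
      ∫ t in Set.Ioi (0 : ℝ), Ft t ((n : ℝ) / k) / (k : ℝ) ^ t := by
  have hk0 : 0 < k := by omega
  have one_lt : ∀ d ∈ Icc 1 (n / k), (1 : ℝ) < (k * d : ℕ) := fun d hd => by
    have := (mem_Icc.1 hd).1
    exact_mod_cast (by nlinarith : 1 < k * d)
  have integrand_eq : ∀ t : ℝ, Ft t ((n : ℝ) / k) / (k : ℝ) ^ t = ∑ d ∈ Icc 1 (n / k),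
      ((n / k / d : ℕ) : ℝ) * (ArithmeticFunction.moebius d : ℝ) *
        (((k * d : ℕ) : ℝ) ^ t)⁻¹ := fun t => by
    rw [Ft_natCast_div, sum_div]
    refine sum_congr rfl fun d _ => ?_
    rw [Nat.cast_mul, Real.mul_rpow (by positivity) (by positivity), div_div,
      mul_comm ((d : ℝ) ^ t), div_eq_mul_inv]
  simp only [integrand_eq]
  rw [MeasureTheory.integral_finsetSum _ fun d hd =>
      (integrableOn_inv_rpow_Ioi (one_lt d hd)).const_mul _,
    sum_filter_dvd_Icc _ n hk0]
  refine sum_congr rfl fun d hd => ?_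
  rw [MeasureTheory.integral_const_mul, integral_inv_rpow_Ioi (one_lt d hd),
    Nat.mul_div_cancel_left d hk0, Nat.div_div_eq_div_mul, div_eq_mul_inv]
end

section
/- For every integer k ≥ 2 and every real σ > 1, Σ_{m : k ∣ m} μ(m/k)/(m^σ log m) = ∫_σ^∞ du/(k^u ζ(u)); i.e. Σ_{d=1}^∞ μ(d)/(k^σ d^σ log(kd)) = ∫_σ^∞ du/(k^u ζ(u)). -/
open Filter Finset

/-- The Dirichlet series of `1 / ζ` at a real point `u > 1`, scaled by `k ^ (-u)`. -/
theorem tsum_moebius_mul_exp_eq (k : ℕ) (hk : 0 < k) (u : ℝ) (hu : 1 < u) :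
    ∑' d : ℕ, (((ArithmeticFunction.moebius (d + 1) : ℝ) *
        Real.exp (-Real.log ((k * (d + 1) : ℕ) : ℝ) * u) : ℝ) : ℂ) =
      1 / ((k : ℂ) ^ (u : ℂ) * riemannZeta u) := by
  have hre : 1 < (u : ℂ).re := by simpa using hu
  have hsum := ArithmeticFunction.LSeriesSummable_moebius_iff.mpr hre
  have hk0 : (0 : ℝ) < k := by exact_mod_cast hk
  have hterm (d : ℕ) : (((ArithmeticFunction.moebius (d + 1) : ℝ) *
        Real.exp (-Real.log ((k * (d + 1) : ℕ) : ℝ) * u) : ℝ) : ℂ) =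
      ((k : ℂ) ^ (u : ℂ))⁻¹ *
        LSeries.term (fun n ↦ (ArithmeticFunction.moebius n : ℂ)) u (d + 1) := by
    have hd : (0 : ℝ) < ((d + 1 : ℕ) : ℝ) := by positivity
    have hexp : Real.exp (-Real.log ((k * (d + 1) : ℕ) : ℝ) * u) =
        ((k : ℝ) ^ u)⁻¹ * (((d + 1 : ℕ) : ℝ) ^ u)⁻¹ := by
      rw [Nat.cast_mul, Real.log_mul hk0.ne' hd.ne', Real.rpow_def_of_pos hk0,
        Real.rpow_def_of_pos hd, ← Real.exp_neg, ← Real.exp_neg, ← Real.exp_add]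
      ring_nf
    rw [hexp, LSeries.term_of_ne_zero d.succ_ne_zero]
    simp only [Complex.ofReal_mul, Complex.ofReal_inv, Complex.ofReal_cpow hk0.le,
      Complex.ofReal_cpow hd.le, Complex.ofReal_natCast, Complex.ofReal_intCast]
    ring
  have hL : ∑' d : ℕ, LSeries.term (fun n ↦ (ArithmeticFunction.moebius n : ℂ)) u (d + 1) =
      (riemannZeta u)⁻¹ := by
    have h0 := hsum.tsum_eq_zero_add
    rw [LSeries.term_zero, zero_add] at h0
    have h1 := ArithmeticFunction.LSeries_zeta_mul_Lseries_moebius hre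
    rw [ArithmeticFunction.LSeries_zeta_eq_riemannZeta hre] at h1
    rw [← h0]
    exact eq_inv_of_mul_eq_one_right h1
  simp_rw [hterm]
  rw [tsum_mul_left, hL, one_div, mul_inv]

/-- For every integer `k ≥ 2` and every real `σ > 1`,
`Σ_{d=1}^∞ μ(d)/(k^σ d^σ log(kd)) = ∫_σ^∞ du/(k^u ζ(u))`. -/
theorem stmt_15 (k : ℕ) (hk : 2 ≤ k) (σ : ℝ) (hσ : 1 < σ) :
    Complex.ofReal (∑' d : ℕ, (ArithmeticFunction.moebius (d + 1) : ℝ) /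
        ((k : ℝ) ^ σ * ((d + 1 : ℕ) : ℝ) ^ σ * Real.log ((k * (d + 1) : ℕ) : ℝ))) =
      ∫ u in Set.Ioi σ, 1 / ((k : ℂ) ^ (u : ℂ) * riemannZeta u) := by
  have hk0 : (0 : ℝ) < k := by positivity
  have hk1 : (1 : ℝ) ≤ k := by exact_mod_cast (by omega : 1 ≤ k)
  have hlog2 : 0 < Real.log 2 := Real.log_pos one_lt_two
  have hlog (d : ℕ) : Real.log 2 ≤ Real.log ((k * (d + 1) : ℕ) : ℝ) :=
    Real.log_le_log two_pos (by exact_mod_cast (by nlinarith : 2 ≤ k * (d + 1)))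
  have hneg (d : ℕ) : -Real.log ((k * (d + 1) : ℕ) : ℝ) < 0 := by linarith [hlog d]
  have hint (d : ℕ) : ∫ u in Set.Ioi σ, Real.exp (-Real.log ((k * (d + 1) : ℕ) : ℝ) * u) =
      1 / ((k : ℝ) ^ σ * ((d + 1 : ℕ) : ℝ) ^ σ * Real.log ((k * (d + 1) : ℕ) : ℝ)) := by
    have hd : (0 : ℝ) < ((k * (d + 1) : ℕ) : ℝ) := by positivity
    rw [integral_exp_mul_Ioi (hneg d), ← Real.mul_rpow hk0.le (Nat.cast_nonneg _),
      ← Nat.cast_mul, Real.rpow_def_of_pos hd, neg_div_neg_eq, neg_mul, Real.exp_neg, one_div,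
      mul_inv, div_eq_mul_inv]
  let F (d : ℕ) (u : ℝ) : ℂ := (((ArithmeticFunction.moebius (d + 1) : ℝ) *
    Real.exp (-Real.log ((k * (d + 1) : ℕ) : ℝ) * u) : ℝ) : ℂ)
  have hF_int (d : ℕ) : MeasureTheory.Integrable (F d)
      (MeasureTheory.volume.restrict (Set.Ioi σ)) :=
    ((integrableOn_exp_mul_Ioi (hneg d) σ).const_mul _).ofReal
  have hF_sum : Summable fun d ↦ ∫ u in Set.Ioi σ, ‖F d u‖ := by
    have hs : Summable fun d : ℕ ↦ 1 / ((d + 1 : ℕ) : ℝ) ^ σ :=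
      (summable_nat_add_iff 1).mpr (Real.summable_one_div_nat_rpow.mpr hσ)
    refine (hs.mul_right (1 / Real.log 2)).of_nonneg_of_le
      (fun d ↦ MeasureTheory.integral_nonneg fun u ↦ norm_nonneg _) fun d ↦ ?_
    have hnorm (u : ℝ) : ‖F d u‖ = |(ArithmeticFunction.moebius (d + 1) : ℝ)| *
        Real.exp (-Real.log ((k * (d + 1) : ℕ) : ℝ) * u) := by
      simp only [F, Complex.norm_real, Real.norm_eq_abs, abs_mul, Real.abs_exp]
    have hμ : |(ArithmeticFunction.moebius (d + 1) : ℝ)| ≤ 1 := by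
      exact_mod_cast ArithmeticFunction.abs_moebius_le_one (n := d + 1)
    have hkσ : 1 ≤ (k : ℝ) ^ σ := Real.one_le_rpow hk1 (by linarith)
    have hdσ : 0 < ((d + 1 : ℕ) : ℝ) ^ σ := Real.rpow_pos_of_pos (by positivity) _
    have hlogd := hlog d
    have hlogpos := hlog2.trans_le hlogd
    simp_rw [hnorm]
    rw [MeasureTheory.integral_const_mul, hint, one_div_mul_one_div]
    refine (mul_le_of_le_one_left (by positivity) hμ).trans ?_
    gcongr
    exact le_mul_of_one_le_left hdσ.le hkσ
  rw [Complex.ofReal_tsum]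
  calc _ = ∑' d, ∫ u in Set.Ioi σ, F d u := by
        refine tsum_congr fun d ↦ ?_
        simp only [F]
        rw [integral_complex_ofReal, MeasureTheory.integral_const_mul, hint, mul_one_div]
    _ = ∫ u in Set.Ioi σ, ∑' d, F d u :=
        MeasureTheory.integral_tsum_of_summable_integral_norm hF_int hF_sum
    _ = _ := MeasureTheory.setIntegral_congr_fun measurableSet_Ioi fun u hu ↦
        tsum_moebius_mul_exp_eq k (by omega) u (hσ.trans hu)
end

section
/- Let f : ℕ → ℂ be completely multiplicative and let (a_k) be the unique sequence (given by Möbius inversion) with f(m) = Σ_{d∣m} a_d for all m. Then for every integer m ≥ 1, S(m) = Σ_{k≤m} (f(k) − 1) Λ(k) Σ_{ℓ≤⌊m/k⌋} f(ℓ). -/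
open Filter Finset

/-- `S a n = Σ_{k≤n} a_k ⌊n/k⌋ log k`. -/
noncomputable def S (a : ℕ → ℂ) (n : ℕ) : ℂ :=
  ∑ k ∈ Finset.Icc 1 n, a k * ((n / k : ℕ) : ℂ) * (Real.log k : ℂ)

namespace ArithmeticFunction

/-- Turn a function on `ℕ` into an arithmetic function by setting its value at `0` to `0`. -/
def ofNatFun {R : Type*} [Zero R] (g : ℕ → R) : ArithmeticFunction R :=
  ⟨fun n => if n = 0 then 0 else g n, if_pos rfl⟩

theorem ofNatFun_apply {R : Type*} [Zero R] (g : ℕ → R) {n : ℕ} (hn : n ≠ 0) :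
    ofNatFun g n = g n := if_neg hn

/-- Multiplication by a completely additive function is a derivation for Dirichlet convolution. -/
theorem pmul_mul_of_completely_additive {R : Type*} [CommSemiring R] {L : ArithmeticFunction R}
    (hL : ∀ m n : ℕ, m ≠ 0 → n ≠ 0 → L (m * n) = L m + L n) (g h : ArithmeticFunction R) :
    pmul L (g * h) = pmul L g * h + g * pmul L h := by
  ext n
  simp only [pmul_apply, mul_apply, add_apply, Finset.mul_sum, ← Finset.sum_add_distrib]
  refine Finset.sum_congr rfl fun x hx => ?_
  obtain ⟨rfl, hn⟩ := Nat.mem_divisorsAntidiagonal.1 hx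
  rw [hL _ _ (left_ne_zero_of_mul hn) (right_ne_zero_of_mul hn)]
  ring

/-- Multiplication by a completely multiplicative function distributes over Dirichlet
convolution. -/
theorem pmul_mul_of_completely_multiplicative {R : Type*} [CommSemiring R]
    {F : ArithmeticFunction R} (hF : ∀ m n : ℕ, m ≠ 0 → n ≠ 0 → F (m * n) = F m * F n)
    (g h : ArithmeticFunction R) :
    pmul F (g * h) = pmul F g * pmul F h := by
  ext n
  simp only [pmul_apply, mul_apply, Finset.mul_sum]
  refine Finset.sum_congr rfl fun x hx => ?_
  obtain ⟨rfl, hn⟩ := Nat.mem_divisorsAntidiagonal.1 hx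
  rw [hF _ _ (left_ne_zero_of_mul hn) (right_ne_zero_of_mul hn)]
  ring

/-- If `F = A * ζ` is completely multiplicative and `L = V * ζ` is completely additive, then
`(L A) * ζ = (F V - V) * F`. -/
theorem pmul_mul_zeta_eq {R : Type*} [CommRing R] {F A L V : ArithmeticFunction R}
    (hF : ∀ m n : ℕ, m ≠ 0 → n ≠ 0 → F (m * n) = F m * F n)
    (hL : ∀ m n : ℕ, m ≠ 0 → n ≠ 0 → L (m * n) = L m + L n)
    (hA : A * (zeta : ArithmeticFunction R) = F) (hV : V * (zeta : ArithmeticFunction R) = L) :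
    pmul L A * (zeta : ArithmeticFunction R) = (pmul F V - V) * F := by
  have h₁ : pmul L F = pmul L A * (zeta : ArithmeticFunction R) + V * F := by
    rw [← hA, pmul_mul_of_completely_additive hL, pmul_zeta, ← hV]
    ring
  have h₂ : pmul L F = pmul F V * F := by
    rw [pmul_comm, ← hV, pmul_mul_of_completely_multiplicative hF, pmul_zeta]
  rw [sub_mul, ← h₂, h₁, add_sub_cancel_right]

end ArithmeticFunction

open ArithmeticFunction in
/-- Let `f` be completely multiplicative and `a` the sequence with
`f(m) = Σ_{d∣m} a_d`. Then for every `m ≥ 1`,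
`S(m) = Σ_{k≤m} (f(k) − 1) Λ(k) Σ_{ℓ≤⌊m/k⌋} f(ℓ)`. -/
theorem stmt_16 (f : ℕ → ℂ) (hf1 : f 1 = 1) (hf : ∀ m n : ℕ, f (m * n) = f m * f n)
    (a : ℕ → ℂ) (ha : ∀ m : ℕ, 1 ≤ m → f m = ∑ d ∈ m.divisors, a d)
    (m : ℕ) (hm : 1 ≤ m) :
    S a m = ∑ k ∈ Finset.Icc 1 m, (f k - 1) * (ArithmeticFunction.vonMangoldt k : ℂ) *
      ∑ l ∈ Finset.Icc 1 (m / k), f l := by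
  have hF : ∀ k n : ℕ, k ≠ 0 → n ≠ 0 → ofNatFun f (k * n) = ofNatFun f k * ofNatFun f n := by
    intro k n hk hn
    rw [ofNatFun_apply f hk, ofNatFun_apply f hn, ofNatFun_apply f (mul_ne_zero hk hn), hf]
  let L : ArithmeticFunction ℂ := ofNatFun fun n => (Real.log n : ℂ)
  let V : ArithmeticFunction ℂ := ofNatFun fun n => (vonMangoldt n : ℂ)
  have hL : ∀ k n : ℕ, k ≠ 0 → n ≠ 0 → L (k * n) = L k + L n := by
    intro k n hk hn
    rw [ofNatFun_apply _ hk, ofNatFun_apply _ hn, ofNatFun_apply _ (mul_ne_zero hk hn),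
      Nat.cast_mul, Real.log_mul (by exact_mod_cast hk) (by exact_mod_cast hn), Complex.ofReal_add]
  have hA : ofNatFun a * (zeta : ArithmeticFunction ℂ) = ofNatFun f := by
    ext n
    rcases eq_or_ne n 0 with rfl | hn
    · simp
    rw [coe_mul_zeta_apply, ofNatFun_apply f hn, ha n (Nat.one_le_iff_ne_zero.2 hn)]
    exact Finset.sum_congr rfl fun d hd => ofNatFun_apply a (Nat.pos_of_mem_divisors hd).ne'
  have hV : V * (zeta : ArithmeticFunction ℂ) = L := by
    ext n
    rcases eq_or_ne n 0 with rfl | hn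
    · simp
    rw [coe_mul_zeta_apply, ofNatFun_apply _ hn, ← vonMangoldt_sum, Complex.ofReal_sum]
    exact Finset.sum_congr rfl fun d hd => ofNatFun_apply _ (Nat.pos_of_mem_divisors hd).ne'
  have key := congrArg (fun g : ArithmeticFunction ℂ => ∑ n ∈ Finset.Ioc 0 m, g n)
    (pmul_mul_zeta_eq hF hL hA hV)
  simp only [sum_Ioc_mul_zeta_eq_sum] at key
  rw [sum_Ioc_mul_eq_sum_sum] at key
  have hIcc (n : ℕ) : Finset.Icc 1 n = Finset.Ioc 0 n := rfl
  simp only [S, hIcc]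
  refine (Finset.sum_congr rfl fun k hk => ?_).trans
    (key.trans (Finset.sum_congr rfl fun k hk => ?_))
  · have hk0 : k ≠ 0 := (Finset.mem_Ioc.1 hk).1.ne'
    rw [pmul_apply, ofNatFun_apply _ hk0, ofNatFun_apply _ hk0]
    ring
  · have hk0 : k ≠ 0 := (Finset.mem_Ioc.1 hk).1.ne'
    rw [sub_eq_add_neg, ArithmeticFunction.add_apply, ArithmeticFunction.neg_apply, pmul_apply, ofNatFun_apply _ hk0,
      ofNatFun_apply _ hk0, Finset.sum_congr rfl fun l hl =>
        ofNatFun_apply f (Finset.mem_Ioc.1 hl).1.ne']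
    ring
end
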